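/- Let λ ⊆ [-1,1]² be a rectifiable Jordan curve which is the concatenation λ = λ₁ * λ₂ of two simple curves, where λ₁ ⊆ ∂[-1,1]² and every point of λ₂ except its two endpoints lies in the open square (-1,1)². Let ε > 0. Then there is a simple polygonal circuit ρ ⊆ [-1,1]² (a closed, piecewise-linear Jordan curve) such that: (1) d_H(λ, ρ) ≤ ε; (2) I_τ(∂hull(λ)) + ε ≥ I_τ(∂hull(ρ)); (3) Leb(hull(λ) Δ hull(ρ)) ≤ ε. -/

import Mathlib

open MeasureTheory Set Filter ENNReal

noncomputable section

/-- The closed square `[-1,1]²` in `ℝ × ℝ`. -/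
def Isq : Set (ℝ × ℝ) := Set.Icc (-1, -1) (1, 1)

/-- The open square `(-1,1)²` in `ℝ × ℝ`. -/
def Osq : Set (ℝ × ℝ) := Set.Ioo (-1, -1) (1, 1)

/-- `τ` is a norm on `ℝ²`. -/
def IsNorm2 (τ : ℝ × ℝ → ℝ) : Prop :=
  (∀ x, τ x = 0 ↔ x = 0) ∧ (∀ (c : ℝ) (x), τ (c • x) = |c| * τ x) ∧
    ∀ x y, τ (x + y) ≤ τ x + τ y

/-- The Euclidean norm on `ℝ × ℝ`. -/
def eNorm2 (v : ℝ × ℝ) : ℝ := Real.sqrt (v.1 ^ 2 + v.2 ^ 2)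

/-- The dual norm `τ*` of a norm `τ` on `ℝ²`. -/
def dualNorm (τ : ℝ × ℝ → ℝ) (w : ℝ × ℝ) : ℝ :=
  sSup {x | ∃ v : ℝ × ℝ, τ v ≤ 1 ∧ x = v.1 * w.1 + v.2 * w.2}

/-- The divergence of a vector field on `ℝ²`. -/
def div2 (f : ℝ × ℝ → ℝ × ℝ) (x : ℝ × ℝ) : ℝ :=
  (fderiv ℝ f x (1, 0)).1 + (fderiv ℝ f x (0, 1)).2

/-- The perimeter `per(∂E)` of a set `E ⊆ ℝ²`, as the supremum of `∫_E div f`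
over smooth compactly supported vector fields with `|f|₂ ≤ 1`. -/
def per (E : Set (ℝ × ℝ)) : ℝ≥0∞ :=
  ⨆ f ∈ {f : ℝ × ℝ → ℝ × ℝ |
      ContDiff ℝ (⊤ : ℕ∞) f ∧ HasCompactSupport f ∧ ∀ x, eNorm2 (f x) ≤ 1},
    ENNReal.ofReal (∫ x in E, div2 f x)

/-- The restricted surface energy `I_τ(∂E)`: the supremum of `∫_E div f` over smooth
vector fields compactly supported in the open square with `τ*(f) ≤ 1`. -/
def surfE (τ : ℝ × ℝ → ℝ) (E : Set (ℝ × ℝ)) : ℝ≥0∞ :=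
  ⨆ f ∈ {f : ℝ × ℝ → ℝ × ℝ |
      ContDiff ℝ (⊤ : ℕ∞) f ∧ HasCompactSupport f ∧ tsupport f ⊆ Osq ∧
        ∀ x, dualNorm τ (f x) ≤ 1},
    ENNReal.ofReal (∫ x in E, div2 f x)

/-- `E ∈ 𝒞`: `E` is a subset of `[-1,1]²` of finite perimeter. -/
def MemC (E : Set (ℝ × ℝ)) : Prop := E ⊆ Isq ∧ per E ≠ ⊤

open Classical in
/-- The conductance `I_τ(∂E)/Leb(E)` of `E`, with the convention `0/0 = ∞`. -/
def conduct (τ : ℝ × ℝ → ℝ) (E : Set (ℝ × ℝ)) : ℝ≥0∞ :=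
  if volume E = 0 then ⊤ else surfE τ E / volume E

/-- The optimal conductance `ψ_τ^(a)` over sets of finite perimeter in the square. -/
def psi (τ : ℝ × ℝ → ℝ) (a : ℝ) : ℝ≥0∞ :=
  ⨅ E ∈ {E : Set (ℝ × ℝ) | MemC E ∧ volume E ≤ ENNReal.ofReal a}, conduct τ E

/-- The set of optimizers `𝒞_τ^(a)`. -/
def Copt (τ : ℝ × ℝ → ℝ) (a : ℝ) : Set (Set (ℝ × ℝ)) :=
  {E | MemC E ∧ volume E ≤ ENNReal.ofReal a ∧ conduct τ E = psi τ a}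

/-- A set of finite perimeter is decomposable if it can be split into two parts of positive
measure whose perimeters add up to the perimeter of the whole. -/
def Decomposable (E : Set (ℝ × ℝ)) : Prop :=
  ∃ A B : Set (ℝ × ℝ), E = A ∪ B ∧ Disjoint A B ∧ 0 < volume A ∧ 0 < volume B ∧
    per E = per A + per B

/-- The length of the curve `γ` measured with the gauge `β`: the supremum, over partitions
`0 = t₀ ≤ t₁ ≤ ⋯ ≤ t_n = 1`, of `∑ β(γ(t_j) - γ(t_{j-1}))`. -/
def varLength (β : ℝ × ℝ → ℝ) (γ : ℝ → ℝ × ℝ) : ℝ≥0∞ :=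
  ⨆ (n : ℕ) (t : Fin (n + 1) → ℝ)
    (_ : Monotone t ∧ t 0 = 0 ∧ t (Fin.last n) = 1),
    ENNReal.ofReal (∑ i : Fin n, β (γ (t i.succ) - γ (t i.castSucc)))

/-- `C` is a rectifiable Jordan curve: the image of a continuous injective map of the unit
circle (equivalently, a continuous `1`-periodic map injective on `[0,1)`) of finite length. -/
def IsRectJordanCurve (C : Set (ℝ × ℝ)) : Prop :=
  ∃ γ : ℝ → ℝ × ℝ, Continuous γ ∧ (∀ t, γ (t + 1) = γ t) ∧
    Set.InjOn γ (Set.Ico 0 1) ∧ C = γ '' Set.Icc 0 1 ∧ varLength eNorm2 γ ≠ ⊤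

/-- The hull of a curve `C`: the union of `C` with all bounded connected components of its
complement. -/
def hullSet (C : Set (ℝ × ℝ)) : Set (ℝ × ℝ) :=
  C ∪ {x | x ∉ C ∧ Bornology.IsBounded (connectedComponentIn Cᶜ x)}

/-- `R ∈ ℛ`: `R` is a compact subset of the square with nonempty interior whose boundary is
a finite union of rectifiable Jordan curves, any two of which have `ℋ¹`-null intersection. -/
def MemR (R : Set (ℝ × ℝ)) : Prop :=
  IsCompact R ∧ R ⊆ Isq ∧ (interior R).Nonempty ∧
    ∃ F : Finset (Set (ℝ × ℝ)),
      (∀ C ∈ F, IsRectJordanCurve C) ∧ frontier R = ⋃ C ∈ F, C ∧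
        ∀ C ∈ F, ∀ C' ∈ F, C ≠ C' →
          (MeasureTheory.Measure.hausdorffMeasure 1 : Measure (ℝ × ℝ)) (C ∩ C') = 0

/-- The optimal conductance `φ_τ^(a)` over the class `ℛ`. -/
def phiR (τ : ℝ × ℝ → ℝ) (a : ℝ) : ℝ≥0∞ :=
  ⨅ R ∈ {R : Set (ℝ × ℝ) | MemR R ∧ volume R ≤ ENNReal.ofReal a}, conduct τ R

/-- The set of optimizers `ℛ_τ^(a)`. -/
def Ropt (τ : ℝ × ℝ → ℝ) (a : ℝ) : Set (Set (ℝ × ℝ)) :=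
  {R | MemR R ∧ volume R ≤ ENNReal.ofReal a ∧ conduct τ R = phiR τ a}

/-- `L¹` convergence of sets: `Leb(E_k Δ E₀) → 0`. -/
def TendstoL1 (E : ℕ → Set (ℝ × ℝ)) (E₀ : Set (ℝ × ℝ)) : Prop :=
  Tendsto (fun k => volume (symmDiff (E k) E₀)) atTop (nhds 0)

/-- `ρ` is a (piecewise-linear) polygonal curve on `[0,1]`. -/
def IsPolygonal (ρ : ℝ → ℝ × ℝ) : Prop :=
  ∃ (n : ℕ) (s : Fin (n + 1) → ℝ), Monotone s ∧ s 0 = 0 ∧ s (Fin.last n) = 1 ∧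
    ∀ i : Fin n, ∀ t ∈ Set.Icc (s i.castSucc) (s i.succ),
      ρ t = ρ (s i.castSucc) +
        ((t - s i.castSucc) / (s i.succ - s i.castSucc)) • (ρ (s i.succ) - ρ (s i.castSucc))

end



/-- Identification of `ℝ × ℝ` with `ℂ`. -/
noncomputable def cx (p : ℝ × ℝ) : ℂ := Complex.equivRealProdCLM.symm p

theorem cx_continuous : Continuous cx := Complex.equivRealProdCLM.symm.continuous
theorem cx_sub (p q : ℝ × ℝ) : cx (p - q) = cx p - cx q := map_sub Complex.equivRealProdCLM.symm p q
theorem cx_re (p : ℝ × ℝ) : (cx p).re = p.1 := rfl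
theorem cx_im (p : ℝ × ℝ) : (cx p).im = p.2 := rfl
theorem cx_inj {p q : ℝ × ℝ} (h : cx p = cx q) : p = q := Complex.equivRealProdCLM.symm.injective h
theorem cx_ne {p q : ℝ × ℝ} (h : p ≠ q) : cx (p - q) ≠ 0 := by
  rw [cx_sub, sub_ne_zero]; exact fun e => h (cx_inj e)

theorem norm_cx_ge (p : ℝ × ℝ) : ‖p‖ ≤ ‖cx p‖ := by
  rw [Prod.norm_def]
  exact max_le (Complex.abs_re_le_norm (cx p)) (Complex.abs_im_le_norm (cx p))
theorem norm_cx_le (p : ℝ × ℝ) : ‖cx p‖ ≤ 2 * ‖p‖ := by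
  have := Complex.norm_le_abs_re_add_abs_im (cx p)
  have h1 : |(cx p).re| ≤ ‖p‖ := by rw [Prod.norm_def]; exact le_max_left _ _
  have h2 : |(cx p).im| ≤ ‖p‖ := by rw [Prod.norm_def]; exact le_max_right _ _
  linarith

/-- Global continuous logarithm. -/
theorem exists_log {X : Type*} [TopologicalSpace X] [SimplyConnectedSpace X]
    [LocallyPathConnectedSpace X] (g : X → ℂ) (hg : Continuous g) (h0 : ∀ x, g x ≠ 0) :
    ∃ L : X → ℂ, Continuous L ∧ ∀ x, Complex.exp (L x) = g x := by
  obtain ⟨x₀⟩ : Nonempty X := inferInstance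
  rcases Complex.isCoveringMapOn_exp.existsUnique_continuousMap_lifts
    ⟨g, hg⟩ (Complex.exp_log (h0 x₀)) (fun x ↦ h0 x) with ⟨f, ⟨-, hf⟩, -⟩
  exact ⟨f, f.continuous, fun x => congrFun hf x⟩

theorem exists_log_Icc {a b : ℝ} (hab : a ≤ b) (g : ℝ → ℂ) (hg : ContinuousOn g (Icc a b))
    (h0 : ∀ x ∈ Icc a b, g x ≠ 0) :
    ∃ L : ℝ → ℂ, ContinuousOn L (Icc a b) ∧ ∀ x ∈ Icc a b, Complex.exp (L x) = g x := by
  obtain ⟨L, hL, hL'⟩ := exists_log (fun x : ℝ => g (projIcc a b hab x))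
    (hg.comp_continuous (by fun_prop) (fun x => (projIcc a b hab x).2))
    (fun x => h0 _ (projIcc a b hab x).2)
  refine ⟨L, hL.continuousOn, fun x hx => ?_⟩
  rw [hL', projIcc_of_mem hab hx]

theorem discrete_const {S : Set ℝ} (hS : IsPreconnected S) (D : ℝ → ℂ)
    (hD : ContinuousOn D S) (h : ∀ x ∈ S, Complex.exp (D x) = 1) {x y : ℝ} (hx : x ∈ S)
    (hy : y ∈ S) : D x = D y := by
  have h1 : ∀ x ∈ S, ∃ n : ℤ, D x = n * (2 * Real.pi * Complex.I) := fun x hx =>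
    Complex.exp_eq_one_iff.1 (h x hx)
  have key : ∀ x ∈ S, ∃ n : ℤ, (D x).im / (2 * Real.pi) = n := by
    intro x hx
    obtain ⟨n, hn⟩ := h1 x hx
    refine ⟨n, ?_⟩
    rw [hn]; simp
  have hc : ContinuousOn (fun x => (D x).im / (2 * Real.pi)) S :=
    (Complex.continuous_im.comp_continuousOn hD).div_const _
  have : (D x).im / (2 * Real.pi) = (D y).im / (2 * Real.pi) := by
    have hp : IsPreconnected ((fun x => (D x).im / (2 * Real.pi)) '' S) := hS.image _ hc
    by_contra hne
    have hord := hp.ordConnected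
    have : ∀ a b : ℝ, a ∈ (fun x => (D x).im / (2 * Real.pi)) '' S →
        b ∈ (fun x => (D x).im / (2 * Real.pi)) '' S → a < b → False := by
      intro a b ha hb hab
      obtain ⟨c, hc1, hc2⟩ : ∃ c, c ∈ Ioo a (min b (a + 1)) :=
        nonempty_Ioo.2 (lt_min hab (by linarith))
      have hc := hord.out ha hb ⟨hc1.le, (hc2.trans_le (min_le_left _ _)).le⟩
      obtain ⟨xa, hxa, rfl⟩ := ha
      obtain ⟨xc, hxc, rfl⟩ := hc
      obtain ⟨n, hn⟩ := key _ hxa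
      obtain ⟨m, hm⟩ := key _ hxc
      simp only [hn, hm] at hc1 hc2
      have h3 := hc2.trans_le (min_le_right _ _)
      have : n < m := by exact_mod_cast hc1
      have : m < n + 1 := by exact_mod_cast h3
      omega
    rcases lt_or_gt_of_ne hne with h | h
    · exact this _ _ ⟨x, hx, rfl⟩ ⟨y, hy, rfl⟩ h
    · exact this _ _ ⟨y, hy, rfl⟩ ⟨x, hx, rfl⟩ h
  obtain ⟨n, hn⟩ := h1 x hx
  obtain ⟨m, hm⟩ := h1 y hy
  have h2 : (n : ℝ) = m := by
    have e1 : (D x).im / (2 * Real.pi) = n := by rw [hn]; simp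
    have e2 : (D y).im / (2 * Real.pi) = m := by rw [hm]; simp
    rw [← e1, ← e2, this]
  have : n = m := by exact_mod_cast h2
  rw [hn, hm, this]

/-- Two lifts differ by a constant. -/
theorem lift_unique {S : Set ℝ} (hS : IsPreconnected S) (L L' : ℝ → ℂ)
    (hL : ContinuousOn L S) (hL' : ContinuousOn L' S)
    (h : ∀ x ∈ S, Complex.exp (L x) = Complex.exp (L' x)) {x y : ℝ} (hx : x ∈ S)
    (hy : y ∈ S) : L y - L x = L' y - L' x := by
  have := discrete_const hS (fun x => L x - L' x) (hL.sub hL') (fun x hx => by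
    rw [Complex.exp_sub, h x hx, div_self (Complex.exp_ne_zero _)]) hx hy
  linear_combination -this

/-- `Γ` (on `[0,1]`) has winding number `w` about `x`. -/
def HasW (Γ : ℝ → ℝ × ℝ) (x : ℝ × ℝ) (w : ℤ) : Prop :=
  ∃ L : ℝ → ℂ, ContinuousOn L (Icc 0 1) ∧ (∀ t ∈ Icc (0:ℝ) 1, Complex.exp (L t) = cx (Γ t - x)) ∧
    L 1 - L 0 = w * (2 * Real.pi * Complex.I)

theorem mem01_0 : (0:ℝ) ∈ Icc (0:ℝ) 1 := ⟨le_rfl, zero_le_one⟩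
theorem mem01_1 : (1:ℝ) ∈ Icc (0:ℝ) 1 := ⟨zero_le_one, le_rfl⟩

theorem HasW.lift_eq {Γ : ℝ → ℝ × ℝ} {x : ℝ × ℝ} {w : ℤ} (h : HasW Γ x w) (L : ℝ → ℂ)
    (hL : ContinuousOn L (Icc 0 1)) (hL' : ∀ t ∈ Icc (0:ℝ) 1, Complex.exp (L t) = cx (Γ t - x)) :
    L 1 - L 0 = w * (2 * Real.pi * Complex.I) := by
  obtain ⟨M, hM, hM', e⟩ := h
  rw [← e]
  exact lift_unique isPreconnected_Icc L M hL hM (fun t ht => by rw [hL' t ht, hM' t ht]) mem01_0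
    mem01_1

theorem HasW.unique {Γ : ℝ → ℝ × ℝ} {x : ℝ × ℝ} {w w' : ℤ} (h : HasW Γ x w) (h' : HasW Γ x w') :
    w = w' := by
  obtain ⟨M, hM, hM', e⟩ := h
  have := h'.lift_eq M hM hM'
  rw [e] at this
  have h2 : (2 * Real.pi * Complex.I) ≠ 0 := Complex.two_pi_I_ne_zero
  exact_mod_cast mul_right_cancel₀ h2 this

theorem exists_hasW {Γ : ℝ → ℝ × ℝ} (hΓ : ContinuousOn Γ (Icc 0 1)) (h01 : Γ 1 = Γ 0) {x : ℝ × ℝ}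
    (hx : x ∉ Γ '' Icc 0 1) : ∃ w, HasW Γ x w := by
  obtain ⟨L, hL, hL'⟩ := exists_log_Icc zero_le_one (fun t => cx (Γ t - x))
    (cx_continuous.comp_continuousOn (hΓ.sub continuousOn_const))
    (fun t ht => cx_ne (fun e => hx ⟨t, ht, e⟩))
  have : Complex.exp (L 1 - L 0) = 1 := by
    rw [Complex.exp_sub, hL' 1 mem01_1, hL' 0 mem01_0, h01, div_self]
    exact cx_ne (fun e => hx ⟨0, mem01_0, e⟩)
  obtain ⟨n, hn⟩ := Complex.exp_eq_one_iff.1 this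
  exact ⟨n, L, hL, hL', hn⟩

theorem HasW.perturb {Γ Γ' : ℝ → ℝ × ℝ} {x x' : ℝ × ℝ} {w : ℤ} (h : HasW Γ' x' w)
    (hΓ : ContinuousOn Γ (Icc 0 1)) (hΓ' : ContinuousOn Γ' (Icc 0 1)) (h01 : Γ 1 = Γ 0)
    (h01' : Γ' 1 = Γ' 0)
    (hlt : ∀ t ∈ Icc (0:ℝ) 1, ‖cx (Γ t - x) - cx (Γ' t - x')‖ < ‖cx (Γ' t - x')‖) :
    HasW Γ x w := by
  obtain ⟨M, hM, hM', e⟩ := h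
  have hne : ∀ t ∈ Icc (0:ℝ) 1, cx (Γ' t - x') ≠ 0 := fun t ht e => by
    have := hlt t ht
    rw [e, norm_zero] at this
    exact absurd this (not_lt.2 (norm_nonneg _))
  have hs : ∀ t ∈ Icc (0:ℝ) 1, cx (Γ t - x) / cx (Γ' t - x') ∈ Complex.slitPlane := by
    intro t ht
    have h1 : ‖1 - cx (Γ t - x) / cx (Γ' t - x')‖ < 1 := by
      have : 1 - cx (Γ t - x) / cx (Γ' t - x') = (cx (Γ' t - x') - cx (Γ t - x)) / cx (Γ' t - x') := by
        rw [sub_div, div_self (hne t ht)]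
      rw [this, norm_div, div_lt_one (norm_pos_iff.2 (hne t ht)), norm_sub_rev]
      exact hlt t ht
    left
    have h2 := (Complex.abs_re_le_norm _).trans_lt h1
    rw [Complex.sub_re, Complex.one_re, abs_lt] at h2
    linarith [h2.2]
  have hc1 : ContinuousOn (fun t => cx (Γ t - x)) (Icc 0 1) :=
    cx_continuous.comp_continuousOn (hΓ.sub continuousOn_const)
  have hc2 : ContinuousOn (fun t => cx (Γ' t - x')) (Icc 0 1) :=
    cx_continuous.comp_continuousOn (hΓ'.sub continuousOn_const)
  refine ⟨fun t => M t + Complex.log (cx (Γ t - x) / cx (Γ' t - x')),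
    hM.add ((hc1.div hc2 hne).clog hs), fun t ht => ?_, ?_⟩
  · rw [Complex.exp_add, hM' t ht, Complex.exp_log (Complex.slitPlane_ne_zero (hs t ht)),
      mul_div_cancel₀ _ (hne t ht)]
  · simp only [h01, h01']
    linear_combination e

theorem hasW_zero_of_far {Γ : ℝ → ℝ × ℝ} (hΓ : ContinuousOn Γ (Icc 0 1)) (h01 : Γ 1 = Γ 0)
    {x : ℝ × ℝ} (hx : ∀ t ∈ Icc (0:ℝ) 1, ‖cx (Γ t)‖ < ‖cx x‖) : HasW Γ x 0 := by
  have hn : cx x ≠ 0 := fun e => by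
    have := hx 0 mem01_0
    rw [e, norm_zero] at this
    exact absurd this (not_lt.2 (norm_nonneg _))
  have h0 : HasW (fun _ => (0 : ℝ × ℝ)) x 0 := by
    refine ⟨fun _ => Complex.log (cx (0 - x)), continuousOn_const, fun t ht => ?_, by simp⟩
    rw [Complex.exp_log]
    rw [cx_sub]
    have : cx 0 = 0 := map_zero Complex.equivRealProdCLM.symm
    rwa [this, zero_sub, neg_ne_zero]
  refine h0.perturb hΓ continuousOn_const h01 rfl fun t ht => ?_
  have e0 : cx 0 = 0 := map_zero Complex.equivRealProdCLM.symm
  change ‖cx (Γ t - x) - cx (0 - x)‖ < ‖cx (0 - x)‖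
  rw [cx_sub, cx_sub 0 x, e0, zero_sub, norm_neg]
  simpa using hx t ht

/-- local constancy -/
theorem HasW.eventually {Γ : ℝ → ℝ × ℝ} (hΓ : ContinuousOn Γ (Icc 0 1)) (h01 : Γ 1 = Γ 0)
    {x : ℝ × ℝ} (hx : x ∉ Γ '' Icc 0 1) {w : ℤ} (h : HasW Γ x w) :
    ∀ᶠ y in nhds x, HasW Γ y w := by
  have hK : IsCompact (Γ '' Icc 0 1) := isCompact_Icc.image_of_continuousOn hΓ
  obtain ⟨r, hr, hrb⟩ := Metric.isOpen_iff.1 hK.isClosed.isOpen_compl x hx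
  refine Metric.eventually_nhds_iff.2 ⟨r / 2, by positivity, fun y hy => ?_⟩
  refine h.perturb hΓ hΓ h01 h01 fun t ht => ?_
  have h1 : r ≤ ‖Γ t - x‖ := by
    by_contra hlt
    push Not at hlt
    have : Γ t ∈ Metric.ball x r := by rwa [mem_ball_iff_norm]
    exact hrb this ⟨t, ht, rfl⟩
  have h2 : ‖cx (Γ t - y) - cx (Γ t - x)‖ < r := by
    rw [← cx_sub]
    refine (norm_cx_le _).trans_lt ?_
    have : Γ t - y - (Γ t - x) = x - y := by abel
    rw [this, ← dist_eq_norm, dist_comm]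
    linarith
  linarith [norm_cx_ge (Γ t - x)]

/-- constancy on connected components -/
theorem HasW.of_component {Γ : ℝ → ℝ × ℝ} (hΓ : ContinuousOn Γ (Icc 0 1)) (h01 : Γ 1 = Γ 0)
    {S : Set (ℝ × ℝ)} (hS : IsPreconnected S) (hSK : S ⊆ (Γ '' Icc 0 1)ᶜ)
    {x y : ℝ × ℝ} (hx : x ∈ S) (hy : y ∈ S) {w : ℤ} (h : HasW Γ x w) : HasW Γ y w := by
  have hK : IsCompact (Γ '' Icc 0 1) := isCompact_Icc.image_of_continuousOn hΓ
  by_contra hn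
  have h1 : IsOpen {z | z ∉ Γ '' Icc 0 1 ∧ HasW Γ z w} := by
    rw [isOpen_iff_mem_nhds]
    intro z hz
    filter_upwards [hz.2.eventually hΓ h01 hz.1, hK.isClosed.isOpen_compl.mem_nhds hz.1] with u h1 h2
    exact ⟨h2, h1⟩
  have h2 : IsOpen {z | z ∉ Γ '' Icc 0 1 ∧ ∃ w', w' ≠ w ∧ HasW Γ z w'} := by
    rw [isOpen_iff_mem_nhds]
    rintro z ⟨hz, w', hw', hzw⟩
    filter_upwards [hzw.eventually hΓ h01 hz, hK.isClosed.isOpen_compl.mem_nhds hz] with u h1 h2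
    exact ⟨h2, w', hw', h1⟩
  obtain ⟨w', hw'⟩ := exists_hasW hΓ h01 (hSK hy)
  obtain ⟨z, hz, ⟨-, hz1⟩, ⟨-, w'', hne, hz2⟩⟩ := hS _ _ h1 h2 (fun z hz => by
      obtain ⟨w'', hw''⟩ := exists_hasW hΓ h01 (hSK hz)
      by_cases e : w'' = w
      · left; exact ⟨hSK hz, e ▸ hw''⟩
      · right; exact ⟨hSK hz, w'', e, hw''⟩) ⟨x, hx, hSK hx, h⟩
      ⟨y, hy, hSK hy, w', fun e => hn (e ▸ hw'), hw'⟩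
  exact hne (hz2.unique hz1)


theorem no_ext (h : ℝ × ℝ → ℂ) (hc : Continuous h) (h0 : ∀ z, h z ≠ 0) (p : ℝ × ℝ)
    (U : Set (ℝ × ℝ)) (hU : Bornology.IsBounded U) (hout : ∀ z ∉ U, h z = cx (z - p)) : False := by
  obtain ⟨H, hH, hH'⟩ := exists_log h hc h0
  obtain ⟨R, hR0, hR⟩ := hU.subset_ball_lt 0 p
  set Γ : ℝ → ℝ × ℝ := fun t => p + (2 * R * Real.cos (2 * Real.pi * t), 2 * R * Real.sin (2 * Real.pi * t))
    with hΓ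
  have hΓc : Continuous Γ := by fun_prop
  have hΓU : ∀ t, Γ t ∉ U := by
    intro t ht
    have h1 := hR ht
    rw [mem_ball_iff_norm] at h1
    have h2 : Γ t - p = (2 * R * Real.cos (2 * Real.pi * t), 2 * R * Real.sin (2 * Real.pi * t)) := by
      simp [hΓ]
    rw [h2, Prod.norm_def, max_lt_iff, Real.norm_eq_abs, Real.norm_eq_abs] at h1
    have h3 := sq_lt_sq' (by linarith [abs_nonneg (2 * R * Real.cos (2 * Real.pi * t))]) h1.1
    have h4 := sq_lt_sq' (by linarith [abs_nonneg (2 * R * Real.sin (2 * Real.pi * t))]) h1.2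
    rw [sq_abs] at h3 h4
    nlinarith [Real.sin_sq_add_cos_sq (2 * Real.pi * t), sq_pos_of_pos hR0]
  have hlift := lift_unique (S := Icc 0 1) isPreconnected_Icc (fun t => H (Γ t))
    (fun t => Complex.log (2 * R) + 2 * Real.pi * t * Complex.I)
    (hH.comp hΓc).continuousOn (by fun_prop) (fun t ht => by
      have hne : (2 * R : ℂ) ≠ 0 := by
        have : (R : ℂ) ≠ 0 := by exact_mod_cast hR0.ne'
        simp [this]
      rw [hH', hout _ (hΓU t), Complex.exp_add, Complex.exp_log hne]
      have : (2 * Real.pi * t * Complex.I : ℂ) = ((2 * Real.pi * t : ℝ) : ℂ) * Complex.I := by push_cast; ring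
      rw [this, Complex.exp_mul_I, ← Complex.ofReal_cos, ← Complex.ofReal_sin]
      have e2 : Γ t - p = (2 * R * Real.cos (2 * Real.pi * t), 2 * R * Real.sin (2 * Real.pi * t)) := by
        simp [hΓ]
      rw [e2]
      generalize Real.cos (2 * Real.pi * t) = c
      generalize Real.sin (2 * Real.pi * t) = s
      apply Complex.ext
      · simp [cx_re]
      · simp [cx_im]) mem01_0 mem01_1
  have e : Γ 1 = Γ 0 := by simp [hΓ]
  simp only [e, sub_self] at hlift
  have h2 : (2 * Real.pi * Complex.I : ℂ) ≠ 0 := Complex.two_pi_I_ne_zero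
  apply h2
  push_cast at hlift
  linear_combination -hlift

theorem descend {Γ : ℝ → ℝ × ℝ} (hΓ : ContinuousOn Γ (Icc 0 1))
    (hinj : InjOn Γ (Ico 0 1)) (h01 : Γ 1 = Γ 0) (M : ℝ → ℂ) (hM : ContinuousOn M (Icc 0 1))
    (hM01 : M 1 = M 0) : ∃ l : ℝ × ℝ → ℂ, Continuous l ∧ ∀ t ∈ Icc (0:ℝ) 1, l (Γ t) = M t := by
  set K := Γ '' Icc 0 1 with hK
  have hKc : IsCompact K := isCompact_Icc.image_of_continuousOn hΓ
  let f : Icc (0:ℝ) 1 → K := fun t => ⟨Γ t, ⟨t, t.2, rfl⟩⟩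
  have hf : Continuous f := (continuousOn_iff_continuous_domRestrict.1 hΓ).subtype_mk _
  have hfs : Function.Surjective f := by
    rintro ⟨_, t, ht, rfl⟩; exact ⟨⟨t, ht⟩, rfl⟩
  have hq : Topology.IsQuotientMap f := hf.isClosedMap.isQuotientMap hf hfs
  let g : C(Icc (0:ℝ) 1, ℂ) := ⟨fun t => M t, continuousOn_iff_continuous_domRestrict.1 hM⟩
  have key : ∀ s t : ℝ, s ∈ Icc (0:ℝ) 1 → t ∈ Icc (0:ℝ) 1 → Γ s = Γ t → M s = M t := by
    intro s t hs ht e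
    rcases hs.2.lt_or_eq with hs1 | rfl <;> rcases ht.2.lt_or_eq with ht1 | rfl
    · rw [hinj ⟨hs.1, hs1⟩ ⟨ht.1, ht1⟩ e]
    · rw [h01] at e
      rw [hinj ⟨hs.1, hs1⟩ ⟨le_rfl, zero_lt_one⟩ e, hM01]
    · rw [h01] at e
      rw [← hinj ⟨le_rfl, zero_lt_one⟩ ⟨ht.1, ht1⟩ e, hM01]
    · rfl
  have hg : ∀ a b, f a = f b → g a = g b := fun a b e => key a b a.2 b.2 (congrArg Subtype.val e)
  obtain ⟨l0, hl0, hl0'⟩ : ∃ l0 : K → ℂ, Continuous l0 ∧ ∀ a, l0 (f a) = g a := by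
    refine ⟨fun k => g (Classical.choose (hfs k)), ?_, fun a => ?_⟩
    · rw [hq.continuous_iff]
      convert g.continuous using 1
      funext a
      exact hg _ _ (Classical.choose_spec (hfs (f a)))
    · exact hg _ _ (Classical.choose_spec (hfs (f a)))
  obtain ⟨l, hl⟩ := ContinuousMap.exists_restrict_eq hKc.isClosed (⟨l0, hl0⟩ : C(K, ℂ))
  refine ⟨l, l.continuous, fun t ht => ?_⟩
  have := congrArg (fun u => u (f ⟨t, ht⟩)) hl
  simp only [ContinuousMap.restrict_apply, ContinuousMap.coe_mk, hl0'] at this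
  exact this

/-- Two distinct bounded... -/
theorem bounded_comp_unique {Γ : ℝ → ℝ × ℝ} (hΓ : ContinuousOn Γ (Icc 0 1))
    (hinj : InjOn Γ (Ico 0 1)) (h01 : Γ 1 = Γ 0) {p q : ℝ × ℝ}
    (hp : p ∉ Γ '' Icc 0 1) (hq : q ∉ Γ '' Icc 0 1) {σ : ℤ} (hσ : σ * σ = 1) (hqσ : HasW Γ q σ)
    (hb : Bornology.IsBounded (connectedComponentIn (Γ '' Icc 0 1)ᶜ p)) :
    q ∈ connectedComponentIn (Γ '' Icc 0 1)ᶜ p := by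
  by_contra hqU
  set K := Γ '' Icc 0 1 with hK
  have hKc : IsCompact K := isCompact_Icc.image_of_continuousOn hΓ
  set U := connectedComponentIn Kᶜ p with hU
  have hUo : IsOpen U := hKc.isClosed.isOpen_compl.connectedComponentIn
  have hfr : frontier U ⊆ K := by
    intro z hz
    by_contra hzK
    have hzU : z ∉ U := by
      have := hz.2
      rwa [hUo.interior_eq] at this
    have hV : IsOpen (connectedComponentIn Kᶜ z) := hKc.isClosed.isOpen_compl.connectedComponentIn
    obtain ⟨y, hyV, hyU⟩ := mem_closure_iff.1 hz.1 _ hV (mem_connectedComponentIn hzK)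
    have e1 := connectedComponentIn_eq hyV
    have e2 := connectedComponentIn_eq hyU
    apply hzU
    rw [hU, e2, ← e1]
    exact mem_connectedComponentIn hzK
  obtain ⟨m, Lp, hLp, hLp', ep⟩ := exists_hasW hΓ h01 hp
  obtain ⟨Lq, hLq, hLq', eq⟩ := hqσ
  obtain ⟨l, hl, hl'⟩ := descend hΓ hinj h01 (fun t => Lp t - (σ * m : ℤ) * Lq t)
    (hLp.sub (continuousOn_const.mul hLq)) (by
      have : (σ : ℂ) * σ = 1 := by exact_mod_cast hσ
      push_cast
      linear_combination ep - σ * m * eq - (m * (2 * Real.pi * Complex.I)) * this)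
  classical
  refine no_ext (fun z => if z ∈ U then cx (z - q) ^ (σ * m) * Complex.exp (l z) else cx (z - p))
    ?_ ?_ p U hb (fun z hz => by simp [hz])
  · have hA : ContinuousOn (fun z => cx (z - q) ^ (σ * m) * Complex.exp (l z)) (closure U) := by
      intro z hz
      have hzq : z ≠ q := by
        rintro rfl
        by_cases h : z ∈ U
        · exact hqU h
        · exact hq (hfr ⟨hz, by rwa [hUo.interior_eq]⟩)
      have h1 : ContinuousAt (fun z => cx (z - q)) z :=
        (cx_continuous.comp (continuous_id.sub continuous_const)).continuousAt
      exact ((h1.zpow₀ _ (Or.inl (cx_ne hzq))).mul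
        (Complex.continuous_exp.comp hl).continuousAt).continuousWithinAt
    refine continuous_if (p := fun z => z ∈ U) ?_ hA
      (cx_continuous.comp (continuous_id.sub continuous_const)).continuousOn
    intro z hz
    obtain ⟨t, ht, rfl⟩ := hfr hz
    rw [hl' t ht, Complex.exp_sub, hLp' t ht, Complex.exp_int_mul, hLq' t ht, mul_div_cancel₀]
    exact zpow_ne_zero _ (cx_ne (fun e => hq ⟨t, ht, e⟩))
  · intro z
    by_cases hz : z ∈ U
    · simp only [hz, if_true]
      refine mul_ne_zero (zpow_ne_zero _ (cx_ne ?_)) (Complex.exp_ne_zero _)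
      rintro rfl; exact hqU hz
    · simp only [hz, if_false]
      refine cx_ne ?_
      rintro rfl; exact hz (mem_connectedComponentIn hp)


theorem log_sub_log_neg_pos {z : ℂ} (h : 0 < z.im) :
    Complex.log z - Complex.log (-z) = Real.pi * Complex.I := by
  have h2 := Complex.arg_neg_eq_arg_sub_pi_of_im_pos h
  rw [Complex.log, Complex.log, norm_neg, h2]; push_cast; ring

theorem log_sub_log_neg_neg {z : ℂ} (h : z.im < 0) :
    Complex.log z - Complex.log (-z) = -(Real.pi * Complex.I) := by
  have h2 := Complex.arg_neg_eq_arg_add_pi_of_im_neg h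
  rw [Complex.log, Complex.log, norm_neg, h2]; push_cast; ring

theorem sign_aux (y : ℝ → ℝ) (hy : ContinuousOn y (Icc 0 1)) (h0 : y 0 = 0) (h1 : y 1 = 0)
    {η : ℝ} (hη : 0 < η) (hη' : η < 1 / 2)
    (hinj : ∀ a ∈ Ioc 0 η, ∀ b ∈ Ico (1 - η) 1, y a ≠ y b) :
    ¬ (0 < y η ∧ 0 < y (1 - η)) := by
  rintro ⟨ha, hb⟩
  set m := min (y η) (y (1 - η)) with hm
  have hm0 : 0 < m := lt_min ha hb
  have c1 : m ∈ y '' Icc 0 η := by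
    apply intermediate_value_Icc hη.le (hy.mono (Icc_subset_Icc_right (by linarith)))
    rw [h0]; exact ⟨hm0.le, min_le_left _ _⟩
  have c2 : m ∈ y '' Icc (1 - η) 1 := by
    apply intermediate_value_Icc' (by linarith) (hy.mono (Icc_subset_Icc_left (by linarith)))
    rw [h1]; exact ⟨hm0.le, min_le_right _ _⟩
  obtain ⟨a, ha, ea⟩ := c1
  obtain ⟨b, hb, eb⟩ := c2
  refine hinj a ⟨lt_of_le_of_ne ha.1 ?_, ha.2⟩ b ⟨hb.1, lt_of_le_of_ne hb.2 ?_⟩ (ea.trans eb.symm)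
  · rintro rfl; rw [h0] at ea; exact hm0.ne ea
  · rintro rfl; rw [h1] at eb; exact hm0.ne eb

theorem exists_q {Γ : ℝ → ℝ × ℝ} (hΓ : ContinuousOn Γ (Icc 0 1))
    (hinj : InjOn Γ (Ico 0 1)) (h01 : Γ 1 = Γ 0) {e : ℂ} (he : e ≠ 0)
    (hre : ∀ t ∈ Icc (0:ℝ) 1, 0 ≤ (e * cx (Γ t - Γ 0)).re) {η : ℝ} (hη : 0 < η) (hη' : η < 1 / 2)
    (hz1 : ∀ t ∈ Icc 0 η, (e * cx (Γ t - Γ 0)).re = 0)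
    (hz2 : ∀ t ∈ Icc (1 - η) 1, (e * cx (Γ t - Γ 0)).re = 0) :
    ∃ q, q ∉ Γ '' Icc 0 1 ∧ ∃ σ : ℤ, σ * σ = 1 ∧ HasW Γ q σ := by
  set v : ℝ → ℂ := fun t => e * cx (Γ t - Γ 0) with hv
  have hvc : ContinuousOn v (Icc 0 1) :=
    continuousOn_const.mul (cx_continuous.comp_continuousOn (hΓ.sub continuousOn_const))
  have hvinj : ∀ s ∈ Icc (0:ℝ) 1, ∀ t ∈ Icc (0:ℝ) 1, v s = v t → Γ s = Γ t := by
    intro s _ t _ h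
    have := mul_left_cancel₀ he h
    rw [cx_sub, cx_sub] at this
    exact cx_inj (sub_left_injective this)
  have hv0 : v 0 = 0 := by
    have : cx 0 = 0 := map_zero Complex.equivRealProdCLM.symm
    simp [hv, this]
  have hv1 : v 1 = 0 := by rw [← hv0]; simp only [hv, h01]
  have hvne : ∀ t ∈ Ioo (0:ℝ) 1, v t ≠ 0 := by
    intro t ht h
    have := hinj ⟨ht.1.le, ht.2⟩ ⟨le_rfl, zero_lt_one⟩
      (hvinj t ⟨ht.1.le, ht.2.le⟩ 0 mem01_0 (h.trans hv0.symm))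
    exact ht.1.ne' this
  have hmid : Icc η (1 - η) ⊆ Icc 0 1 := Icc_subset_Icc hη.le (by linarith)
  obtain ⟨t0, ht0, hmin⟩ := (isCompact_Icc (a := η) (b := 1 - η)).exists_isMinOn
    (nonempty_Icc.2 (by linarith)) (hvc.mono hmid).norm
  set s : ℝ := ‖v t0‖ / 2 with hs
  have hs0 : 0 < s := by
    have := norm_pos_iff.2 (hvne t0 ⟨hη.trans_le ht0.1, ht0.2.trans_lt (by linarith)⟩)
    positivity
  have hsm : ∀ t ∈ Icc η (1 - η), s < ‖v t‖ := by
    intro t ht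
    have : ‖v t0‖ ≤ ‖v t‖ := hmin ht
    linarith
  obtain ⟨q, hq⟩ : ∃ q, cx q = cx (Γ 0) + s / e :=
    ⟨Complex.equivRealProdCLM (cx (Γ 0) + s / e), Complex.equivRealProdCLM.symm_apply_apply _⟩
  have hu : ∀ t, cx (Γ t - q) = (v t - s) / e := by
    intro t
    rw [cx_sub, hq]
    simp only [hv, cx_sub]
    field_simp
    ring
  -- slit plane
  have hslit : ∀ t ∈ Ioo (0:ℝ) 1, v t - s ∈ Complex.slitPlane := by
    intro t ht
    by_contra hn
    rw [Complex.mem_slitPlane_iff, not_or, not_lt, not_not] at hn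
    obtain ⟨hn1, hn2⟩ := hn
    simp only [Complex.sub_re, Complex.ofReal_re, Complex.sub_im, Complex.ofReal_im, sub_zero] at hn1 hn2
    have h1 := hre t ⟨ht.1.le, ht.2.le⟩
    by_cases h : t ∈ Icc η (1 - η)
    · have h3 := hsm t h
      have h4 := Complex.norm_le_abs_re_add_abs_im (v t)
      rw [hn2, abs_zero, abs_of_nonneg h1] at h4
      linarith
    · have h5 : (v t).re = 0 := by
        rw [mem_Icc, not_and_or, not_le, not_le] at h
        rcases h with h | h
        · exact hz1 t ⟨ht.1.le, h.le⟩
        · exact hz2 t ⟨h.le, ht.2.le⟩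
      exact hvne t ht (Complex.ext h5 hn2)
  have hneg1 : ∀ t ∈ Icc 0 η, -(v t - s) ∈ Complex.slitPlane := by
    intro t ht; left
    have := hz1 t ht
    simp only [Complex.neg_re, Complex.sub_re, Complex.ofReal_re]
    linarith
  have hneg2 : ∀ t ∈ Icc (1 - η) 1, -(v t - s) ∈ Complex.slitPlane := by
    intro t ht; left
    have := hz2 t ht
    simp only [Complex.neg_re, Complex.sub_re, Complex.ofReal_re]
    linarith
  have hqK : q ∉ Γ '' Icc 0 1 := by
    rintro ⟨t, ht, rfl⟩
    have h1 := hu t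
    have : cx 0 = 0 := map_zero Complex.equivRealProdCLM.symm
    rw [sub_self, this, eq_comm, _root_.div_eq_zero_iff] at h1
    have h2 : v t - s = 0 := h1.resolve_right he
    by_cases h : t ∈ Icc 0 η
    · have := hneg1 t h; rw [h2, neg_zero] at this; exact Complex.slitPlane_ne_zero this rfl
    by_cases h' : t ∈ Icc (1 - η) 1
    · have := hneg2 t h'; rw [h2, neg_zero] at this; exact Complex.slitPlane_ne_zero this rfl
    rw [mem_Icc, not_and_or, not_le, not_le] at h h'
    have hh : t ∈ Ioo (0:ℝ) 1 := ⟨by rcases h with h | h <;> linarith [ht.1],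
      by rcases h' with h | h <;> linarith [ht.2]⟩
    have := hslit t hh; rw [h2] at this; exact Complex.slitPlane_ne_zero this rfl
  refine ⟨q, hqK, ?_⟩
  obtain ⟨w, L, hL, hL', hw⟩ := exists_hasW hΓ h01 hqK
  have huc : ContinuousOn (fun t => v t - s) (Icc 0 1) := hvc.sub continuousOn_const
  have A : ∀ a b : ℝ, 0 ≤ a → a ≤ b → b ≤ 1 → (∀ t ∈ Icc a b, v t - s ∈ Complex.slitPlane) →
      L b - L a = Complex.log (v b - s) - Complex.log (v a - s) := by
    intro a b h0 hab h1 h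
    have hsub : Icc a b ⊆ Icc 0 1 := Icc_subset_Icc h0 h1
    have := lift_unique (isPreconnected_Icc (a := a) (b := b)) L
      (fun t => Complex.log (v t - s) - Complex.log e)
      (hL.mono hsub) (((huc.mono hsub).clog h).sub continuousOn_const) (fun t ht => by
        rw [hL' t (hsub ht), hu, Complex.exp_sub, Complex.exp_log (Complex.slitPlane_ne_zero (h t ht)),
          Complex.exp_log he]) (left_mem_Icc.2 hab) (right_mem_Icc.2 hab)
    rw [this]; ring
  have B : ∀ a b : ℝ, 0 ≤ a → a ≤ b → b ≤ 1 → (∀ t ∈ Icc a b, -(v t - s) ∈ Complex.slitPlane) →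
      L b - L a = Complex.log (-(v b - s)) - Complex.log (-(v a - s)) := by
    intro a b h0 hab h1 h
    have hsub : Icc a b ⊆ Icc 0 1 := Icc_subset_Icc h0 h1
    have := lift_unique (isPreconnected_Icc (a := a) (b := b)) L
      (fun t => Complex.log (-(v t - s)) - Complex.log (-e))
      (hL.mono hsub) (((huc.mono hsub).neg.clog h).sub continuousOn_const) (fun t ht => by
        rw [hL' t (hsub ht), hu, Complex.exp_sub, Complex.exp_log (Complex.slitPlane_ne_zero (h t ht)),
          Complex.exp_log (neg_ne_zero.2 he), neg_div_neg_eq]) (left_mem_Icc.2 hab) (right_mem_Icc.2 hab)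
    rw [this]; ring
  have e1 := A η (1 - η) hη.le (by linarith) (by linarith) (fun t ht => hslit t
    ⟨hη.trans_le ht.1, ht.2.trans_lt (by linarith)⟩)
  have e2 := B 0 η le_rfl hη.le (by linarith) hneg1
  have e3 := B (1 - η) 1 (by linarith) (by linarith) le_rfl hneg2
  rw [hv0] at e2
  rw [hv1] at e3
  have etot : L 1 - L 0 = (Complex.log (v (1 - η) - s) - Complex.log (-(v (1 - η) - s))) -
      (Complex.log (v η - s) - Complex.log (-(v η - s))) := by
    linear_combination e1 + e2 + e3
  -- signs
  have hyc : ContinuousOn (fun t => (v t).im) (Icc 0 1) := Complex.continuous_im.comp_continuousOn hvc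
  have hyinj : ∀ a ∈ Ioc 0 η, ∀ b ∈ Ico (1 - η) 1, (v a).im ≠ (v b).im := by
    intro a ha b hb h
    have h1 : v a = v b := Complex.ext ((hz1 a ⟨ha.1.le, ha.2⟩).trans (hz2 b ⟨hb.1, hb.2.le⟩).symm) h
    have ha' : a < 1 := by linarith [ha.2]
    have hb' : 0 < b := by linarith [hb.1]
    have := hinj ⟨ha.1.le, ha'⟩ ⟨hb'.le, hb.2⟩ (hvinj a ⟨ha.1.le, ha'.le⟩ b ⟨hb'.le, hb.2.le⟩ h1)
    linarith [ha.2, hb.1]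
  have s1 := sign_aux (fun t => (v t).im) hyc (by simp [hv0]) (by simp [hv1]) hη hη' hyinj
  have s2 := sign_aux (fun t => -(v t).im) hyc.neg (by simp [hv0]) (by simp [hv1]) hη hη'
    (fun a ha b hb h => hyinj a ha b hb (neg_injective h))
  have n1 : (v η).im ≠ 0 := fun h => hvne η ⟨hη, by linarith⟩
    (Complex.ext (hz1 η ⟨hη.le, le_rfl⟩) h)
  have n2 : (v (1 - η)).im ≠ 0 := fun h => hvne (1 - η) ⟨by linarith, by linarith⟩
    (Complex.ext (hz2 (1 - η) ⟨le_rfl, by linarith⟩) h)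
  have im1 : ∀ t, (v t - s).im = (v t).im := fun t => by simp
  rcases lt_or_gt_of_ne n1 with c1 | c1 <;> rcases lt_or_gt_of_ne n2 with c2 | c2
  · exact absurd ⟨neg_pos.2 c1, neg_pos.2 c2⟩ s2
  · refine ⟨1, by norm_num, L, hL, hL', ?_⟩
    rw [etot, log_sub_log_neg_pos (by rwa [im1]), log_sub_log_neg_neg (by rwa [im1])]
    push_cast; ring
  · refine ⟨-1, by norm_num, L, hL, hL', ?_⟩
    rw [etot, log_sub_log_neg_neg (by rwa [im1]), log_sub_log_neg_pos (by rwa [im1])]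
    push_cast; ring
  · exact absurd ⟨c1, c2⟩ s1

/-- Hypotheses of the Jordan theorem we use. -/
structure JHyp (Γ : ℝ → ℝ × ℝ) : Prop where
  cont : ContinuousOn Γ (Icc 0 1)
  inj : InjOn Γ (Ico 0 1)
  closed : Γ 1 = Γ 0
  tangent : ∃ e : ℂ, e ≠ 0 ∧ (∀ t ∈ Icc (0:ℝ) 1, 0 ≤ (e * cx (Γ t - Γ 0)).re) ∧
    ∃ η : ℝ, 0 < η ∧ η < 1 / 2 ∧ (∀ t ∈ Icc 0 η, (e * cx (Γ t - Γ 0)).re = 0) ∧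
      ∀ t ∈ Icc (1 - η) 1, (e * cx (Γ t - Γ 0)).re = 0

theorem jordan {Γ : ℝ → ℝ × ℝ} (h : JHyp Γ) :
    ∃ σ : ℤ, σ * σ = 1 ∧ ∃ U : Set (ℝ × ℝ), IsOpen U ∧ Disjoint U (Γ '' Icc 0 1) ∧
      hullSet (Γ '' Icc 0 1) = Γ '' Icc 0 1 ∪ U ∧ (∀ x ∈ U, HasW Γ x σ) ∧
      ∀ x, x ∉ Γ '' Icc 0 1 → x ∉ U → HasW Γ x 0 := by
  obtain ⟨hΓ, hinj, h01, e, he, hre, η, hη, hη', hz1, hz2⟩ := h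
  obtain ⟨q, hq, σ, hσ, hqσ⟩ := exists_q hΓ hinj h01 he hre hη hη' hz1 hz2
  set K := Γ '' Icc 0 1 with hK
  have hKc : IsCompact K := isCompact_Icc.image_of_continuousOn hΓ
  have hunb : ∀ x ∉ K, ¬ Bornology.IsBounded (connectedComponentIn Kᶜ x) → HasW Γ x 0 := by
    intro x hx hb
    obtain ⟨R, hR⟩ := hKc.isBounded.subset_closedBall 0
    have : ∃ y ∈ connectedComponentIn Kᶜ x, 2 * R + 1 < ‖y‖ := by
      by_contra hcon
      push Not at hcon
      exact hb (isBounded_iff_forall_norm_le.2 ⟨_, hcon⟩)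
    obtain ⟨y, hy, hyR⟩ := this
    have h0 : HasW Γ y 0 := by
      refine hasW_zero_of_far hΓ h01 fun t ht => ?_
      have h1 : ‖Γ t‖ ≤ R := by
        have := hR ⟨t, ht, rfl⟩
        rwa [mem_closedBall_zero_iff] at this
      linarith [norm_cx_le (Γ t), norm_cx_ge y]
    exact h0.of_component hΓ h01 isPreconnected_connectedComponentIn
      (connectedComponentIn_subset _ _) hy (mem_connectedComponentIn hx)
  have hqb : Bornology.IsBounded (connectedComponentIn Kᶜ q) := by
    by_contra hb
    have := hqσ.unique (hunb q hq hb)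
    rw [this] at hσ; norm_num at hσ
  have hiff : ∀ x ∉ K, Bornology.IsBounded (connectedComponentIn Kᶜ x) ↔
      x ∈ connectedComponentIn Kᶜ q := by
    intro x hx
    constructor
    · intro hb
      have := bounded_comp_unique hΓ hinj h01 hx hq hσ hqσ hb
      rw [← connectedComponentIn_eq this]
      exact mem_connectedComponentIn hx
    · intro hx'
      rw [← connectedComponentIn_eq hx']; exact hqb
  refine ⟨σ, hσ, connectedComponentIn Kᶜ q, hKc.isClosed.isOpen_compl.connectedComponentIn, ?_, ?_, ?_, ?_⟩
  · rw [Set.disjoint_left]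
    intro x hx hxK
    exact connectedComponentIn_subset _ _ hx hxK
  · ext x
    unfold hullSet
    by_cases hx : x ∈ K
    · simp [hx]
    · simp [hx, hiff x hx]
  · intro x hx
    exact hqσ.of_component hΓ h01 isPreconnected_connectedComponentIn
      (connectedComponentIn_subset _ _) (mem_connectedComponentIn hq) hx
  · intro x hx hx'
    exact hunb x hx (fun hb => hx' ((hiff x hx).1 hb))


/-- Piecewise linear on `[a,b]`. -/
inductive PL (A : ℝ → ℝ × ℝ) (a : ℝ) : ℝ → Prop
  | nil : PL A a a
  | snoc (b c : ℝ) (d : ℝ × ℝ) : PL A a b → b < c → (∀ t ∈ Icc b c, A t = A b + (t - b) • d) →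
      PL A a c

namespace PL

variable {A B : ℝ → ℝ × ℝ} {a b c : ℝ}

theorem le (h : PL A a b) : a ≤ b := by
  induction h with
  | nil => exact le_rfl
  | snoc b c d h1 h2 h3 ih => exact ih.trans h2.le

theorem single {d : ℝ × ℝ} (hab : a ≤ b) (h : ∀ t ∈ Icc a b, A t = A a + (t - a) • d) :
    PL A a b := by
  rcases hab.eq_or_lt with rfl | hlt
  · exact nil
  · exact snoc a b d nil hlt h

theorem congr (h : PL A a b) (hAB : EqOn A B (Icc a b)) : PL B a b := by
  induction h with
  | nil => exact nil
  | snoc b c d h1 h2 h3 ih =>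
    refine snoc b c d (ih (hAB.mono (Icc_subset_Icc_right h2.le))) h2 fun t ht => ?_
    rw [← hAB ⟨h1.le.trans ht.1, ht.2⟩, ← hAB ⟨h1.le, h2.le⟩]
    exact h3 t ht

theorem trans (h : PL A a b) (h' : PL A b c) : PL A a c := by
  induction h' with
  | nil => exact h
  | snoc c e d h1 h2 h3 ih => exact snoc c e d ih h2 h3

theorem left (h : PL A a b) {s : ℝ} (hs : s ∈ Icc a b) : PL A a s := by
  induction h with
  | nil => rw [Icc_self, mem_singleton_iff] at hs; subst hs; exact nil
  | snoc b c d h1 h2 h3 ih =>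
    rcases le_or_gt s b with h | h
    · exact ih ⟨hs.1, h⟩
    · exact snoc b s d h1 h fun t ht => h3 t ⟨ht.1, ht.2.trans hs.2⟩

theorem right (h : PL A a b) {s : ℝ} (hs : s ∈ Icc a b) : PL A s b := by
  induction h with
  | nil => rw [Icc_self, mem_singleton_iff] at hs; subst hs; exact nil
  | snoc b c d h1 h2 h3 ih =>
    rcases le_or_gt s b with h | h
    · exact snoc b c d (ih ⟨hs.1, h⟩) h2 h3
    · refine single (d := d) hs.2 fun t ht => ?_
      rw [h3 t ⟨h.le.trans ht.1, ht.2⟩, h3 s ⟨h.le, hs.2⟩, add_assoc, ← add_smul]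
      congr 2; ring

theorem cont (h : PL A a b) : ContinuousOn A (Icc a b) := by
  induction h with
  | nil => rw [Icc_self]; exact continuousOn_singleton _ _
  | snoc b c d h1 h2 h3 ih =>
    rw [← Icc_union_Icc_eq_Icc h1.le h2.le]
    refine ih.union_of_isClosed ?_ isClosed_Icc isClosed_Icc
    refine ContinuousOn.congr (f := fun t => A b + (t - b) • d) ?_ h3
    fun_prop

/-- affine reparametrization -/
theorem affine (h : PL A a b) {k m : ℝ} (hk : 0 < k) :
    PL (fun t => A (k * t + m)) ((a - m) / k) ((b - m) / k) := by
  induction h with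
  | nil => exact nil
  | snoc b c d h1 h2 h3 ih =>
    refine snoc _ _ (k • d) ih (by gcongr) fun t ht => ?_
    have e : k * ((b - m) / k) + m = b := by field_simp; ring
    rw [e, h3, smul_smul]
    · congr 2; field_simp; ring
    · have h1 := (div_le_iff₀ hk).1 ht.1
      have h2 := (le_div_iff₀ hk).1 ht.2
      constructor <;> linarith

theorem edge_deriv {d : ℝ × ℝ} (h3 : ∀ t ∈ Icc b c, A t = A b + (t - b) • d) {t : ℝ}
    (ht : t ∈ Ioo b c) : deriv A t = d := by
  have : HasDerivAt (fun t => A b + (t - b) • d) d t := by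
    have h1 : HasDerivAt (fun t : ℝ => t - b) 1 t := (hasDerivAt_id t).sub_const b
    have := (h1.smul_const d).const_add (A b)
    simpa using this
  refine (this.congr_of_eventuallyEq ?_).deriv
  filter_upwards [Ioo_mem_nhds ht.1 ht.2] with s hs
  exact h3 s ⟨hs.1.le, hs.2.le⟩

theorem edge_congr {d : ℝ × ℝ} (hbc : b ≤ c) (h3 : ∀ t ∈ Icc b c, A t = A b + (t - b) • d)
    (Φ : ℝ × ℝ → ℝ × ℝ → ℝ) :
    ∀ᵐ t, t ∈ uIoc b c → Φ (A t) (deriv A t) = Φ (A b + (t - b) • d) d := by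
  have : ∀ᵐ t : ℝ, t ≠ c := by
    simp [ae_iff]
  filter_upwards [this] with t htc ht
  rw [uIoc_of_le hbc] at ht
  rw [edge_deriv h3 ⟨ht.1, lt_of_le_of_ne ht.2 htc⟩, h3 t ⟨ht.1.le, ht.2⟩]

theorem edge_integral {d : ℝ × ℝ} (hbc : b ≤ c) (h3 : ∀ t ∈ Icc b c, A t = A b + (t - b) • d)
    (Φ : ℝ × ℝ → ℝ × ℝ → ℝ) :
    ∫ t in b..c, Φ (A t) (deriv A t) = ∫ t in b..c, Φ (A b + (t - b) • d) d :=
  intervalIntegral.integral_congr_ae (edge_congr hbc h3 Φ)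

theorem intInt (h : PL A a b) (Φ : ℝ × ℝ → ℝ × ℝ → ℝ) (hΦ : ∀ d, Continuous fun p => Φ p d) :
    IntervalIntegrable (fun t => Φ (A t) (deriv A t)) volume a b := by
  induction h with
  | nil => exact IntervalIntegrable.refl
  | snoc b c d h1 h2 h3 ih =>
    refine ih.trans ?_
    have : IntervalIntegrable (fun t => Φ (A b + (t - b) • d) d) volume b c := by
      apply Continuous.intervalIntegrable
      have := hΦ d
      fun_prop
    refine this.congr_ae ?_
    rw [EventuallyEq, ae_restrict_iff' measurableSet_uIoc]
    filter_upwards [edge_congr h2.le h3 Φ] with t ht h'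
    exact (ht h').symm

theorem ftc (h : PL A a b) (k : ℝ × ℝ →L[ℝ] ℝ) :
    ∫ t in a..b, k (deriv A t) = k (A b) - k (A a) := by
  induction h with
  | nil => simp
  | snoc b c d h1 h2 h3 ih =>
    rw [← intervalIntegral.integral_add_adjacent_intervals
      (h1.intInt (fun _ d => k d) (fun d => continuous_const))
      ((single h2.le h3).intInt (fun _ d => k d) (fun d => continuous_const)), ih,
      edge_integral h2.le h3 (fun _ d => k d)]
    rw [intervalIntegral.integral_const, h3 c ⟨h2.le, le_rfl⟩]
    simp
    ring

theorem integral_congr (h : EqOn A B (Ioo a b)) (hab : a ≤ b) (Φ : ℝ × ℝ → ℝ × ℝ → ℝ) :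
    ∫ t in a..b, Φ (A t) (deriv A t) = ∫ t in a..b, Φ (B t) (deriv B t) := by
  refine intervalIntegral.integral_congr_ae ?_
  have : ∀ᵐ t : ℝ, t ≠ b := by simp [ae_iff]
  filter_upwards [this] with t htc ht
  rw [uIoc_of_le hab] at ht
  have h1 : t ∈ Ioo a b := ⟨ht.1, lt_of_le_of_ne ht.2 htc⟩
  have : A =ᶠ[nhds t] B := by
    filter_upwards [Ioo_mem_nhds h1.1 h1.2] with s hs using h hs
  rw [this.deriv_eq, h h1]

theorem integral_affine {N : ℝ × ℝ → ℝ × ℝ → ℝ} (hN : ∀ (p) (c : ℝ) x, N p (c • x) = |c| * N p x)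
    {k m : ℝ} (hk : 0 < k) :
    ∫ t in ((a - m) / k)..((b - m) / k), N (A (k * t + m)) (deriv (fun t => A (k * t + m)) t) =
      ∫ t in a..b, N (A t) (deriv A t) := by
  have h1 : ∀ t, deriv (fun t => A (k * t + m)) t = k • deriv A (k * t + m) := by
    intro t
    have := deriv_comp_mul_left k (fun s => A (s + m)) t
    rw [this, deriv_comp_add_const]
  simp_rw [h1, hN, abs_of_pos hk]
  rw [intervalIntegral.integral_const_mul, intervalIntegral.mul_integral_comp_mul_add
    (f := fun t => N (A t) (deriv A t))]
  congr 1 <;> field_simp <;> ring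

theorem null (h : PL A a b) : volume (A '' Icc a b) = 0 := by
  induction h with
  | nil => simp
  | snoc b c d h1 h2 h3 ih =>
    rw [← Icc_union_Icc_eq_Icc h1.le h2.le, image_union]
    refine measure_union_null ih ?_
    have : A '' Icc b c ⊆ (AffineMap.lineMap (A b) (A b + d) : ℝ →ᵃ[ℝ] ℝ × ℝ) '' univ := by
      rintro _ ⟨t, ht, rfl⟩
      refine ⟨t - b, trivial, ?_⟩
      rw [h3 t ht, AffineMap.lineMap_apply]; simp [add_comm]
    refine measure_mono_null this ?_
    rw [image_univ]
    have h4 : dimH (range (AffineMap.lineMap (A b) (A b + d) : ℝ →ᵃ[ℝ] ℝ × ℝ)) ≤ 1 := by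
      have : LipschitzWith ‖d‖₊ (AffineMap.lineMap (A b) (A b + d) : ℝ → ℝ × ℝ) := by
        refine LipschitzWith.of_dist_le_mul fun x y => ?_
        rw [dist_lineMap_lineMap, mul_comm]; simp
      refine (this.dimH_range_le).trans ?_
      rw [Real.dimH_univ]
    rw [← hausdorffMeasure_prod_real]
    have := hausdorffMeasure_of_dimH_lt (X := ℝ × ℝ) (d := 2) (s := range (AffineMap.lineMap (A b) (A b + d) : ℝ →ᵃ[ℝ] ℝ × ℝ))
      (h4.trans_lt (by norm_num))
    exact_mod_cast this

end PL


theorem ae_snd_ne (c : ℝ) : ∀ᵐ x : ℝ × ℝ, x.2 ≠ c := by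
  have : ∀ᵐ x : ℝ, x ≠ c := by simp [ae_iff]
  exact (Measure.quasiMeasurePreserving_snd (μ := (volume : Measure ℝ)) (ν := (volume : Measure ℝ))).ae this

theorem cont_d1 {g : ℝ × ℝ → ℝ} (hg : ContDiff ℝ 1 g) (v : ℝ × ℝ) :
    Continuous fun x => fderiv ℝ g x v :=
  (hg.continuous_fderiv (by norm_num)).clm_apply continuous_const

theorem integrable_d1 {g : ℝ × ℝ → ℝ} (hg : ContDiff ℝ 1 g) (hc : HasCompactSupport g) (v : ℝ × ℝ) :
    Integrable fun x => fderiv ℝ g x v :=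
  (cont_d1 hg v).integrable_of_hasCompactSupport (hc.fderiv_apply ℝ v)

theorem strip {g : ℝ × ℝ → ℝ} (hg : ContDiff ℝ 1 g) (hc : HasCompactSupport g) {y0 y1 : ℝ}
    (hy : y0 ≤ y1) {X : ℝ → ℝ} (hX : Continuous X) {S : Set (ℝ × ℝ)}
    (hS : S = {x | x.2 ∈ Ioc y0 y1 ∧ x.1 ≤ X x.2}) :
    Integrable (S.indicator fun x => fderiv ℝ g x (1, 0)) ∧
      ∫ x, S.indicator (fun x => fderiv ℝ g x (1, 0)) x = ∫ y in y0..y1, g (X y, y) := by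
  have hSm : MeasurableSet S := by
    rw [hS]
    refine (measurableSet_Ioc.preimage measurable_snd).inter ?_
    exact (isClosed_le continuous_fst (hX.comp continuous_snd)).measurableSet
  have hi : Integrable (S.indicator fun x => fderiv ℝ g x (1, 0)) :=
    (integrable_d1 hg hc _).indicator hSm
  refine ⟨hi, ?_⟩
  rw [Measure.volume_eq_prod, integral_prod_symm _ (by rwa [← Measure.volume_eq_prod]),
    intervalIntegral.integral_of_le hy, ← integral_indicator measurableSet_Ioc]
  congr 1
  ext y
  by_cases h : y ∈ Ioc y0 y1
  · rw [indicator_of_mem h]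
    have e : ∀ x, S.indicator (fun x => fderiv ℝ g x (1, 0)) (x, y) =
        (Iic (X y)).indicator (fun x => deriv (fun s => g (s, y)) x) x := by
      intro x
      have hd : deriv (fun s => g (s, y)) x = fderiv ℝ g (x, y) (1, 0) := by
        have h1 : HasFDerivAt g (fderiv ℝ g (x, y)) (x, y) :=
          (hg.differentiable (by norm_num) (x, y)).hasFDerivAt
        have h2 : HasDerivAt (fun s : ℝ => (s, y)) (1, 0) x :=
          (hasDerivAt_id x).prodMk (hasDerivAt_const x y)
        exact (h1.comp_hasDerivAt x h2).deriv
      by_cases hx : x ≤ X y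
      · rw [indicator_of_mem (by rw [hS]; exact ⟨h, hx⟩), indicator_of_mem (by exact hx), hd]
      · rw [indicator_of_notMem (by rw [hS]; exact fun h' => hx h'.2), indicator_of_notMem (by exact hx)]
    simp_rw [e]
    rw [integral_indicator measurableSet_Iic]
    refine HasCompactSupport.integral_Iic_deriv_eq (f := fun s => g (s, y)) ?_ ?_ (X y)
    · exact hg.comp (contDiff_id.prodMk contDiff_const)
    · refine HasCompactSupport.of_support_subset_isCompact (hc.isCompact.image continuous_fst) ?_
      intro s hs
      exact ⟨(s, y), subset_tsupport _ hs, rfl⟩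
  · rw [indicator_of_notMem h]
    have e : ∀ x, S.indicator (fun x => fderiv ℝ g x (1, 0)) (x, y) = 0 := by
      intro x
      rw [indicator_of_notMem (by rw [hS]; exact fun h' => h h'.1)]
    simp [e]

/-- crossing data of a path: function `k` -/
def Cross (A : ℝ → ℝ × ℝ) (a b : ℝ) (k : ℝ × ℝ → ℝ) : Prop :=
  (∀ g : ℝ × ℝ → ℝ, ContDiff ℝ 1 g → HasCompactSupport g →
    Integrable (fun x => k x * fderiv ℝ g x (1, 0)) ∧
    ∫ t in a..b, g (A t) * (deriv A t).2 = ∫ x, k x * fderiv ℝ g x (1, 0)) ∧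
  ∀ᵐ x : ℝ × ℝ, ∀ L : ℝ → ℂ, ContinuousOn L (Icc a b) →
    (∀ t ∈ Icc a b, Complex.exp (L t) = cx (A t - x)) →
    L b - L a = Complex.log (-cx (A b - x)) - Complex.log (-cx (A a - x)) +
      k x * (2 * Real.pi * Complex.I)

theorem edge_lift_neg {z L : ℝ → ℂ} {b c : ℝ} (hbc : b ≤ c) (hz : ContinuousOn z (Icc b c))
    (hL : ContinuousOn L (Icc b c)) (hLz : ∀ t ∈ Icc b c, Complex.exp (L t) = z t)
    (hs : ∀ t ∈ Icc b c, -z t ∈ Complex.slitPlane) :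
    L c - L b = Complex.log (-z c) - Complex.log (-z b) := by
  have := lift_unique isPreconnected_Icc (fun t => L t + Real.pi * Complex.I)
    (fun t => Complex.log (-z t)) (hL.add continuousOn_const)
    (hz.neg.clog hs) (fun t ht => by
      rw [Complex.exp_add, Complex.exp_pi_mul_I, hLz t ht, Complex.exp_log]
      · ring
      · exact Complex.slitPlane_ne_zero (hs t ht))
    (left_mem_Icc.2 hbc) (right_mem_Icc.2 hbc)
  linear_combination this

theorem edge_lift_pos {z L : ℝ → ℂ} {b c : ℝ} (hbc : b ≤ c) (hz : ContinuousOn z (Icc b c))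
    (hL : ContinuousOn L (Icc b c)) (hLz : ∀ t ∈ Icc b c, Complex.exp (L t) = z t)
    (hs : ∀ t ∈ Icc b c, z t ∈ Complex.slitPlane) :
    L c - L b = Complex.log (z c) - Complex.log (z b) := by
  exact lift_unique isPreconnected_Icc L
    (fun t => Complex.log (z t)) hL
    (hz.clog hs) (fun t ht => by
      rw [hLz t ht, Complex.exp_log]
      exact Complex.slitPlane_ne_zero (hs t ht))
    (left_mem_Icc.2 hbc) (right_mem_Icc.2 hbc)

theorem edge_cross {A : ℝ → ℝ × ℝ} {b c : ℝ} {d : ℝ × ℝ} (hbc : b < c)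
    (h3 : ∀ t ∈ Icc b c, A t = A b + (t - b) • d) : ∃ k, Cross A b c k := by
  classical
  have hAc : ContinuousOn A (Icc b c) := (PL.single hbc.le h3).cont
  have hzc : ∀ x, ContinuousOn (fun t => cx (A t - x)) (Icc b c) := fun x =>
    cx_continuous.comp_continuousOn (hAc.sub continuousOn_const)
  have hre : ∀ x, ∀ t ∈ Icc b c, (cx (A t - x)).re = (A b).1 + (t - b) * d.1 - x.1 := by
    intro x t ht; rw [cx_re, h3 t ht]; rfl
  have him : ∀ x, ∀ t ∈ Icc b c, (cx (A t - x)).im = (A b).2 + (t - b) * d.2 - x.2 := by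
    intro x t ht; rw [cx_im, h3 t ht]; rfl
  have hAc2 : (A c).2 = (A b).2 + (c - b) * d.2 := by rw [h3 c ⟨hbc.le, le_rfl⟩]; rfl
  set X : ℝ → ℝ := fun y => (A b).1 + (y - (A b).2) * (d.1 / d.2) with hX
  have hXc : Continuous X := by fun_prop
  have hsub : ∀ g : ℝ × ℝ → ℝ, d.2 ≠ 0 → ∫ t in b..c, g (A t) * (deriv A t).2 =
      ∫ y in (A b).2..(A c).2, g (X y, y) := by
    intro g hd
    rw [PL.edge_integral hbc.le h3 (fun p v => g p * v.2)]
    have := intervalIntegral.smul_integral_comp_mul_add (a := b) (b := c)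
      (fun y => g (X y, y)) d.2 ((A b).2 - b * d.2)
    rw [show d.2 * b + ((A b).2 - b * d.2) = (A b).2 by ring,
      show d.2 * c + ((A b).2 - b * d.2) = (A c).2 by rw [hAc2]; ring] at this
    rw [← this, intervalIntegral.integral_mul_const, smul_eq_mul, mul_comm]
    congr 2
    ext t
    congr 1
    ext
    · simp only [hX, Prod.fst_add, Prod.smul_fst, smul_eq_mul]; field_simp; ring
    · simp only [Prod.snd_add, Prod.smul_snd, smul_eq_mul]; ring
  have hL0 : ∀ x : ℝ × ℝ, ∀ L : ℝ → ℂ, (∀ t ∈ Icc b c, Complex.exp (L t) = cx (A t - x)) →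
      ∀ t ∈ Icc b c, (cx (A t - x)).im = 0 → (cx (A t - x)).re ≠ 0 := by
    intro x L hL t ht h1 h2
    have : cx (A t - x) = 0 := Complex.ext h2 h1
    rw [← hL t ht] at this
    exact Complex.exp_ne_zero _ this
  have hXt : ∀ x, d.2 ≠ 0 → ∀ t ∈ Icc b c, (cx (A t - x)).im = 0 →
      (cx (A t - x)).re = X x.2 - x.1 := by
    intro x hd t ht h0
    rw [hre x t ht]
    rw [him x t ht] at h0
    simp only [hX]
    have : x.2 = (A b).2 + (t - b) * d.2 := by linarith
    rw [this]; field_simp; ring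
  have hbm : b ∈ Icc b c := ⟨le_rfl, hbc.le⟩
  have hcm : c ∈ Icc b c := ⟨hbc.le, le_rfl⟩
  rcases lt_trichotomy d.2 0 with hd | hd | hd
  · set S : Set (ℝ × ℝ) := {x | x.2 ∈ Ioc (A c).2 (A b).2 ∧ x.1 ≤ X x.2} with hS
    have hle : (A c).2 ≤ (A b).2 := by rw [hAc2]; nlinarith
    refine ⟨fun x => if x ∈ S then -1 else 0, fun g hg hgc => ?_, ?_⟩
    · obtain ⟨i1, i2⟩ := strip hg hgc hle hXc hS
      have e : (fun x => (if x ∈ S then (-1:ℝ) else 0) * fderiv ℝ g x (1, 0)) =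
          fun x => - S.indicator (fun x => fderiv ℝ g x (1, 0)) x := by
        ext x; by_cases hx : x ∈ S <;> simp [hx]
      rw [e]
      refine ⟨i1.neg, ?_⟩
      rw [integral_neg, i2, hsub g hd.ne, intervalIntegral.integral_symm]
    · filter_upwards [ae_snd_ne (A b).2, ae_snd_ne (A c).2] with x n1 n2 L hL hLz
      by_cases hx : x ∈ S
      · rw [if_pos hx, edge_lift_pos hbc.le (hzc x) hL hLz]
        · have a1 := log_sub_log_neg_pos (z := cx (A b - x)) (by
            rw [cx_im]; exact sub_pos.2 (lt_of_le_of_ne hx.1.2 n1))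
          have a2 := log_sub_log_neg_neg (z := cx (A c - x)) (by
            rw [cx_im]; exact sub_neg.2 hx.1.1)
          push_cast
          linear_combination a2 - a1
        · intro t ht
          rw [Complex.mem_slitPlane_iff]
          by_cases h0 : (cx (A t - x)).im = 0
          · left
            refine lt_of_le_of_ne ?_ (hL0 x L hLz t ht h0).symm
            rw [hXt x hd.ne t ht h0]; exact sub_nonneg.2 hx.2
          · right; exact h0
      · rw [if_neg hx, edge_lift_neg hbc.le (hzc x) hL hLz]
        · simp
        · intro t ht
          rw [Complex.mem_slitPlane_iff]
          by_cases h0 : (cx (A t - x)).im = 0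
          · left
            rw [Complex.neg_re, hXt x hd.ne t ht h0]
            by_contra hcon
            refine hx ⟨?_, by linarith⟩
            rw [him x t ht] at h0
            rw [hAc2]
            have t1 := ht.1
            have t2 := ht.2
            refine ⟨lt_of_le_of_ne (by nlinarith) (by rw [← hAc2]; exact n2.symm), by nlinarith⟩
          · right; rw [Complex.neg_im, neg_ne_zero]; exact h0
  · refine ⟨fun x => 0, fun g hg hgc => ?_, ?_⟩
    · refine ⟨by simp, ?_⟩
      rw [PL.edge_integral hbc.le h3 (fun p v => g p * v.2)]
      simp [hd]
    · filter_upwards [ae_snd_ne (A b).2] with x n1 L hL hLz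
      rw [edge_lift_neg hbc.le (hzc x) hL hLz]
      · simp
      · intro t ht
        rw [Complex.mem_slitPlane_iff]
        right
        rw [Complex.neg_im, neg_ne_zero, him x t ht, hd, mul_zero, add_zero]
        exact sub_ne_zero.2 n1.symm
  · set S : Set (ℝ × ℝ) := {x | x.2 ∈ Ioc (A b).2 (A c).2 ∧ x.1 ≤ X x.2} with hS
    have hle : (A b).2 ≤ (A c).2 := by rw [hAc2]; nlinarith
    refine ⟨fun x => if x ∈ S then 1 else 0, fun g hg hgc => ?_, ?_⟩
    · obtain ⟨i1, i2⟩ := strip hg hgc hle hXc hS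
      have e : (fun x => (if x ∈ S then (1:ℝ) else 0) * fderiv ℝ g x (1, 0)) =
          fun x => S.indicator (fun x => fderiv ℝ g x (1, 0)) x := by
        ext x; by_cases hx : x ∈ S <;> simp [hx]
      rw [e]
      exact ⟨i1, by rw [i2, hsub g hd.ne']⟩
    · filter_upwards [ae_snd_ne (A b).2, ae_snd_ne (A c).2] with x n1 n2 L hL hLz
      by_cases hx : x ∈ S
      · rw [if_pos hx, edge_lift_pos hbc.le (hzc x) hL hLz]
        · have a1 := log_sub_log_neg_neg (z := cx (A b - x)) (by
            rw [cx_im]; exact sub_neg.2 hx.1.1)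
          have a2 := log_sub_log_neg_pos (z := cx (A c - x)) (by
            rw [cx_im]; exact sub_pos.2 (lt_of_le_of_ne hx.1.2 n2))
          push_cast
          linear_combination a2 - a1
        · intro t ht
          rw [Complex.mem_slitPlane_iff]
          by_cases h0 : (cx (A t - x)).im = 0
          · left
            refine lt_of_le_of_ne ?_ (hL0 x L hLz t ht h0).symm
            rw [hXt x hd.ne' t ht h0]; exact sub_nonneg.2 hx.2
          · right; exact h0
      · rw [if_neg hx, edge_lift_neg hbc.le (hzc x) hL hLz]
        · simp
        · intro t ht
          rw [Complex.mem_slitPlane_iff]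
          by_cases h0 : (cx (A t - x)).im = 0
          · left
            rw [Complex.neg_re, hXt x hd.ne' t ht h0]
            by_contra hcon
            refine hx ⟨?_, by linarith⟩
            rw [him x t ht] at h0
            rw [hAc2]
            have t1 := ht.1
            have t2 := ht.2
            refine ⟨lt_of_le_of_ne (by nlinarith) n1.symm, by nlinarith⟩
          · right; rw [Complex.neg_im, neg_ne_zero]; exact h0

theorem PL.cross {A : ℝ → ℝ × ℝ} {a b : ℝ} (h : PL A a b) : ∃ k, Cross A a b k := by
  induction h with
  | nil => exact ⟨fun _ => 0, fun g hg hgc => by simp, by simp⟩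
  | snoc b c d h1 h2 h3 ih =>
    obtain ⟨k1, p1, q1⟩ := ih
    obtain ⟨k2, p2, q2⟩ := edge_cross h2 h3
    refine ⟨fun x => k1 x + k2 x, fun g hg hgc => ?_, ?_⟩
    · obtain ⟨i1, j1⟩ := p1 g hg hgc
      obtain ⟨i2, j2⟩ := p2 g hg hgc
      simp_rw [add_mul]
      refine ⟨i1.add i2, ?_⟩
      rw [integral_add i1 i2, ← j1, ← j2]
      have hΦ : ∀ d : ℝ × ℝ, Continuous fun p => g p * d.2 := fun d =>
        hg.continuous.mul continuous_const
      exact (intervalIntegral.integral_add_adjacent_intervals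
        (h1.intInt (fun p v => g p * v.2) hΦ)
        ((PL.single h2.le h3).intInt (fun p v => g p * v.2) hΦ)).symm
    · filter_upwards [q1, q2] with x r1 r2 L hL hLz
      have e1 := r1 L (hL.mono (Icc_subset_Icc_right h2.le))
        (fun t ht => hLz t ⟨ht.1, ht.2.trans h2.le⟩)
      have e2 := r2 L (hL.mono (Icc_subset_Icc_left h1.le))
        (fun t ht => hLz t ⟨h1.le.trans ht.1, ht.2⟩)
      push_cast
      linear_combination e1 + e2

theorem PL.green1 {A : ℝ → ℝ × ℝ} (h : PL A 0 1) (hcl : A 1 = A 0) {w : ℝ × ℝ → ℤ}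
    (hw : ∀ᵐ x, HasW A x (w x)) {g : ℝ × ℝ → ℝ} (hg : ContDiff ℝ 1 g) (hgc : HasCompactSupport g) :
    Integrable (fun x => (w x : ℝ) * fderiv ℝ g x (1, 0)) ∧
    ∫ t in (0:ℝ)..1, g (A t) * (deriv A t).2 = ∫ x, (w x : ℝ) * fderiv ℝ g x (1, 0) := by
  obtain ⟨k, h1, h2⟩ := h.cross
  obtain ⟨h3, h4⟩ := h1 g hg hgc
  have : (fun x => k x * fderiv ℝ g x (1, 0)) =ᵐ[volume] fun x => (w x : ℝ) * fderiv ℝ g x (1, 0) := by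
    filter_upwards [h2, hw] with x hx ⟨L, hL, hLz, e⟩
    have := hx L hL hLz
    rw [hcl, sub_self, zero_add, e] at this
    have h5 := mul_right_cancel₀ Complex.two_pi_I_ne_zero this
    have h6 : (w x : ℝ) = k x := by exact_mod_cast h5
    rw [h6]
  exact ⟨h3.congr this, by rw [h4, integral_congr_ae this]⟩

theorem deriv_swap' (A : ℝ → ℝ × ℝ) (t : ℝ) : deriv (fun t => (A t).swap) t = (deriv A t).swap := by
  have := (ContinuousLinearEquiv.prodComm ℝ ℝ ℝ).comp_fderiv (f := A) (x := t)
  exact congrArg (fun l => l 1) this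

theorem PL.swap {A : ℝ → ℝ × ℝ} {a b : ℝ} (h : PL A a b) : PL (fun t => (A t).swap) a b := by
  induction h with
  | nil => exact nil
  | snoc b c d h1 h2 h3 ih =>
    refine snoc b c d.swap ih h2 fun t ht => ?_
    rw [h3 t ht]; rfl

theorem HasW.swap {A : ℝ → ℝ × ℝ} {x : ℝ × ℝ} {w : ℤ} (h : HasW A x w) :
    HasW (fun t => (A t).swap) x.swap (-w) := by
  obtain ⟨L, hL, hLz, e⟩ := h
  refine ⟨fun t => (starRingEnd ℂ) (L t) + Real.pi / 2 * Complex.I,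
    (Complex.continuous_conj.comp_continuousOn hL).add continuousOn_const, fun t ht => ?_, ?_⟩
  · rw [Complex.exp_add, Complex.exp_conj, hLz t ht, Complex.exp_pi_div_two_mul_I]
    apply Complex.ext <;> simp [cx_re, cx_im]
  · have : (starRingEnd ℂ) (L 1 - L 0) = -(w * (2 * Real.pi * Complex.I)) := by
      rw [e]; simp [map_ofNat (starRingEnd ℂ) 2]
    rw [map_sub] at this
    push_cast
    linear_combination this

theorem mp_swap : MeasurePreserving (Prod.swap : ℝ × ℝ → ℝ × ℝ) := by
  exact Measure.measurePreserving_swap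

theorem fderiv_swap' {g : ℝ × ℝ → ℝ} (hg : ContDiff ℝ 1 g) (x : ℝ × ℝ) :
    fderiv ℝ (fun p : ℝ × ℝ => g p.swap) x.swap (1, 0) = fderiv ℝ g x (0, 1) := by
  have h1 : HasFDerivAt g (fderiv ℝ g x) (x.swap.swap) :=
    (hg.differentiable (by norm_num) x).hasFDerivAt
  have h2 := h1.comp x.swap (ContinuousLinearEquiv.prodComm ℝ ℝ ℝ).hasFDerivAt
  have h3 : fderiv ℝ (fun p : ℝ × ℝ => g p.swap) x.swap = _ := h2.fderiv
  rw [h3]; rfl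

theorem PL.green2 {A : ℝ → ℝ × ℝ} (h : PL A 0 1) (hcl : A 1 = A 0) {w : ℝ × ℝ → ℤ}
    (hw : ∀ᵐ x, HasW A x (w x)) {g : ℝ × ℝ → ℝ} (hg : ContDiff ℝ 1 g) (hgc : HasCompactSupport g) :
    Integrable (fun x => (w x : ℝ) * fderiv ℝ g x (0, 1)) ∧
    ∫ t in (0:ℝ)..1, g (A t) * (deriv A t).1 = - ∫ x, (w x : ℝ) * fderiv ℝ g x (0, 1) := by
  have hw' : ∀ᵐ x, HasW (fun t => (A t).swap) x (-w x.swap) := by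
    filter_upwards [mp_swap.quasiMeasurePreserving.ae hw] with x hx
    exact hx.swap
  have hg' : ContDiff ℝ 1 (fun p : ℝ × ℝ => g p.swap) :=
    hg.comp (ContinuousLinearEquiv.prodComm ℝ ℝ ℝ).contDiff
  have hgc' : HasCompactSupport (fun p : ℝ × ℝ => g p.swap) :=
    hgc.comp_homeomorph (Homeomorph.prodComm ℝ ℝ)
  obtain ⟨h1, h2⟩ := h.swap.green1 (by simp [hcl]) hw' hg' hgc'
  have me : MeasurableEmbedding (Prod.swap : ℝ × ℝ → ℝ × ℝ) :=
    (MeasurableEquiv.prodComm (α := ℝ) (β := ℝ)).measurableEmbedding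
  have e : (fun x : ℝ × ℝ => (((-w x.swap : ℤ) : ℝ)) * fderiv ℝ (fun p : ℝ × ℝ => g p.swap) x (1, 0)) ∘ Prod.swap
      = fun x => -((w x : ℝ) * fderiv ℝ g x (0, 1)) := by
    ext x
    simp only [Function.comp, Prod.swap_swap]
    rw [fderiv_swap' hg]; push_cast; ring
  constructor
  · have := (mp_swap.integrable_comp_emb me).2 h1
    rw [e] at this
    simpa using this.neg
  · have e2 := mp_swap.integral_comp me (fun x : ℝ × ℝ => (((-w x.swap : ℤ) : ℝ)) *
      fderiv ℝ (fun p : ℝ × ℝ => g p.swap) x (1, 0))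
    rw [← integral_neg, ← e]
    refine Eq.trans ?_ e2.symm
    rw [← h2]
    simp_rw [deriv_swap']
    simp

/-- line integrand -/
def lineI (f : ℝ × ℝ → ℝ × ℝ) (p v : ℝ × ℝ) : ℝ := (f p).1 * v.2 - (f p).2 * v.1

theorem lineI_cont {f : ℝ × ℝ → ℝ × ℝ} (hf : Continuous f) (d : ℝ × ℝ) :
    Continuous fun p => lineI f p d := by unfold lineI; fun_prop

theorem PL.green {A : ℝ → ℝ × ℝ} (h : PL A 0 1) (hcl : A 1 = A 0) {w : ℝ × ℝ → ℤ}
    (hw : ∀ᵐ x, HasW A x (w x)) {f : ℝ × ℝ → ℝ × ℝ} (hf : ContDiff ℝ 1 f) (hfc : HasCompactSupport f) :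
    ∫ t in (0:ℝ)..1, lineI f (A t) (deriv A t) = ∫ x, (w x : ℝ) * div2 f x := by
  have d1 : ∀ x v, fderiv ℝ (fun p => (f p).1) x v = (fderiv ℝ f x v).1 := by
    intro x v
    rw [fderiv.fst (hf.differentiable (by norm_num) x)]; rfl
  have d2 : ∀ x v, fderiv ℝ (fun p => (f p).2) x v = (fderiv ℝ f x v).2 := by
    intro x v
    rw [fderiv.snd (hf.differentiable (by norm_num) x)]; rfl
  obtain ⟨i1, j1⟩ := h.green1 hcl hw (g := fun p => (f p).1) (by fun_prop)
    (hfc.comp_left (g := Prod.fst) rfl)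
  obtain ⟨i2, j2⟩ := h.green2 hcl hw (g := fun p => (f p).2) (by fun_prop)
    (hfc.comp_left (g := Prod.snd) rfl)
  unfold lineI div2
  have hfcont := hf.continuous
  rw [intervalIntegral.integral_sub (h.intInt (fun p v => (f p).1 * v.2) (by intro d; fun_prop))
    (h.intInt (fun p v => (f p).2 * v.1) (by intro d; fun_prop)), j1, j2, sub_neg_eq_add,
    ← integral_add i1 i2]
  simp_rw [d1, d2, mul_add]


namespace IsNorm2
variable {τ : ℝ × ℝ → ℝ}

theorem zero (h : IsNorm2 τ) : τ 0 = 0 := (h.1 0).2 rfl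
theorem neg (h : IsNorm2 τ) (x : ℝ × ℝ) : τ (-x) = τ x := by
  have := h.2.1 (-1) x; simpa using this
theorem nonneg (h : IsNorm2 τ) (x : ℝ × ℝ) : 0 ≤ τ x := by
  have := h.2.2 x (-x)
  rw [h.neg, add_neg_cancel, h.zero] at this; linarith
theorem sub_le (h : IsNorm2 τ) (x y : ℝ × ℝ) : τ x - τ y ≤ τ (x - y) := by
  have := h.2.2 (x - y) y
  rw [sub_add_cancel] at this; linarith

theorem upper (h : IsNorm2 τ) : ∃ M, 0 < M ∧ ∀ x, τ x ≤ M * ‖x‖ := by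
  refine ⟨τ (1, 0) + τ (0, 1) + 1, by have := h.nonneg (1,0); have := h.nonneg (0,1); linarith, fun x => ?_⟩
  have e : x = x.1 • ((1, 0) : ℝ × ℝ) + x.2 • ((0, 1) : ℝ × ℝ) := by ext <;> simp
  have h1 : τ x ≤ |x.1| * τ (1, 0) + |x.2| * τ (0, 1) := by
    conv_lhs => rw [e]
    rw [← h.2.1, ← h.2.1]; exact h.2.2 _ _
  have h2 : |x.1| ≤ ‖x‖ := by rw [Prod.norm_def]; exact le_max_left _ _
  have h3 : |x.2| ≤ ‖x‖ := by rw [Prod.norm_def]; exact le_max_right _ _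
  have := mul_le_mul_of_nonneg_right h2 (h.nonneg (1, 0))
  have := mul_le_mul_of_nonneg_right h3 (h.nonneg (0, 1))
  nlinarith [norm_nonneg x]

theorem continuous (h : IsNorm2 τ) : Continuous τ := by
  obtain ⟨M, hM, hb⟩ := h.upper
  refine (LipschitzWith.of_dist_le_mul (K := ⟨M, hM.le⟩) fun x y => ?_).continuous
  rw [Real.dist_eq, dist_eq_norm, abs_le]
  have h1 := h.sub_le x y
  have h2 := h.sub_le y x
  have h3 := hb (x - y)
  have h4 := hb (y - x)
  rw [norm_sub_rev] at h4
  constructor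
  · show -(M * ‖x - y‖) ≤ _; linarith
  · show _ ≤ (M * ‖x - y‖); linarith

theorem lower (h : IsNorm2 τ) : ∃ c, 0 < c ∧ ∀ x, c * ‖x‖ ≤ τ x := by
  have hne : (Metric.sphere (0 : ℝ × ℝ) 1).Nonempty := ⟨(1, 0), by simp [Prod.norm_def]⟩
  obtain ⟨x0, hx0, hmin⟩ := (isCompact_sphere (0 : ℝ × ℝ) 1).exists_isMinOn hne h.continuous.continuousOn
  have hx0n : x0 ≠ 0 := by rintro rfl; simp at hx0
  refine ⟨τ x0, lt_of_le_of_ne (h.nonneg _) (fun e => hx0n ((h.1 _).1 e.symm)), fun x => ?_⟩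
  by_cases hx : x = 0
  · subst hx; simp [h.zero]
  · have hn : 0 < ‖x‖ := norm_pos_iff.2 hx
    have : τ x0 ≤ τ (‖x‖⁻¹ • x) := hmin (by simp [norm_smul, hn.ne'])
    rw [h.2.1, abs_of_pos (by positivity)] at this
    calc τ x0 * ‖x‖ ≤ (‖x‖⁻¹ * τ x) * ‖x‖ := by gcongr
      _ = τ x := by field_simp

theorem dual_bdd (h : IsNorm2 τ) (w : ℝ × ℝ) : BddAbove {x | ∃ v : ℝ × ℝ, τ v ≤ 1 ∧ x = v.1 * w.1 + v.2 * w.2} := by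
  obtain ⟨c, hc, hl⟩ := h.lower
  refine ⟨c⁻¹ * |w.1| + c⁻¹ * |w.2|, ?_⟩
  rintro _ ⟨v, hv, rfl⟩
  have h0 : ‖v‖ ≤ c⁻¹ := by
    rw [← one_div, le_div_iff₀ hc]; linarith [hl v]
  have h2 : |v.1| ≤ ‖v‖ := by rw [Prod.norm_def]; exact le_max_left _ _
  have h3 : |v.2| ≤ ‖v‖ := by rw [Prod.norm_def]; exact le_max_right _ _
  have h4 : v.1 * w.1 ≤ c⁻¹ * |w.1| := by
    refine (le_abs_self _).trans ?_
    rw [abs_mul]; exact mul_le_mul_of_nonneg_right (h2.trans h0) (abs_nonneg _)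
  have h5 : v.2 * w.2 ≤ c⁻¹ * |w.2| := by
    refine (le_abs_self _).trans ?_
    rw [abs_mul]; exact mul_le_mul_of_nonneg_right (h3.trans h0) (abs_nonneg _)
  linarith

theorem dual_iff (h : IsNorm2 τ) (w : ℝ × ℝ) : dualNorm τ w ≤ 1 ↔ ∀ v : ℝ × ℝ, v.1 * w.1 + v.2 * w.2 ≤ τ v := by
  constructor
  · intro hd v
    by_cases hv : v = 0
    · subst hv; simp [h.zero]
    · have hp : 0 < τ v := lt_of_le_of_ne (h.nonneg _) (fun e => hv ((h.1 _).1 e.symm))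
      have h1 : τ ((τ v)⁻¹ • v) ≤ 1 := by
        rw [h.2.1, abs_of_pos (by positivity), inv_mul_cancel₀ hp.ne']
      have h2 := (le_csSup (h.dual_bdd w) ⟨_, h1, rfl⟩).trans hd
      simp only [Prod.smul_fst, Prod.smul_snd, smul_eq_mul] at h2
      have h3 : (τ v)⁻¹ * (v.1 * w.1 + v.2 * w.2) ≤ 1 := by linarith
      rwa [inv_mul_le_iff₀ hp, mul_one] at h3
  · intro hv
    refine csSup_le ⟨_, 0, by simp [h.zero], rfl⟩ ?_
    rintro _ ⟨v, hv1, rfl⟩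
    exact (hv v).trans hv1

theorem dual_exists (h : IsNorm2 τ) (v : ℝ × ℝ) : ∃ w : ℝ × ℝ, dualNorm τ w ≤ 1 ∧ v.1 * w.1 + v.2 * w.2 = τ v := by
  by_cases hv : v = 0
  · subst hv
    refine ⟨0, (h.dual_iff 0).2 fun v => by simpa using h.nonneg v, by simp [h.zero]⟩
  obtain ⟨g, hg1, hg2⟩ := exists_extension_of_le_sublinear
    (LinearPMap.mkSpanSingleton v (τ v) hv) τ (fun c hc x => by rw [h.2.1, abs_of_pos hc]) h.2.2
    (by
      rintro ⟨x, hx⟩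
      obtain ⟨c, rfl⟩ := Submodule.mem_span_singleton.1 hx
      rw [LinearPMap.mkSpanSingleton'_apply, h.2.1, smul_eq_mul]
      exact mul_le_mul_of_nonneg_right (le_abs_self c) (h.nonneg v))
  have e : ∀ x : ℝ × ℝ, x.1 * g (1, 0) + x.2 * g (0, 1) = g x := by
    intro x
    have : x = x.1 • ((1, 0) : ℝ × ℝ) + x.2 • ((0, 1) : ℝ × ℝ) := by ext <;> simp
    conv_rhs => rw [this]
    rw [map_add, map_smul, map_smul, smul_eq_mul, smul_eq_mul]
  refine ⟨(g (1, 0), g (0, 1)), (h.dual_iff _).2 fun x => ?_, ?_⟩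
  · simp only; rw [e]; exact hg2 x
  · simp only; rw [e]
    have := hg1 ⟨v, Submodule.mem_span_singleton_self v⟩
    rw [this]
    have := LinearPMap.mkSpanSingleton_apply ℝ ℝ (σ := RingHom.id ℝ) hv (τ v)
    exact this

end IsNorm2

/-- rotated norm -/
def rotN (τ : ℝ × ℝ → ℝ) (v : ℝ × ℝ) : ℝ := τ (v.2, -v.1)

theorem rotN_norm {τ : ℝ × ℝ → ℝ} (h : IsNorm2 τ) : IsNorm2 (rotN τ) := by
  refine ⟨fun x => ?_, fun c x => ?_, fun x y => ?_⟩
  · rw [rotN, h.1]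
    constructor
    · intro e
      have h1 := congrArg Prod.fst e
      have h2 := congrArg Prod.snd e
      simp at h1 h2
      ext <;> simp [h1, h2]
    · rintro rfl; simp
  · rw [rotN, rotN, ← h.2.1]; simp
  · rw [rotN, rotN, rotN]
    have := h.2.2 (x.2, -x.1) (y.2, -y.1)
    simpa [add_comm] using this

/-- The genuine open square. -/
def Oq : Set (ℝ × ℝ) := Ioo (-1) 1 ×ˢ Ioo (-1) 1

theorem isOpen_Oq : IsOpen Oq := isOpen_Ioo.prod isOpen_Ioo

open Classical in
/-- Length integrand restricted to the open square. -/
noncomputable def iN (τ : ℝ × ℝ → ℝ) (p v : ℝ × ℝ) : ℝ := if p ∈ Oq then rotN τ v else 0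

theorem iN_of_mem {τ : ℝ × ℝ → ℝ} {p v : ℝ × ℝ} (h : p ∈ Oq) : iN τ p v = rotN τ v := if_pos h
theorem iN_of_not_mem {τ : ℝ × ℝ → ℝ} {p v : ℝ × ℝ} (h : p ∉ Oq) : iN τ p v = 0 := if_neg h

section len
variable {τ : ℝ × ℝ → ℝ} {A : ℝ → ℝ × ℝ} {a b : ℝ}

theorem lineI_le (h : IsNorm2 τ) {f : ℝ × ℝ → ℝ × ℝ} {p : ℝ × ℝ} (hp : dualNorm τ (f p) ≤ 1) (v : ℝ × ℝ) :
    lineI f p v ≤ rotN τ v := by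
  have := (h.dual_iff _).1 hp (v.2, -v.1)
  unfold lineI rotN
  simp only at this; linarith

theorem neg_le_lineI (h : IsNorm2 τ) {f : ℝ × ℝ → ℝ × ℝ} {p : ℝ × ℝ} (hp : dualNorm τ (f p) ≤ 1) (v : ℝ × ℝ) :
    -rotN τ v ≤ lineI f p v := by
  have := (h.dual_iff _).1 hp (-(v.2, -v.1))
  rw [h.neg] at this
  unfold lineI rotN
  simp only [Prod.fst_neg, Prod.snd_neg] at this; linarith

theorem lineI_le' (h : IsNorm2 τ) {f : ℝ × ℝ → ℝ × ℝ} {p : ℝ × ℝ} (hp : dualNorm τ (f p) ≤ 1) (hz : p ∉ Oq → f p = 0)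
    (v : ℝ × ℝ) : lineI f p v ≤ iN τ p v := by
  by_cases ho : p ∈ Oq
  · rw [iN_of_mem ho]; exact lineI_le h hp v
  · rw [iN_of_not_mem ho, lineI, hz ho]; simp

theorem neg_le_lineI' (h : IsNorm2 τ) {f : ℝ × ℝ → ℝ × ℝ} {p : ℝ × ℝ} (hp : dualNorm τ (f p) ≤ 1)
    (hz : p ∉ Oq → f p = 0) (v : ℝ × ℝ) : -iN τ p v ≤ lineI f p v := by
  by_cases ho : p ∈ Oq
  · rw [iN_of_mem ho]; exact neg_le_lineI h hp v
  · rw [iN_of_not_mem ho, lineI, hz ho]; simp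

theorem iN_nonneg (h : IsNorm2 τ) (p v : ℝ × ℝ) : 0 ≤ iN τ p v := by
  unfold iN; split_ifs
  · exact (rotN_norm h).nonneg v
  · exact le_rfl

theorem iN_le (h : IsNorm2 τ) (p v : ℝ × ℝ) : iN τ p v ≤ rotN τ v := by
  unfold iN; split_ifs
  · exact le_rfl
  · exact (rotN_norm h).nonneg v

theorem iN_smul (h : IsNorm2 τ) (p : ℝ × ℝ) (c : ℝ) (v : ℝ × ℝ) : iN τ p (c • v) = |c| * iN τ p v := by
  unfold iN; split_ifs
  · exact (rotN_norm h).2.1 c v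
  · simp

theorem lenInt (h : IsNorm2 τ) (hA : PL A a b) : IntervalIntegrable (fun t => iN τ (A t) (deriv A t)) volume a b := by
  classical
  induction hA with
  | nil => exact IntervalIntegrable.refl
  | snoc b c d h1 h2 h3 ih =>
    refine ih.trans ?_
    have ho : IsOpen ((fun t : ℝ => A b + (t - b) • d) ⁻¹' Oq) := isOpen_Oq.preimage (by fun_prop)
    have : IntervalIntegrable (fun t => iN τ (A b + (t - b) • d) d) volume b c := by
      have e : (fun t => iN τ (A b + (t - b) • d) d) =
          ((fun t : ℝ => A b + (t - b) • d) ⁻¹' Oq).indicator (fun _ => rotN τ d) := by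
        funext t; simp only [iN, indicator, mem_preimage]
      rw [e]
      have hi : IntervalIntegrable (fun _ : ℝ => rotN τ d) volume b c := intervalIntegrable_const
      exact ⟨hi.1.indicator ho.measurableSet, hi.2.indicator ho.measurableSet⟩
    refine this.congr_ae ?_
    have := PL.edge_congr h2.le h3 (iN τ)
    rw [Filter.EventuallyEq, ae_restrict_iff' measurableSet_uIoc]
    filter_upwards [this] with t ht htm
    exact (ht htm).symm

theorem lineInt_le (h : IsNorm2 τ) (hA : PL A a b) {f : ℝ × ℝ → ℝ × ℝ} (hf : Continuous f)
    (hd : ∀ p, dualNorm τ (f p) ≤ 1) (hz : ∀ p ∉ Oq, f p = 0) :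
    ∫ t in a..b, lineI f (A t) (deriv A t) ≤ ∫ t in a..b, iN τ (A t) (deriv A t) :=
  intervalIntegral.integral_mono_on hA.le (hA.intInt _ (lineI_cont hf)) (lenInt h hA)
    fun t _ => lineI_le' h (hd _) (hz _) _

theorem lower_sum (h : IsNorm2 τ) (hA : PL A a b) {f : ℝ × ℝ → ℝ × ℝ} (hf : Continuous f)
    (hd : ∀ p, dualNorm τ (f p) ≤ 1) (hz : ∀ p ∉ Oq, f p = 0) {p q : ℕ → ℝ} {c : ℕ → ℝ × ℝ} (n : ℕ)
    (hpa : ∀ i < n, a ≤ p i) (hpq : ∀ i < n, p i ≤ q i) (hord : ∀ i j, i < j → j < n → q i ≤ p j)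
    (hfc : ∀ i < n, ∀ t ∈ Icc (p i) (q i), f (A t) = c i)
    (x : ℝ) (hx : x ∈ Icc a b) (hqx : ∀ i < n, q i ≤ x) :
    2 * ∑ i ∈ Finset.range n, lineI (fun _ => c i) 0 (A (q i) - A (p i)) ≤
      ∫ t in a..x, (lineI f (A t) (deriv A t) + iN τ (A t) (deriv A t)) := by
  have hi : IntervalIntegrable (fun t => lineI f (A t) (deriv A t) + iN τ (A t) (deriv A t)) volume a b :=
    (hA.intInt _ (lineI_cont hf)).add (lenInt h hA)
  have hsub : ∀ s ∈ Icc a b, ∀ t ∈ Icc a b, IntervalIntegrable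
      (fun t => lineI f (A t) (deriv A t) + iN τ (A t) (deriv A t)) volume s t := by
    intro s hs t ht
    refine hi.mono_set ?_
    rw [uIcc_of_le hA.le]
    exact uIcc_subset_Icc hs ht
  have hnn : ∀ s t, s ≤ t → 0 ≤ ∫ t in s..t, (lineI f (A t) (deriv A t) + iN τ (A t) (deriv A t)) :=
    fun s t hst => intervalIntegral.integral_nonneg hst fun t _ => by
      have := neg_le_lineI' h (hd (A t)) (hz _) (deriv A t); linarith
  induction n generalizing x with
  | zero => simpa using hnn a x hx.1
  | succ n ih =>
    have hn : n < n + 1 := Nat.lt_succ_self n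
    have hqn : q n ∈ Icc a b := ⟨(hpa n hn).trans (hpq n hn), (hqx n hn).trans hx.2⟩
    have hpn : p n ∈ Icc a b := ⟨hpa n hn, (hpq n hn).trans hqn.2⟩
    have ha : a ∈ Icc a b := ⟨le_rfl, hA.le⟩
    have i1 := ih (fun i hi => hpa i (by omega)) (fun i hi => hpq i (by omega))
      (fun i j hij hj => hord i j hij (by omega)) (fun i hi => hfc i (by omega)) (p n) hpn
      (fun i hi => hord i n hi hn)
    have hPL : PL A (p n) (q n) := (hA.right hpn).left ⟨hpq n hn, hqn.2⟩
    have hc : dualNorm τ (c n) ≤ 1 := by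
      rw [← hfc n hn (p n) ⟨le_rfl, hpq n hn⟩]; exact hd _
    have hcl : ∫ t in (p n)..(q n), lineI (fun _ => c n) 0 (deriv A t) =
        lineI (fun _ => c n) 0 (A (q n) - A (p n)) := by
      have := hPL.ftc ((c n).1 • ContinuousLinearMap.snd ℝ ℝ ℝ - (c n).2 • ContinuousLinearMap.fst ℝ ℝ ℝ)
      simp only [sub_apply, smul_apply,
        ContinuousLinearMap.coe_fst', ContinuousLinearMap.coe_snd', smul_eq_mul] at this
      unfold lineI
      rw [this]
      simp only [Prod.fst_sub, Prod.snd_sub]; ring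
    have i2 : 2 * lineI (fun _ => c n) 0 (A (q n) - A (p n)) ≤
        ∫ t in (p n)..(q n), (lineI f (A t) (deriv A t) + iN τ (A t) (deriv A t)) := by
      rw [← hcl, ← intervalIntegral.integral_const_mul]
      refine intervalIntegral.integral_mono_on (hpq n hn) ?_ (hsub _ hpn _ hqn) fun t ht => ?_
      · exact (hPL.intInt (fun _ v => lineI (fun _ => c n) 0 v) fun _ => continuous_const).const_mul 2
      · have e : lineI f (A t) (deriv A t) = lineI (fun _ => c n) 0 (deriv A t) := by
          unfold lineI; rw [hfc n hn t ht]
        rw [e]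
        by_cases ho : A t ∈ Oq
        · have := lineI_le h (f := fun _ => c n) (p := 0) hc (deriv A t)
          rw [iN_of_mem ho]; linarith
        · have : c n = 0 := by rw [← hfc n hn t ht]; exact hz _ ho
          rw [iN_of_not_mem ho, this]; simp [lineI]
    have i3 := hnn _ _ (hqx n hn)
    rw [Finset.sum_range_succ, mul_add,
      ← intervalIntegral.integral_add_adjacent_intervals (hsub a ha _ hqn) (hsub _ hqn _ hx),
      ← intervalIntegral.integral_add_adjacent_intervals (hsub a ha _ hpn) (hsub _ hpn _ hqn)]
    linarith

theorem edge_len (h : IsNorm2 τ) {d : ℝ × ℝ} {b c : ℝ} (hbc : b ≤ c) (h3 : ∀ t ∈ Icc b c, A t = A b + (t - b) • d) :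
    ∫ t in b..c, iN τ (A t) (deriv A t) ≤ rotN τ (A c - A b) := by
  have h1 : ∫ t in b..c, iN τ (A t) (deriv A t) ≤ ∫ t in b..c, rotN τ (deriv A t) :=
    intervalIntegral.integral_mono_on hbc (lenInt h (PL.single hbc h3))
      ((PL.single hbc h3).intInt (fun _ v => rotN τ v) fun _ => continuous_const) fun t _ => iN_le h _ _
  refine h1.trans (le_of_eq ?_)
  rw [PL.edge_integral hbc h3 (fun _ v => rotN τ v), intervalIntegral.integral_const,
    h3 c ⟨hbc, le_rfl⟩, add_sub_cancel_left, (rotN_norm h).2.1, abs_of_nonneg (by linarith),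
    smul_eq_mul]

end len


/-- loop-erasure data -/
structure LoopE (τ : ℝ × ℝ → ℝ) (P : ℝ → ℝ × ℝ) (a b : ℝ) (A : ℝ → ℝ × ℝ) (T : ℝ) (φ : ℝ → ℝ) : Prop where
  pl : PL A 0 T
  inj : InjOn A (Icc 0 T)
  A0 : A 0 = P a
  AT : A T = P b
  mono : Monotone φ
  cont : Continuous φ
  φa : φ a = 0
  φb : φ b = T
  sand : ∀ t ∈ Icc a b, ∃ t' ∈ Icc a t, ∃ t'' ∈ Icc t b, A (φ t) = P t' ∧ A (φ t) = P t''
  len : ∫ t in (0:ℝ)..T, iN τ (A t) (deriv A t) ≤ ∫ t in a..b, iN τ (P t) (deriv P t)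

theorem loop_erase {τ : ℝ × ℝ → ℝ} (hτ : IsNorm2 τ) {P : ℝ → ℝ × ℝ} {a b : ℝ} (h : PL P a b) :
    ∃ A T φ, LoopE τ P a b A T φ := by
  induction h with
  | nil =>
    refine ⟨fun _ => P a, 0, fun _ => 0, PL.nil, by simp, rfl, rfl, monotone_const, continuous_const,
      rfl, rfl, fun t ht => ?_, by simp⟩
    rw [Icc_self, mem_singleton_iff] at ht
    subst ht
    exact ⟨t, by simp, t, by simp, rfl, rfl⟩
  | snoc b c d h1 h2 h3 ih =>
    obtain ⟨A, T, φ, hA⟩ := ih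
    have hT : 0 ≤ T := hA.pl.le
    have hPe : PL P b c := PL.single h2.le h3
    -- choice of cut times
    obtain ⟨s, hs, u, hu, hAP, hfirst, hinj⟩ : ∃ s ∈ Icc 0 T, ∃ u ∈ Icc b c, A s = P u ∧
        (∀ r ∈ Icc 0 T, r < s → ∀ v ∈ Icc b c, A r ≠ P v) ∧ InjOn P (Icc u c) := by
      by_cases hd : d = 0
      · have hconst : ∀ v ∈ Icc b c, P v = P b := fun v hv => by rw [h3 v hv, hd]; simp
        refine ⟨T, ⟨hT, le_rfl⟩, c, ⟨h2.le, le_rfl⟩, ?_, ?_, by simp⟩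
        · rw [hA.AT, hconst c ⟨h2.le, le_rfl⟩]
        · intro r hr hrT v hv e
          rw [hconst v hv, ← hA.AT] at e
          exact hrT.ne (hA.inj hr ⟨hT, le_rfl⟩ e)
      · have hPinj : InjOn P (Icc b c) := by
          intro x hx y hy e
          rw [h3 x hx, h3 y hy] at e
          have e' := smul_left_injective ℝ hd (add_left_cancel e)
          linarith [e']
        have hK : IsCompact (Icc 0 T ∩ A ⁻¹' (P '' Icc b c)) := by
          refine isCompact_Icc.of_isClosed_subset ?_ inter_subset_left
          exact hA.pl.cont.preimage_isClosed_of_isClosed isClosed_Icc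
            (isCompact_Icc.image_of_continuousOn hPe.cont).isClosed
        obtain ⟨s, hs, hmin⟩ := hK.exists_isLeast
          ⟨T, ⟨hT, le_rfl⟩, b, ⟨le_rfl, h2.le⟩, hA.AT.symm⟩
        obtain ⟨u, hu, e⟩ := hs.2
        refine ⟨s, hs.1, u, hu, e.symm, ?_, hPinj.mono (Icc_subset_Icc_left hu.1)⟩
        intro r hr hrs v hv e
        exact absurd (hmin ⟨hr, v, hv, e.symm⟩) (not_le.2 hrs)
    set A' : ℝ → ℝ × ℝ := fun r => if r ≤ s then A r else P (1 * r + (u - s)) with hA'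
    set T' : ℝ := s + (c - u) with hT'
    have hsT' : s ≤ T' := by rw [hT']; linarith [hu.2]
    have e1 : ∀ r, r ≤ s → A' r = A r := fun r hr => by simp [hA', hr]
    have e2 : ∀ r, s ≤ r → A' r = P (1 * r + (u - s)) := by
      intro r hr
      rcases hr.eq_or_lt with rfl | hlt
      · rw [e1 _ le_rfl, hAP]; congr 1; ring
      · simp [hA', not_le.2 hlt]
    have hAl : PL A 0 s := hA.pl.left hs
    have hPr : PL P u c := hPe.right hu
    have hPa : PL (fun r => P (1 * r + (u - s))) s T' := by
      have := hPr.affine (k := 1) (m := u - s) one_pos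
      rw [div_one, div_one, show u - (u - s) = s by ring, show c - (u - s) = T' by rw [hT']; ring] at this
      exact this
    have q1 : PL A' 0 s := hAl.congr fun r hr => (e1 r hr.2).symm
    have q2 : PL A' s T' := hPa.congr fun r hr => (e2 r hr.1).symm
    have hφle : ∀ t, b ≤ t → s ≤ φ t := fun t ht => by
      have := hA.mono ht; rw [hA.φb] at this; exact hs.2.trans this
    have hsφ : ∀ t, a ≤ t → s ≤ φ t → ∃ r ∈ Icc a t, φ r = s := by
      intro t hat hst
      have := intermediate_value_Icc hat hA.cont.continuousOn
      rw [hA.φa] at this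
      exact this ⟨hs.1, hst⟩
    refine ⟨A', T', fun t => min (φ t) s + max 0 (t - u), ?_⟩
    refine ⟨q1.trans q2, ?_, ?_, ?_, ?_, ?_, ?_, ?_, ?_, ?_⟩
    · -- injectivity
      have key : ∀ x ∈ Icc 0 T', ∀ y ∈ Icc 0 T', x < y → A' x ≠ A' y := by
        intro x hx y hy hxy e
        have hmem : ∀ r, s ≤ r → r ≤ T' → 1 * r + (u - s) ∈ Icc u c := by
          intro r h1 h2; rw [hT'] at h2; constructor <;> linarith
        rcases le_or_gt y s with hys | hys
        · rw [e1 x (hxy.le.trans hys), e1 y hys] at e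
          exact hxy.ne (hA.inj ⟨hx.1, (hxy.le.trans hys).trans hs.2⟩ ⟨hy.1, hys.trans hs.2⟩ e)
        · rw [e2 y hys.le] at e
          have hym := hmem y hys.le hy.2
          rcases lt_or_ge x s with hxs | hxs
          · rw [e1 x hxs.le] at e
            exact hfirst x ⟨hx.1, hxs.le.trans hs.2⟩ hxs _ ⟨hu.1.trans hym.1, hym.2⟩ e
          · rw [e2 x hxs] at e
            have := hinj (hmem x hxs hx.2) hym e
            linarith
      intro x hx y hy e
      rcases lt_trichotomy x y with h | h | h
      · exact absurd e (key x hx y hy h)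
      · exact h
      · exact absurd e.symm (key y hy x hx h)
    · rw [e1 0 hs.1, hA.A0]
    · rw [e2 T' hsT']; congr 1; rw [hT']; ring
    · intro x y hxy
      have := hA.mono hxy
      dsimp only
      gcongr
    · have := hA.cont
      fun_prop
    · have : a ≤ u := h1.le.trans hu.1
      simp only [hA.φa]
      rw [min_eq_left hs.1, max_eq_left (by linarith)]; simp
    · rw [min_eq_right (hφle c h2.le), max_eq_right (by linarith [hu.2])]
    · intro t ht
      rcases le_total t b with htb | htb
      · rw [max_eq_left (by linarith [hu.1]), add_zero]
        rcases le_total (φ t) s with hφ | hφ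
        · rw [min_eq_left hφ, e1 _ hφ]
          obtain ⟨t', ht', t'', ht'', g⟩ := hA.sand t ⟨ht.1, htb⟩
          exact ⟨t', ht', t'', ⟨ht''.1, ht''.2.trans h2.le⟩, g⟩
        · rw [min_eq_right hφ, e1 _ le_rfl]
          obtain ⟨r, hr, hrs⟩ := hsφ t ht.1 hφ
          obtain ⟨t', ht', t'', ht'', g1, g2⟩ := hA.sand r ⟨hr.1, hr.2.trans htb⟩
          rw [hrs] at g1
          exact ⟨t', ⟨ht'.1, ht'.2.trans hr.2⟩, u, ⟨htb.trans hu.1, hu.2⟩, g1, hAP⟩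
      · rw [min_eq_right (hφle t htb)]
        rcases le_total t u with htu | htu
        · rw [max_eq_left (by linarith), add_zero, e1 _ le_rfl]
          obtain ⟨r, hr, hrs⟩ := hsφ b h1.le (hφle b le_rfl)
          obtain ⟨t', ht', t'', ht'', g1, g2⟩ := hA.sand r ⟨hr.1, hr.2⟩
          rw [hrs] at g1
          exact ⟨t', ⟨ht'.1, ht'.2.trans (hr.2.trans htb)⟩, u, ⟨htu, hu.2⟩, g1, hAP⟩
        · rw [max_eq_right (by linarith), e2 _ (by linarith),
            show 1 * (s + (t - u)) + (u - s) = t by ring]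
          exact ⟨t, ⟨ht.1, le_rfl⟩, t, ⟨le_rfl, ht.2⟩, rfl, rfl⟩
    · have nn : ∀ (B : ℝ → ℝ × ℝ) (x y : ℝ), x ≤ y → 0 ≤ ∫ t in x..y, iN τ (B t) (deriv B t) :=
        fun B x y hxy => intervalIntegral.integral_nonneg hxy fun t _ => iN_nonneg hτ _ _
      rw [← intervalIntegral.integral_add_adjacent_intervals (lenInt hτ q1) (lenInt hτ q2),
        ← intervalIntegral.integral_add_adjacent_intervals (lenInt hτ h1) (lenInt hτ hPe)]
      have l1 : ∫ t in (0:ℝ)..s, iN τ (A' t) (deriv A' t) = ∫ t in (0:ℝ)..s, iN τ (A t) (deriv A t) :=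
        PL.integral_congr (fun r hr => e1 r hr.2.le) hs.1 (iN τ)
      have l2 : ∫ t in s..T', iN τ (A' t) (deriv A' t) = ∫ t in u..c, iN τ (P t) (deriv P t) := by
        rw [PL.integral_congr (B := fun r => P (1 * r + (u - s))) (fun r hr => e2 r hr.1.le) hsT'
          (iN τ)]
        have := PL.integral_affine (A := P) (a := u) (b := c) (iN_smul hτ) (k := 1) (m := u - s) one_pos
        rw [div_one, div_one, show u - (u - s) = s by ring, show c - (u - s) = T' by rw [hT']; ring] at this
        exact this
      have l3 := intervalIntegral.integral_add_adjacent_intervals (lenInt hτ hAl)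
        (lenInt hτ (hA.pl.right hs))
      have l4 := intervalIntegral.integral_add_adjacent_intervals (lenInt hτ (hPe.left hu))
        (lenInt hτ hPr)
      have := nn A s T hs.2
      have := nn P b u hu.1
      have := hA.len
      rw [l1, l2]
      linarith


theorem mem_Isq {p : ℝ × ℝ} : p ∈ Isq ↔ (-1 ≤ p.1 ∧ p.1 ≤ 1) ∧ (-1 ≤ p.2 ∧ p.2 ≤ 1) := by
  unfold Isq
  rw [mem_Icc, Prod.le_def, Prod.le_def]
  simp only; tauto

theorem Isq_eq : Isq = Icc (-1) 1 ×ˢ Icc (-1) 1 := by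
  ext p; rw [mem_Isq]; rfl

theorem mem_Oq {p : ℝ × ℝ} : p ∈ Oq ↔ (-1 < p.1 ∧ p.1 < 1) ∧ (-1 < p.2 ∧ p.2 < 1) := Iff.rfl

theorem convex_Isq : Convex ℝ Isq := by
  rw [Isq_eq]; exact (convex_Icc _ _).prod (convex_Icc _ _)

theorem isCompact_Isq : IsCompact Isq := by
  rw [Isq_eq]; exact isCompact_Icc.prod isCompact_Icc

theorem frontier_Isq : frontier Isq = Isq \ Oq := by
  rw [isCompact_Isq.isClosed.frontier_eq]
  congr 1
  rw [Isq_eq, interior_prod_eq, interior_Icc]; rfl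

theorem Oq_sub : Oq ⊆ Osq := by
  intro p hp
  rw [mem_Oq] at hp
  obtain ⟨⟨h1, h2⟩, h3, h4⟩ := hp
  unfold Osq
  rw [mem_Ioo, Prod.lt_iff, Prod.lt_iff]
  exact ⟨Or.inl ⟨h1, h3.le⟩, Or.inl ⟨h2, h4.le⟩⟩

theorem Osq_sub : Osq ⊆ Isq := Ioo_subset_Icc_self

theorem field_zero {f : ℝ × ℝ → ℝ × ℝ} (hf : Continuous f) (hs : tsupport f ⊆ Osq) :
    ∀ p ∉ Oq, f p = 0 := by
  have h1 : ∀ p ∉ Isq, f p = 0 := fun p hp => image_eq_zero_of_notMem_tsupport fun h => hp (Osq_sub (hs h))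
  intro p hp
  by_cases hI : p ∈ Isq
  · have hfr : p ∈ frontier Isq := by rw [frontier_Isq]; exact ⟨hI, hp⟩
    have h2 : p ∈ closure Isqᶜ := by
      rw [← frontier_compl] at hfr; exact frontier_subset_closure hfr
    have h3 : closure Isqᶜ ⊆ {p | f p = 0} :=
      closure_minimal (fun p hp => h1 p hp) (isClosed_eq hf continuous_const)
    exact h3 h2
  · exact h1 p hI

/-- Sums of lengths of chords over disjoint excursions into the open square. -/
inductive LenI (τ : ℝ × ℝ → ℝ) (Γ : ℝ → ℝ × ℝ) (s : ℝ) : ℝ → ℝ → Prop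
  | nil : LenI τ Γ s s 0
  | skip (b c x : ℝ) : LenI τ Γ s b x → b ≤ c → LenI τ Γ s c x
  | add (b c x : ℝ) : LenI τ Γ s b x → b < c → (∀ z ∈ Ioo b c, Γ z ∈ Oq) →
      LenI τ Γ s c (x + rotN τ (Γ c - Γ b))

theorem LenI.trans {τ : ℝ × ℝ → ℝ} {Γ : ℝ → ℝ × ℝ} {s b c x y : ℝ} (h : LenI τ Γ s b x)
    (h' : LenI τ Γ b c y) : LenI τ Γ s c (x + y) := by
  induction h' with
  | nil => rw [add_zero]; exact h
  | skip b c x h1 h2 ih => exact ih.skip _ _ _ h2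
  | add b c x h1 h2 h3 ih => rw [← add_assoc]; exact ih.add _ _ _ h2 h3

theorem LenI.le {τ : ℝ × ℝ → ℝ} {Γ : ℝ → ℝ × ℝ} {s b x : ℝ} (h : LenI τ Γ s b x) : s ≤ b := by
  induction h with
  | nil => exact le_rfl
  | skip b c x h1 h2 ih => exact ih.trans h2
  | add b c x h1 h2 h3 ih => exact ih.trans h2.le

theorem LenI.bound {τ : ℝ × ℝ → ℝ} (hτ : IsNorm2 τ) {Γ : ℝ → ℝ × ℝ} {s b x t : ℝ}
    (h : LenI τ Γ s b x) (hbv : BoundedVariationOn Γ (Icc s t)) {M : ℝ} (hM : 0 < M)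
    (hb : ∀ v, rotN τ v ≤ M * ‖v‖) (hbt : b ≤ t) :
    x ≤ M * (eVariationOn Γ (Icc s b)).toReal := by
  induction h with
  | nil => positivity
  | skip b c x h1 h2 ih =>
    refine (ih (h2.trans hbt)).trans ?_
    have : eVariationOn Γ (Icc s c) ≠ ⊤ := hbv.mono (Icc_subset_Icc_right hbt)
    gcongr
    exact eVariationOn.mono _ (Icc_subset_Icc_right h2)
  | add b c x h1 h2 h3 ih =>
    have i1 := ih (h2.le.trans hbt)
    have e := eVariationOn.Icc_add_Icc Γ (s := univ) h1.le h2.le (mem_univ _)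
    simp only [univ_inter] at e
    have f1 : eVariationOn Γ (Icc s b) ≠ ⊤ := hbv.mono (Icc_subset_Icc_right (h2.le.trans hbt))
    have f2 : eVariationOn Γ (Icc b c) ≠ ⊤ := hbv.mono (Icc_subset_Icc h1.le hbt)
    rw [← e, ENNReal.toReal_add f1 f2, mul_add]
    refine add_le_add i1 ((hb _).trans ?_)
    gcongr
    have := eVariationOn.edist_le Γ (s := Icc b c) (x := c) (y := b) ⟨h2.le, le_rfl⟩ ⟨le_rfl, h2.le⟩
    have := ENNReal.toReal_mono f2 this
    rwa [edist_dist, ENNReal.toReal_ofReal dist_nonneg, dist_eq_norm] at this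

theorem LenI.bddAbove {τ : ℝ × ℝ → ℝ} (hτ : IsNorm2 τ) {Γ : ℝ → ℝ × ℝ} {α β : ℝ}
    (h : BoundedVariationOn Γ (Icc α β)) : BddAbove {x | LenI τ Γ α β x} := by
  obtain ⟨M, hM, hb⟩ := (rotN_norm hτ).upper
  exact ⟨M * (eVariationOn Γ (Icc α β)).toReal, fun x hx => LenI.bound hτ hx h hM hb le_rfl⟩

theorem PL.glue {A B : ℝ → ℝ × ℝ} {s m t : ℝ} (h1 : PL A s m) (h2 : PL B m t) (e : A m = B m) :
    ∃ P, PL P s t ∧ (∀ z ≤ m, P z = A z) ∧ (∀ z, m ≤ z → P z = B z) := by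
  classical
  set P : ℝ → ℝ × ℝ := fun z => if z ≤ m then A z else B z with hP
  have e1 : ∀ z ≤ m, P z = A z := fun z hz => by simp [hP, hz]
  have e2 : ∀ z, m ≤ z → P z = B z := by
    intro z hz
    rcases hz.eq_or_lt with rfl | h
    · rw [e1 _ le_rfl, e]
    · simp [hP, not_le.2 h]
  exact ⟨P, (h1.congr fun z hz => (e1 z hz.2).symm).trans (h2.congr fun z hz => (e2 z hz.1).symm), e1, e2⟩

theorem glue_len {τ : ℝ × ℝ → ℝ} (hτ : IsNorm2 τ) {A B P : ℝ → ℝ × ℝ} {s m t : ℝ} (h : PL P s t)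
    (hm : m ∈ Icc s t) (e1 : ∀ z ≤ m, P z = A z) (e2 : ∀ z, m ≤ z → P z = B z) :
    ∫ z in s..t, iN τ (P z) (deriv P z) = (∫ z in s..m, iN τ (A z) (deriv A z)) +
      ∫ z in m..t, iN τ (B z) (deriv B z) := by
  rw [← intervalIntegral.integral_add_adjacent_intervals (lenInt hτ (h.left hm)) (lenInt hτ (h.right hm))]
  congr 1
  · exact PL.integral_congr (fun z hz => e1 z hz.2.le) hm.1 (iN τ)
  · exact PL.integral_congr (fun z hz => e2 z hz.1.le) hm.2 (iN τ)

/-- `x` and `y` can be joined inside `X` by a polygonal path of interior length at most `l`. -/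
def Conn (τ : ℝ × ℝ → ℝ) (X : Set (ℝ × ℝ)) (x y : ℝ × ℝ) (l : ℝ) : Prop :=
  ∀ s t : ℝ, s < t → ∃ P : ℝ → ℝ × ℝ, PL P s t ∧ P s = x ∧ P t = y ∧ (∀ z ∈ Icc s t, P z ∈ X) ∧
    ∫ z in s..t, iN τ (P z) (deriv P z) ≤ l

theorem Conn.trans {τ : ℝ × ℝ → ℝ} (hτ : IsNorm2 τ) {X : Set (ℝ × ℝ)} {x y z : ℝ × ℝ} {l k : ℝ}
    (h : Conn τ X x y l) (h' : Conn τ X y z k) : Conn τ X x z (l + k) := by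
  intro s t hst
  obtain ⟨A, a1, a2, a3, a4, a5⟩ := h s ((s + t) / 2) (by linarith)
  obtain ⟨B, b1, b2, b3, b4, b5⟩ := h' ((s + t) / 2) t (by linarith)
  obtain ⟨P, p1, p2, p3⟩ := a1.glue b1 (by rw [a3, b2])
  refine ⟨P, p1, by rw [p2 s (by linarith), a2], by rw [p3 t (by linarith), b3], ?_, ?_⟩
  · intro w hw
    rcases le_total w ((s + t) / 2) with h | h
    · rw [p2 w h]; exact a4 w ⟨hw.1, h⟩
    · rw [p3 w h]; exact b4 w ⟨h, hw.2⟩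
  · rw [glue_len hτ p1 ⟨by linarith, by linarith⟩ p2 p3]
    linarith

theorem seg_path (x y : ℝ × ℝ) {s t : ℝ} (hst : s < t) : ∃ P : ℝ → ℝ × ℝ, PL P s t ∧ P s = x ∧ P t = y ∧
    (∀ z ∈ Icc s t, P z = P s + (z - s) • ((t - s)⁻¹ • (y - x))) ∧ ∀ z ∈ Icc s t, P z ∈ segment ℝ x y := by
  set P : ℝ → ℝ × ℝ := fun z => x + (z - s) • ((t - s)⁻¹ • (y - x)) with hP
  have h0 : P s = x := by simp [hP]
  have hne : t - s ≠ 0 := by linarith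
  have h1 : P t = y := by simp only [hP]; rw [smul_smul, mul_inv_cancel₀ hne, one_smul, add_sub_cancel]
  have h2 : ∀ z ∈ Icc s t, P z = P s + (z - s) • ((t - s)⁻¹ • (y - x)) := fun z _ => by rw [h0]
  refine ⟨P, PL.single hst.le h2, h0, h1, h2, fun z hz => ?_⟩
  rw [segment_eq_image']
  refine ⟨(z - s) * (t - s)⁻¹, ⟨mul_nonneg (by linarith [hz.1]) (inv_nonneg.2 (by linarith)), ?_⟩, ?_⟩
  · rw [← div_eq_mul_inv, div_le_one (by linarith)]; linarith [hz.2]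
  · simp only [hP]; rw [smul_smul]

theorem Conn.seg {τ : ℝ × ℝ → ℝ} (hτ : IsNorm2 τ) {X : Set (ℝ × ℝ)} {x y : ℝ × ℝ}
    (hX : segment ℝ x y ⊆ X) : Conn τ X x y (rotN τ (y - x)) := by
  intro s t hst
  obtain ⟨P, h1, h2, h3, h4, h5⟩ := seg_path x y hst
  refine ⟨P, h1, h2, h3, fun z hz => hX (h5 z hz), ?_⟩
  have := edge_len hτ hst.le h4
  rwa [h2, h3] at this

theorem Conn.seg0 {τ : ℝ × ℝ → ℝ} {X : Set (ℝ × ℝ)} {x y : ℝ × ℝ}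
    (hX : segment ℝ x y ⊆ X) (hO : Disjoint (segment ℝ x y) Oq) : Conn τ X x y 0 := by
  intro s t hst
  obtain ⟨P, h1, h2, h3, h4, h5⟩ := seg_path x y hst
  refine ⟨P, h1, h2, h3, fun z hz => hX (h5 z hz), ?_⟩
  rw [intervalIntegral.integral_congr (g := fun _ => 0)]
  · simp
  · intro z hz
    rw [uIcc_of_le hst.le] at hz
    exact iN_of_not_mem (Set.disjoint_left.1 hO (h5 z hz))

theorem corner {x y : ℝ × ℝ} (hx : x ∈ Isq \ Oq) (hy : y ∈ Isq \ Oq) (hxy : ‖x - y‖ < 1) :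
    ∃ c ∈ Isq, (c = y ∨ |c.1| = 1 ∧ |c.2| = 1) ∧ ‖x - c‖ ≤ ‖x - y‖ ∧ ‖c - y‖ ≤ ‖x - y‖ ∧
      Disjoint (segment ℝ x c) Oq ∧ Disjoint (segment ℝ c y) Oq := by
  have s1 : ∀ {a b : ℝ × ℝ}, |a.1| = 1 → a.1 = b.1 → Disjoint (segment ℝ a b) Oq := by
    intro a b ha hab
    rw [Set.disjoint_left]
    rintro _ ⟨u, v, hu, hv, huv, rfl⟩ ho
    rw [mem_Oq] at ho
    have e : (u • a + v • b).1 = a.1 := by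
      simp only [Prod.fst_add, Prod.smul_fst, smul_eq_mul]; rw [← hab, ← add_mul, huv, one_mul]
    rw [e] at ho
    rcases eq_or_eq_neg_of_abs_eq ha with h | h <;> rw [h] at ho <;> linarith [ho.1.1, ho.1.2]
  have s2 : ∀ {a b : ℝ × ℝ}, |a.2| = 1 → a.2 = b.2 → Disjoint (segment ℝ a b) Oq := by
    intro a b ha hab
    rw [Set.disjoint_left]
    rintro _ ⟨u, v, hu, hv, huv, rfl⟩ ho
    rw [mem_Oq] at ho
    have e : (u • a + v • b).2 = a.2 := by
      simp only [Prod.snd_add, Prod.smul_snd, smul_eq_mul]; rw [← hab, ← add_mul, huv, one_mul]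
    rw [e] at ho
    rcases eq_or_eq_neg_of_abs_eq ha with h | h <;> rw [h] at ho <;> linarith [ho.2.1, ho.2.2]
  have fr : ∀ {a : ℝ × ℝ}, a ∈ Isq \ Oq → |a.1| = 1 ∨ |a.2| = 1 := by
    rintro a ⟨ha, ha'⟩
    rw [mem_Isq] at ha
    by_contra hcon
    push Not at hcon
    apply ha'
    rw [mem_Oq]
    have h1 : |a.1| < 1 := lt_of_le_of_ne (abs_le.2 ha.1) hcon.1
    have h2 : |a.2| < 1 := lt_of_le_of_ne (abs_le.2 ha.2) hcon.2
    exact ⟨abs_lt.1 h1, abs_lt.1 h2⟩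
  have same : ∀ {a b : ℝ}, |a| = 1 → |b| = 1 → |a - b| < 1 → a = b := by
    intro a b ha hb hab
    rw [abs_lt] at hab
    rcases eq_or_eq_neg_of_abs_eq ha with h | h <;> rcases eq_or_eq_neg_of_abs_eq hb with h' | h' <;>
      linarith [hab.1, hab.2]
  have n1 : |x.1 - y.1| ≤ ‖x - y‖ := norm_fst_le (x - y)
  have n2 : |x.2 - y.2| ≤ ‖x - y‖ := norm_snd_le (x - y)
  have hyy : Disjoint (segment ℝ y y) Oq := by
    rw [segment_same]; exact disjoint_singleton_left.2 hy.2
  have memC : ∀ {a b : ℝ}, |a| = 1 → |b| = 1 → (a, b) ∈ Isq := fun ha hb =>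
    mem_Isq.2 ⟨abs_le.1 ha.le, abs_le.1 hb.le⟩
  rcases fr hx with h1 | h1 <;> rcases fr hy with h2 | h2
  · have e := same h1 h2 (n1.trans_lt hxy)
    exact ⟨y, hy.1, Or.inl rfl, le_rfl, by simp, s1 h1 e, hyy⟩
  · refine ⟨(x.1, y.2), memC h1 h2, Or.inr ⟨h1, h2⟩, ?_, ?_, s1 h1 rfl, s2 h2 rfl⟩
    · rw [Prod.norm_def]; simpa using n2
    · rw [Prod.norm_def]; simpa using n1
  · refine ⟨(y.1, x.2), memC h2 h1, Or.inr ⟨h2, h1⟩, ?_, ?_, s2 h1 rfl, s1 h2 rfl⟩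
    · rw [Prod.norm_def]; simpa using n1
    · rw [Prod.norm_def]; simpa using n2
  · have e := same h1 h2 (n2.trans_lt hxy)
    exact ⟨y, hy.1, Or.inl rfl, le_rfl, by simp, s2 h1 e, hyy⟩

theorem cell {τ : ℝ × ℝ → ℝ} (hτ : IsNorm2 τ) {Γ : ℝ → ℝ × ℝ} {s t μ : ℝ} (hst : s < t)
    (hc : ContinuousOn Γ (Icc s t)) (hI : ∀ z ∈ Icc s t, Γ z ∈ Isq)
    (hμ : ∀ a ∈ Icc s t, ∀ b ∈ Icc s t, ‖Γ a - Γ b‖ ≤ μ) (hμ1 : μ < 1) {S : Set (ℝ × ℝ)}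
    (hS : ∀ z ∈ Icc s t, Γ z ∉ S) (hcor : ∀ p : ℝ × ℝ, |p.1| = 1 → |p.2| = 1 → p ∉ S)
    (hchord : ∀ x ∈ Isq \ S, ∀ y ∈ Isq \ S, ‖x - y‖ ≤ μ → Disjoint (segment ℝ x y) S) :
    ∃ l, LenI τ Γ s t l ∧ Conn τ {p | p ∈ Isq ∧ p ∉ S ∧ ‖p - Γ s‖ ≤ 2 * μ} (Γ s) (Γ t) l := by
  set X := {p | p ∈ Isq ∧ p ∉ S ∧ ‖p - Γ s‖ ≤ 2 * μ} with hX
  have hs : s ∈ Icc s t := ⟨le_rfl, hst.le⟩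
  have ht : t ∈ Icc s t := ⟨hst.le, le_rfl⟩
  have hμ0 : 0 ≤ μ := (norm_nonneg _).trans (hμ s hs s hs)
  have segX : ∀ x ∈ X, ∀ y ∈ X, ‖x - y‖ ≤ μ → segment ℝ x y ⊆ X := by
    intro x hx y hy hxy p hp
    refine ⟨convex_Isq.segment_subset hx.1 hy.1 hp,
      Set.disjoint_left.1 (hchord x ⟨hx.1, hx.2.1⟩ y ⟨hy.1, hy.2.1⟩ hxy) hp, ?_⟩
    have := (convex_closedBall (Γ s) (2 * μ)).segment_subset (x := x) (y := y)
      (by rw [mem_closedBall_iff_norm]; exact hx.2.2) (by rw [mem_closedBall_iff_norm]; exact hy.2.2) hp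
    rwa [mem_closedBall_iff_norm] at this
  have ΓX : ∀ z ∈ Icc s t, Γ z ∈ X := fun z hz => ⟨hI z hz, hS z hz, (hμ z hz s hs).trans (by linarith)⟩
  set F := Icc s t ∩ Γ ⁻¹' Oqᶜ with hF
  have hFc : IsCompact F := isCompact_Icc.of_isClosed_subset
    (hc.preimage_isClosed_of_isClosed isClosed_Icc isOpen_Oq.isClosed_compl) inter_subset_left
  rcases F.eq_empty_or_nonempty with he | hne
  · refine ⟨0 + rotN τ (Γ t - Γ s), LenI.nil.add _ _ _ hst fun z hz => ?_, ?_⟩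
    · by_contra hcon
      have : z ∈ F := ⟨⟨hz.1.le, hz.2.le⟩, hcon⟩
      rw [he] at this; exact this
    · rw [zero_add]
      exact Conn.seg hτ (segX _ (ΓX s hs) _ (ΓX t ht) (hμ s hs t ht))
  · obtain ⟨a, ha, hamin⟩ := hFc.exists_isLeast hne
    obtain ⟨b, hb, hbmax⟩ := hFc.exists_isGreatest hne
    have hab : a ≤ b := hamin hb
    have l1 : LenI τ Γ s a (rotN τ (Γ a - Γ s)) := by
      rcases ha.1.1.eq_or_lt with e | h
      · rw [← e, sub_self, (rotN_norm hτ).zero]; exact LenI.nil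
      · rw [← zero_add (rotN τ _)]
        refine LenI.nil.add _ _ _ h fun z hz => ?_
        by_contra hcon
        exact absurd (hamin ⟨⟨hz.1.le, hz.2.le.trans ha.1.2⟩, hcon⟩) (not_le.2 hz.2)
    have l2 : LenI τ Γ b t (rotN τ (Γ t - Γ b)) := by
      rcases hb.1.2.eq_or_lt with e | h
      · rw [e, sub_self, (rotN_norm hτ).zero]; exact LenI.nil
      · rw [← zero_add (rotN τ _)]
        refine LenI.nil.add _ _ _ h fun z hz => ?_
        by_contra hcon
        exact absurd (hbmax ⟨⟨hb.1.1.trans hz.1.le, hz.2.le⟩, hcon⟩) (not_le.2 hz.1)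
    refine ⟨_, (l1.skip _ _ _ hab).trans l2, ?_⟩
    have hn := hμ a ha.1 b hb.1
    obtain ⟨c, hcI, hcc, c1, c2, c3, c4⟩ := corner ⟨hI a ha.1, ha.2⟩ ⟨hI b hb.1, hb.2⟩ (hn.trans_lt hμ1)
    have hcX : c ∈ X := by
      refine ⟨hcI, ?_, ?_⟩
      · rcases hcc with rfl | h
        · exact hS b hb.1
        · exact hcor c h.1 h.2
      · calc ‖c - Γ s‖ = ‖(c - Γ b) + (Γ b - Γ s)‖ := by rw [sub_add_sub_cancel]
          _ ≤ ‖c - Γ b‖ + ‖Γ b - Γ s‖ := norm_add_le _ _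
          _ ≤ 2 * μ := by linarith [hμ b hb.1 s hs]
    have k1 := Conn.seg hτ (segX _ (ΓX s hs) _ (ΓX a ha.1) (hμ s hs a ha.1))
    have k2 := Conn.seg0 (τ := τ) (segX _ (ΓX a ha.1) c hcX (c1.trans hn)) c3
    have k3 := Conn.seg0 (τ := τ) (segX _ hcX _ (ΓX b hb.1) (c2.trans hn)) c4
    have k4 := Conn.seg hτ (segX _ (ΓX b hb.1) _ (ΓX t ht) (hμ b hb.1 t ht))
    have := ((k1.trans hτ k2).trans hτ k3).trans hτ k4
    simpa using this

theorem unif_inj {Γ : ℝ → ℝ × ℝ} {α β : ℝ} (hc : ContinuousOn Γ (Icc α β)) (hi : InjOn Γ (Icc α β))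
    {δ : ℝ} (hδ : 0 < δ) : ∃ ω > 0, ∀ x ∈ Icc α β, ∀ y ∈ Icc α β, ∀ z ∈ Icc α β, x ≤ y → y ≤ z →
      ‖Γ x - Γ z‖ ≤ ω → ‖Γ x - Γ y‖ < δ := by
  by_cases hab : α ≤ β
  swap
  · exact ⟨1, one_pos, fun x hx => absurd (hx.1.trans hx.2) hab⟩
  -- extend to a continuous function
  set G := IccExtend hab ((Icc α β).domRestrict Γ) with hG
  have hGc : Continuous G := (continuousOn_iff_continuous_domRestrict.1 hc).Icc_extend'
  have hGe : ∀ x ∈ Icc α β, G x = Γ x := fun x hx => by rw [hG, IccExtend_of_mem _ _ hx]; rfl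
  set K : Set (ℝ × ℝ × ℝ) := {p | p ∈ Icc α β ×ˢ Icc α β ×ˢ Icc α β ∧ p.1 ≤ p.2.1 ∧ p.2.1 ≤ p.2.2 ∧
    δ ≤ ‖G p.1 - G p.2.1‖} with hK
  have hKc : IsCompact K := by
    refine (isCompact_Icc.prod (isCompact_Icc.prod isCompact_Icc)).inter_right ?_
    have c1 : IsClosed {p : ℝ × ℝ × ℝ | p.1 ≤ p.2.1} := isClosed_le continuous_fst continuous_snd.fst
    have c2 : IsClosed {p : ℝ × ℝ × ℝ | p.2.1 ≤ p.2.2} := isClosed_le continuous_snd.fst continuous_snd.snd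
    have c3 : IsClosed {p : ℝ × ℝ × ℝ | δ ≤ ‖G p.1 - G p.2.1‖} := by
      refine isClosed_le continuous_const ?_
      exact ((hGc.comp continuous_fst).sub (hGc.comp continuous_snd.fst)).norm
    exact c1.inter (c2.inter c3)
  rcases K.eq_empty_or_nonempty with he | hne
  · refine ⟨1, one_pos, fun x hx y hy z hz hxy hyz _ => ?_⟩
    by_contra hcon
    have : (x, y, z) ∈ K := ⟨⟨hx, hy, hz⟩, hxy, hyz, by simp only; rw [hGe x hx, hGe y hy]; exact not_lt.1 hcon⟩
    rw [he] at this; exact this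
  · obtain ⟨p, hp, hmin⟩ := hKc.exists_isMinOn hne
      (f := fun p : ℝ × ℝ × ℝ => ‖G p.1 - G p.2.2‖) (by fun_prop)
    have hpos : 0 < ‖G p.1 - G p.2.2‖ := by
      rw [norm_pos_iff, sub_ne_zero]
      intro e
      obtain ⟨⟨h1, h2, h3⟩, h4, h5, h6⟩ := hp
      rw [hGe _ h1, hGe _ h3] at e
      have e2 := hi h1 h3 e
      have e3 : p.1 = p.2.1 := le_antisymm h4 (by rw [e2]; exact h5)
      rw [e3, sub_self, norm_zero] at h6
      linarith
    refine ⟨‖G p.1 - G p.2.2‖ / 2, by positivity, fun x hx y hy z hz hxy hyz hle => ?_⟩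
    by_contra hcon
    have hm : (x, y, z) ∈ K := ⟨⟨hx, hy, hz⟩, hxy, hyz, by simp only; rw [hGe x hx, hGe y hy]; exact not_lt.1 hcon⟩
    have := hmin hm
    simp only [mem_ofPred_eq] at this
    rw [hGe x hx, hGe z hz] at this
    linarith


theorem chain {τ : ℝ × ℝ → ℝ} (hτ : IsNorm2 τ) {Γ : ℝ → ℝ × ℝ} {μ : ℝ} {S : Set (ℝ × ℝ)} {u : ℕ → ℝ}
    (hu : StrictMono u) (n : ℕ)
    (hΓ : ∀ z ∈ Icc (u 0) (u n), Γ z ∈ Isq ∧ Γ z ∉ S) (hμ0 : 0 ≤ μ)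
    (hcell : ∀ i < n, (∀ a ∈ Icc (u i) (u (i + 1)), ‖Γ a - Γ (u i)‖ ≤ μ) ∧ ∃ l, LenI τ Γ (u i) (u (i + 1)) l ∧
      Conn τ {p | p ∈ Isq ∧ p ∉ S ∧ ‖p - Γ (u i)‖ ≤ 2 * μ} (Γ (u i)) (Γ (u (i + 1))) l) :
    ∃ P l, PL P (u 0) (u n) ∧ P (u 0) = Γ (u 0) ∧ P (u n) = Γ (u n) ∧
      (∀ t ∈ Icc (u 0) (u n), P t ∈ Isq ∧ P t ∉ S ∧ ‖P t - Γ t‖ ≤ 3 * μ) ∧ LenI τ Γ (u 0) (u n) l ∧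
      ∫ t in (u 0)..(u n), iN τ (P t) (deriv P t) ≤ l := by
  induction n with
  | zero =>
    refine ⟨Γ, 0, PL.nil, rfl, rfl, fun t ht => ⟨(hΓ t ht).1, (hΓ t ht).2, ?_⟩, LenI.nil, by simp⟩
    rw [sub_self, norm_zero]; positivity
  | succ n ih =>
    have hlt : u n < u (n + 1) := hu (Nat.lt_succ_self n)
    have h0 : u 0 ≤ u n := hu.monotone (Nat.zero_le n)
    obtain ⟨P, l, p1, p2, p3, p4, p5, p6⟩ := ih (fun z hz => hΓ z ⟨hz.1, hz.2.trans hlt.le⟩)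
      (fun i hi => hcell i (by omega))
    obtain ⟨c1, k, c2, c3⟩ := hcell n (by omega)
    obtain ⟨B, b1, b2, b3, b4, b5⟩ := c3 _ _ hlt
    obtain ⟨Q, q1, q2, q3⟩ := p1.glue b1 (by rw [p3, b2])
    refine ⟨Q, l + k, q1, by rw [q2 _ h0, p2], by rw [q3 _ hlt.le, b3], ?_, p5.trans c2, ?_⟩
    · intro t ht
      rcases le_total t (u n) with h | h
      · rw [q2 t h]; exact p4 t ⟨ht.1, h⟩
      · rw [q3 t h]
        obtain ⟨g1, g2, g3⟩ := b4 t ⟨h, ht.2⟩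
        refine ⟨g1, g2, ?_⟩
        have := c1 t ⟨h, ht.2⟩
        calc ‖B t - Γ t‖ = ‖(B t - Γ (u n)) - (Γ t - Γ (u n))‖ := by rw [sub_sub_sub_cancel_right]
          _ ≤ ‖B t - Γ (u n)‖ + ‖Γ t - Γ (u n)‖ := norm_sub_le _ _
          _ ≤ 3 * μ := by linarith
    · rw [glue_len hτ q1 ⟨h0, hlt.le⟩ q2 q3]; linarith

theorem arc_poly {τ : ℝ × ℝ → ℝ} (hτ : IsNorm2 τ) {Γ : ℝ → ℝ × ℝ} {α β : ℝ} (hab : α < β)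
    (hc : ContinuousOn Γ (Icc α β)) {S : Set (ℝ × ℝ)}
    (hΓ : ∀ z ∈ Icc α β, Γ z ∈ Isq ∧ Γ z ∉ S)
    (hcor : ∀ p : ℝ × ℝ, |p.1| = 1 → |p.2| = 1 → p ∉ S) {c0 : ℝ} (hc0 : 0 < c0)
    (hchord : ∀ x ∈ Isq \ S, ∀ y ∈ Isq \ S, ‖x - y‖ < c0 → Disjoint (segment ℝ x y) S)
    {δ : ℝ} (hδ : 0 < δ) :
    ∃ P l, PL P α β ∧ P α = Γ α ∧ P β = Γ β ∧
      (∀ t ∈ Icc α β, P t ∈ Isq ∧ P t ∉ S ∧ ‖P t - Γ t‖ ≤ δ) ∧ LenI τ Γ α β l ∧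
      ∫ t in α..β, iN τ (P t) (deriv P t) ≤ l := by
  obtain ⟨μ, hμ0, hμ1, hμ2, hμ3⟩ : ∃ μ : ℝ, 0 < μ ∧ μ < 1 ∧ μ < c0 ∧ 3 * μ ≤ δ := by
    refine ⟨min (1 / 2) (min (c0 / 2) (δ / 3)), by positivity, ?_, ?_, ?_⟩
    · exact (min_le_left _ _).trans_lt (by norm_num)
    · exact ((min_le_right _ _).trans (min_le_left _ _)).trans_lt (by linarith)
    · have := (min_le_right (1 / 2) (min (c0 / 2) (δ / 3))).trans (min_le_right _ _)
      linarith
  have huc := isCompact_Icc.uniformContinuousOn_of_continuous hc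
  rw [Metric.uniformContinuousOn_iff] at huc
  obtain ⟨κ, hκ, huc⟩ := huc μ hμ0
  obtain ⟨n, hn⟩ := exists_nat_gt ((β - α) / κ)
  have hn0 : (0:ℝ) < n := lt_trans (div_pos (by linarith) hκ) hn
  have hw : 0 < (β - α) / n := div_pos (by linarith) hn0
  have hwκ : (β - α) / n < κ := by
    rw [div_lt_iff₀ hκ] at hn; rw [div_lt_iff₀ hn0]; linarith
  set u : ℕ → ℝ := fun k => α + k * ((β - α) / n) with hu
  have hus : StrictMono u := by
    refine strictMono_nat_of_lt_succ fun k => ?_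
    simp only [hu]; push_cast; linarith
  have u0 : u 0 = α := by simp [hu]
  have un : u n = β := by simp only [hu]; field_simp; ring
  have hin : ∀ i < n, Icc (u i) (u (i + 1)) ⊆ Icc α β := fun i hi => Icc_subset_Icc
    (by rw [← u0]; exact hus.monotone (Nat.zero_le i)) (by rw [← un]; exact hus.monotone hi)
  have hsm : ∀ i < n, ∀ a ∈ Icc (u i) (u (i + 1)), ∀ b ∈ Icc (u i) (u (i + 1)), ‖Γ a - Γ b‖ ≤ μ := by
    intro i hi a ha b hb
    rw [← dist_eq_norm]
    refine (huc a (hin i hi ha) b (hin i hi hb) ?_).le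
    rw [Real.dist_eq, abs_lt]
    have : u (i + 1) = u i + (β - α) / n := by simp only [hu]; push_cast; ring
    constructor <;> linarith [ha.1, ha.2, hb.1, hb.2]
  have := chain hτ (S := S) (Γ := Γ) hus n (by rw [u0, un]; exact hΓ) hμ0.le (fun i hi => by
    have hlt : u i < u (i + 1) := hus (Nat.lt_succ_self i)
    refine ⟨fun a ha => hsm i hi a ha _ ⟨le_rfl, hlt.le⟩, ?_⟩
    exact cell hτ hlt (hc.mono (hin i hi)) (fun z hz => (hΓ z (hin i hi hz)).1) (hsm i hi) hμ1
      (fun z hz => (hΓ z (hin i hi hz)).2) hcor (fun x hx y hy hxy => hchord x hx y hy (hxy.trans_lt hμ2)))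
  rw [u0, un] at this
  obtain ⟨P, l, p1, p2, p3, p4, p5, p6⟩ := this
  exact ⟨P, l, p1, p2, p3, fun t ht => ⟨(p4 t ht).1, (p4 t ht).2.1, (p4 t ht).2.2.trans hμ3⟩, p5, p6⟩

theorem arc_approx {τ : ℝ × ℝ → ℝ} (hτ : IsNorm2 τ) {Γ : ℝ → ℝ × ℝ} {α β : ℝ} (hab : α < β)
    (hc : ContinuousOn Γ (Icc α β)) (hi : InjOn Γ (Icc α β)) (hbv : BoundedVariationOn Γ (Icc α β))
    {S : Set (ℝ × ℝ)} (hΓ : ∀ z ∈ Icc α β, Γ z ∈ Isq ∧ Γ z ∉ S)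
    (hcor : ∀ p : ℝ × ℝ, |p.1| = 1 → |p.2| = 1 → p ∉ S) {c0 : ℝ} (hc0 : 0 < c0)
    (hchord : ∀ x ∈ Isq \ S, ∀ y ∈ Isq \ S, ‖x - y‖ < c0 → Disjoint (segment ℝ x y) S)
    {δ : ℝ} (hδ : 0 < δ) :
    ∃ (A : ℝ → ℝ × ℝ) (φ : ℝ → ℝ), PL A α β ∧ InjOn A (Icc α β) ∧ A α = Γ α ∧ A β = Γ β ∧
      (∀ t ∈ Icc α β, A t ∈ Isq ∧ A t ∉ S) ∧ Monotone φ ∧ Continuous φ ∧ φ α = α ∧ φ β = β ∧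
      (∀ t ∈ Icc α β, ‖A (φ t) - Γ t‖ ≤ δ) ∧
      ∫ t in α..β, iN τ (A t) (deriv A t) ≤ sSup {x | LenI τ Γ α β x} := by
  obtain ⟨ω, hω, hinj⟩ := unif_inj hc hi (half_pos hδ)
  obtain ⟨P, l, p1, p2, p3, p4, p5, p6⟩ := arc_poly hτ hab hc hΓ hcor hc0 hchord
    (δ := min (ω / 2) (δ / 2)) (by positivity)
  obtain ⟨A, T, φ, hA⟩ := loop_erase hτ p1
  have hT : 0 < T := by
    refine lt_of_le_of_ne hA.pl.le fun e => ?_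
    have h1 := hA.AT
    rw [← e, hA.A0, p2, p3] at h1
    exact hab.ne (hi ⟨le_rfl, hab.le⟩ ⟨hab.le, le_rfl⟩ h1)
  set k := T / (β - α) with hk
  have hba : 0 < β - α := by linarith
  have hk0 : 0 < k := div_pos hT hba
  set m := -(k * α) with hm
  have ea : (0 - m) / k = α := by rw [hm]; field_simp; ring
  have eb : (T - m) / k = β := by
    rw [div_eq_iff hk0.ne', hm, hk]; field_simp; ring
  have eka : k * α + m = 0 := by rw [hm]; ring
  have ekb : k * β + m = T := by rw [← eb]; field_simp; ring
  have hinv : ∀ x, k * ((x - m) / k) + m = x := fun x => by field_simp; ring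
  have hmem : ∀ t ∈ Icc α β, k * t + m ∈ Icc 0 T := by
    intro t ht
    rw [← eka, ← ekb]
    constructor
    · have := mul_le_mul_of_nonneg_left ht.1 hk0.le; linarith
    · have := mul_le_mul_of_nonneg_left ht.2 hk0.le; linarith
  refine ⟨fun t => A (k * t + m), fun t => (φ t - m) / k, ?_, ?_, ?_, ?_, ?_, ?_, ?_, ?_, ?_, ?_, ?_⟩
  · have := hA.pl.affine (k := k) (m := m) hk0
    rwa [ea, eb] at this
  · intro x hx y hy e
    have := hA.inj (hmem x hx) (hmem y hy) e
    have : k * x = k * y := by linarith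
    exact mul_left_cancel₀ hk0.ne' this
  · simp only; rw [eka, hA.A0, p2]
  · simp only; rw [ekb, hA.AT, p3]
  · intro t ht
    have hiv := intermediate_value_Icc hab.le hA.cont.continuousOn
    rw [hA.φa, hA.φb] at hiv
    obtain ⟨r, hr, e⟩ := hiv (hmem t ht)
    obtain ⟨t', ht', -, -, g, -⟩ := hA.sand r hr
    simp only
    rw [← e, g]
    have := p4 t' ⟨ht'.1, ht'.2.trans hr.2⟩
    exact ⟨this.1, this.2.1⟩
  · intro x y hxy
    have := hA.mono hxy
    dsimp only
    gcongr
  · have := hA.cont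
    fun_prop
  · simp only; rw [hA.φa, ea]
  · simp only; rw [hA.φb, eb]
  · intro t ht
    obtain ⟨t', ht', t'', ht'', g, g'⟩ := hA.sand t ht
    simp only
    rw [hinv]
    have m' : t' ∈ Icc α β := ⟨ht'.1, ht'.2.trans ht.2⟩
    have m'' : t'' ∈ Icc α β := ⟨ht.1.trans ht''.1, ht''.2⟩
    have n1 := (p4 t' m').2.2
    have n2 := (p4 t'' m'').2.2
    have w1 := min_le_left (ω / 2) (δ / 2)
    have w2 := min_le_right (ω / 2) (δ / 2)
    have h1 : ‖Γ t' - Γ t''‖ ≤ ω := by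
      rw [← g'.symm.trans g |>.symm] at n2
      calc ‖Γ t' - Γ t''‖ = ‖(P t' - Γ t'') - (P t' - Γ t')‖ := by congr 1; abel
        _ ≤ ‖P t' - Γ t''‖ + ‖P t' - Γ t'‖ := norm_sub_le _ _
        _ ≤ ω := by linarith
    have h2 := hinj t' m' t ht t'' m'' ht'.2 ht''.1 h1
    rw [g]
    calc ‖P t' - Γ t‖ = ‖(P t' - Γ t') + (Γ t' - Γ t)‖ := by rw [sub_add_sub_cancel]
      _ ≤ ‖P t' - Γ t'‖ + ‖Γ t' - Γ t‖ := norm_add_le _ _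
      _ ≤ δ := by linarith
  · have := PL.integral_affine (A := A) (a := 0) (b := T) (iN_smul hτ) (k := k) (m := m) hk0
    rw [ea, eb] at this
    rw [this]
    exact (hA.len.trans p6).trans (le_csSup (LenI.bddAbove hτ hbv) p5)


/-- Normalized parametrization of the curve. -/
structure Setup (Γ : ℝ → ℝ × ℝ) (α β : ℝ) : Prop where
  cont : ContinuousOn Γ (Icc 0 1)
  inj : InjOn Γ (Ico 0 1)
  closed : Γ 1 = Γ 0
  hα : 0 < α
  hαβ : α < β
  hβ : β < 1
  mem : ∀ t ∈ Icc (0:ℝ) 1, Γ t ∈ Isq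
  bv : BoundedVariationOn Γ (Icc α β)
  null : volume (Γ '' Icc 0 1) = 0
  lin : ∃ (e : ℂ) (d0 d1 : ℝ × ℝ), e ≠ 0 ∧ (∀ p ∈ Isq, 0 ≤ (e * cx (p - Γ 0)).re) ∧
    (∀ p ∈ Oq, 0 < (e * cx (p - Γ 0)).re) ∧ (e * cx d0).re = 0 ∧ (e * cx d1).re = 0 ∧
    (∀ t ∈ Icc 0 α, Γ t = Γ 0 + t • d0) ∧ ∀ t ∈ Icc β 1, Γ t = Γ 0 + (t - 1) • d1

theorem cx_smul (c : ℝ) (p : ℝ × ℝ) : cx (c • p) = c * cx p := by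
  apply Complex.ext <;> simp [cx_re, cx_im]
theorem cx_add (p q : ℝ × ℝ) : cx (p + q) = cx p + cx q := map_add Complex.equivRealProdCLM.symm p q

namespace Setup
variable {Γ : ℝ → ℝ × ℝ} {α β : ℝ}

set_option maxHeartbeats 1600000 in
theorem sep (h : Setup Γ α β) : ∃ S : Set (ℝ × ℝ), (∀ t ∈ Icc α β, Γ t ∉ S) ∧ (∀ t ∈ Ico 0 α, Γ t ∈ S) ∧
    (∀ t ∈ Ioc β 1, Γ t ∈ S) ∧ (∀ p : ℝ × ℝ, |p.1| = 1 → |p.2| = 1 → p ∉ S) ∧ ∃ c0 > 0,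
      ∀ x ∈ Isq \ S, ∀ y ∈ Isq \ S, ‖x - y‖ < c0 → Disjoint (segment ℝ x y) S := by
  obtain ⟨e, d0, d1, he, hpos, -, hd0, hd1, l0, l1⟩ := h.lin
  have hα := h.hα
  have hαβ := h.hαβ
  have hβ := h.hβ
  set a := (e * cx d0).im with ha
  set b := (e * cx d1).im with hb
  have ea : e * cx d0 = a * Complex.I := by apply Complex.ext <;> simp [hd0, ha]
  have eb : e * cx d1 = b * Complex.I := by apply Complex.ext <;> simp [hd1, hb]
  have zero_of : ∀ d : ℝ × ℝ, e * cx d = 0 → d = 0 := by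
    intro d hd
    have := (mul_eq_zero.1 hd).resolve_left he
    have h0 : cx 0 = 0 := map_zero Complex.equivRealProdCLM.symm
    exact cx_inj (this.trans h0.symm)
  have ha0 : a ≠ 0 := by
    intro e0
    have hd : d0 = 0 := zero_of _ (by rw [ea, e0]; simp)
    have := l0 α ⟨hα.le, le_rfl⟩
    rw [hd, smul_zero, add_zero] at this
    have := h.inj ⟨hα.le, by linarith⟩ ⟨le_rfl, one_pos⟩ this
    linarith
  have hb0 : b ≠ 0 := by
    intro e0
    have hd : d1 = 0 := zero_of _ (by rw [eb, e0]; simp)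
    have := l1 β ⟨le_rfl, hβ.le⟩
    rw [hd, smul_zero, add_zero] at this
    have := h.inj ⟨by linarith, by linarith⟩ ⟨le_rfl, one_pos⟩ this
    linarith
  set r := b / a with hr
  have hr0 : r ≠ 0 := div_ne_zero hb0 ha0
  have hd1r : d1 = r • d0 := by
    have : e * cx (d1 - r • d0) = 0 := by
      have ha0' : (a : ℂ) ≠ 0 := by exact_mod_cast ha0
      rw [cx_sub, cx_smul, mul_sub, eb, mul_left_comm, ea, hr]
      push_cast; field_simp; ring
    exact sub_eq_zero.1 (zero_of _ this)
  have hrpos : 0 < r := by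
    by_contra hcon
    have hneg : r < 0 := lt_of_le_of_ne (not_lt.1 hcon) hr0
    -- choose small parameter
    set s := min (α / 2) ((1 - β) * (-r)) with hs
    have hs0 : 0 < s := lt_min (by linarith) (mul_pos (by linarith) (by linarith))
    have hs1 : s ≤ α / 2 := min_le_left _ _
    have hs2 : s ≤ (1 - β) * (-r) := min_le_right _ _
    set s' := s / (-r) with hs'
    have hs'0 : 0 < s' := div_pos hs0 (by linarith)
    have hs'1 : s' ≤ 1 - β := by rw [hs', div_le_iff₀ (by linarith)]; exact hs2
    have e1 := l0 s ⟨hs0.le, by linarith⟩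
    have e2 := l1 (1 - s') ⟨by linarith, by linarith⟩
    have e3 : (1 - s' - 1) * r = s := by rw [hs']; field_simp; ring
    rw [hd1r, smul_smul, e3, ← e1] at e2
    have := h.inj ⟨by linarith, by linarith⟩ ⟨hs0.le, by linarith⟩ e2
    linarith
  set H : ℝ × ℝ → ℝ := fun p => (e * cx (p - Γ 0)).re with hH
  set G : ℝ × ℝ → ℝ := fun p => (e * cx (p - Γ 0)).im / a with hG
  have HG : ∀ c : ℝ, H (Γ 0 + c • d0) = 0 ∧ G (Γ 0 + c • d0) = c := by
    intro c
    have : e * cx (Γ 0 + c • d0 - Γ 0) = (c * a : ℝ) * Complex.I := by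
      rw [add_sub_cancel_left, cx_smul, mul_left_comm, ea]; push_cast; ring
    simp only [hH, hG, this]
    constructor
    · simp
    · simp; field_simp
  have HGi : ∀ p, H p = 0 → p = Γ 0 + G p • d0 := by
    intro p hp
    have : e * cx ((p - Γ 0) - G p • d0) = 0 := by
      rw [cx_sub, cx_smul, mul_sub, mul_left_comm, ea]
      apply Complex.ext
      · have hp' : (e * cx (p - Γ 0)).re = 0 := hp
        rw [Complex.sub_re, hp']
        simp
      · rw [Complex.sub_im]
        simp [hG]; field_simp; ring
    have := sub_eq_zero.1 (zero_of _ this)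
    rw [← this]; abel
  have aff : ∀ (u v : ℝ) (x y : ℝ × ℝ), u + v = 1 →
      H (u • x + v • y) = u * H x + v * H y ∧ G (u • x + v • y) = u * G x + v * G y := by
    intro u v x y huv
    have : e * cx (u • x + v • y - Γ 0) = u * (e * cx (x - Γ 0)) + v * (e * cx (y - Γ 0)) := by
      have : u • x + v • y - Γ 0 = u • (x - Γ 0) + v • (y - Γ 0) := by
        have : Γ 0 = (u + v) • Γ 0 := by rw [huv, one_smul]
        conv_lhs => rw [this]
        module
      rw [this, cx_add, cx_smul, cx_smul]; ring
    simp only [hH, hG, this]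
    constructor
    · simp
    · simp; ring
  set S : Set (ℝ × ℝ) := {p | H p = 0 ∧ G p ∈ Ioo (-((1 - β) * r)) α} with hS
  have hSI : ∀ p ∈ S, ∃ t ∈ Ico 0 α ∪ Ioc β 1, Γ t = p := by
    rintro p ⟨hp, hg1, hg2⟩
    rcases le_or_gt 0 (G p) with h0 | h0
    · exact ⟨G p, Or.inl ⟨h0, hg2⟩, by rw [l0 _ ⟨h0, hg2.le⟩, ← HGi p hp]⟩
    · have k1 : G p / r < 0 := div_neg_of_neg_of_pos h0 hrpos
      have k2 : -(1 - β) < G p / r := by rw [lt_div_iff₀ hrpos]; linarith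
      refine ⟨1 + G p / r, Or.inr ⟨by linarith, by linarith⟩, ?_⟩
      rw [l1 _ ⟨by linarith, by linarith⟩, hd1r, smul_smul,
        show (1 + G p / r - 1) * r = G p by field_simp; ring, ← HGi p hp]
  have m0 : ∀ t ∈ Ico 0 α, Γ t ∈ S := by
    intro t ht
    rw [l0 t ⟨ht.1, ht.2.le⟩]
    refine ⟨(HG t).1, ?_⟩
    rw [(HG t).2]
    exact ⟨by have : 0 < (1 - β) * r := mul_pos (by linarith) hrpos
              linarith [ht.1], ht.2⟩
  have m1 : ∀ t ∈ Ioc β 1, Γ t ∈ S := by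
    intro t ht
    rw [l1 t ⟨ht.1.le, ht.2⟩, hd1r, smul_smul]
    refine ⟨(HG _).1, ?_⟩
    rw [(HG _).2]
    have k := mul_nonneg (sub_nonneg.2 ht.2) hrpos.le
    have k' := mul_pos (sub_pos.2 ht.1) hrpos
    rw [sub_mul] at k k'
    constructor <;> linarith
  refine ⟨S, ?_, m0, m1, ?_, (α + (1 - β) * r) * |a| / (2 * ‖e‖), ?_, ?_⟩
  · intro t ht hts
    obtain ⟨t', ht', e'⟩ := hSI _ hts
    rcases ht' with ht' | ht'
    · have := h.inj ⟨ht'.1, by linarith [ht'.2]⟩ ⟨by linarith [ht.1], by linarith [ht.2]⟩ e'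
      linarith [ht'.2, ht.1]
    · rcases ht'.2.eq_or_lt with h1 | h1
      · rw [h1, h.closed] at e'
        have := h.inj ⟨le_rfl, one_pos⟩ ⟨by linarith [ht.1], by linarith [ht.2]⟩ e'
        linarith [ht.1]
      · have := h.inj ⟨by linarith [ht'.1], h1⟩ ⟨by linarith [ht.1], by linarith [ht.2]⟩ e'
        linarith [ht'.1, ht.2]
  · intro p hp1 hp2 hpS
    obtain ⟨hp, hg1, hg2⟩ := hpS
    set κ := min (α - G p) (G p + (1 - β) * r) / 2 with hκ
    have hκ0 : 0 < κ := half_pos (lt_min (by linarith) (by linarith))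
    have hκ1 : κ < α - G p := lt_of_lt_of_le (half_lt_self (lt_min (by linarith) (by linarith))) (min_le_left _ _)
    have hκ2 : κ < G p + (1 - β) * r :=
      lt_of_lt_of_le (half_lt_self (lt_min (by linarith) (by linarith))) (min_le_right _ _)
    have hin : ∀ c, |c| ≤ κ → Γ 0 + (G p + c) • d0 ∈ Isq := by
      intro c hc
      rw [abs_le] at hc
      have : Γ 0 + (G p + c) • d0 ∈ S := by
        refine ⟨(HG _).1, ?_⟩
        rw [(HG _).2]; constructor <;> linarith
      obtain ⟨t, ht, e'⟩ := hSI _ this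
      rw [← e']
      refine h.mem t ?_
      rcases ht with ht | ht
      · exact ⟨ht.1, by linarith [ht.2]⟩
      · exact ⟨by linarith [ht.1], ht.2⟩
    have q1 := mem_Isq.1 (hin κ (by rw [abs_of_pos hκ0]))
    have q2 := mem_Isq.1 (hin (-κ) (by rw [abs_neg, abs_of_pos hκ0]))
    have ep := HGi p hp
    have ep1 : p.1 = (Γ 0).1 + G p * d0.1 := congrArg Prod.fst ep
    have ep2 : p.2 = (Γ 0).2 + G p * d0.2 := congrArg Prod.snd ep
    simp only [Prod.fst_add, Prod.snd_add, Prod.smul_fst, Prod.smul_snd, smul_eq_mul, add_mul, neg_mul] at q1 q2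
    have z1 : κ * d0.1 = 0 := by
      rcases eq_or_eq_neg_of_abs_eq hp1 with h' | h' <;> rw [h'] at ep1 <;> linarith [q1.1.1, q1.1.2, q2.1.1, q2.1.2]
    have z2 : κ * d0.2 = 0 := by
      rcases eq_or_eq_neg_of_abs_eq hp2 with h' | h' <;> rw [h'] at ep2 <;> linarith [q1.2.1, q1.2.2, q2.2.1, q2.2.2]
    have hd : d0 = 0 := Prod.ext ((mul_eq_zero.1 z1).resolve_left hκ0.ne') ((mul_eq_zero.1 z2).resolve_left hκ0.ne')
    apply ha0
    rw [ha, hd, show cx 0 = 0 from map_zero Complex.equivRealProdCLM.symm]; simp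
  · have : 0 < ‖e‖ := norm_pos_iff.2 he
    have := abs_pos.2 ha0
    have : 0 < (1 - β) * r := mul_pos (by linarith) hrpos
    positivity
  · intro x hx y hy hxy
    rw [Set.disjoint_left]
    rintro _ ⟨u, v, hu, hv, huv, rfl⟩ ⟨z1, z2⟩
    rw [(aff u v x y huv).1] at z1
    rw [(aff u v x y huv).2] at z2
    rcases hu.eq_or_lt with hu0 | hu0
    · rw [← hu0, zero_add] at huv
      rw [← hu0, huv, zero_mul, zero_add, one_mul] at z1 z2
      exact hy.2 ⟨z1, z2⟩
    rcases hv.eq_or_lt with hv0 | hv0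
    · rw [← hv0, add_zero] at huv
      rw [← hv0, huv, zero_mul, add_zero, one_mul] at z1 z2
      exact hx.2 ⟨z1, z2⟩
    have px : 0 ≤ H x := hpos x hx.1
    have py : 0 ≤ H y := hpos y hy.1
    have k1 := mul_nonneg hu px
    have k2 := mul_nonneg hv py
    have Hx : H x = 0 := (mul_eq_zero.1 (by linarith : u * H x = 0)).resolve_left hu0.ne'
    have Hy : H y = 0 := (mul_eq_zero.1 (by linarith : v * H y = 0)).resolve_left hv0.ne'
    have gx : ¬ (-((1 - β) * r) < G x ∧ G x < α) := fun hh => hx.2 ⟨Hx, hh⟩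
    have gy : ¬ (-((1 - β) * r) < G y ∧ G y < α) := fun hh => hy.2 ⟨Hy, hh⟩
    have hv' : v = 1 - u := by linarith
    obtain ⟨z2a, z2b⟩ := z2
    have big : α + (1 - β) * r ≤ |G x - G y| := by
      rw [not_and_or, not_lt, not_lt] at gx gy
      rw [le_abs]
      have c1 : ∀ c, G x ≤ c → G y ≤ c → u * G x + v * G y ≤ c := fun c k1 k2 => by
        have := mul_le_mul_of_nonneg_left k1 hu
        have := mul_le_mul_of_nonneg_left k2 hv
        have : u * c + v * c = c := by rw [← add_mul, huv, one_mul]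
        linarith
      have c2 : ∀ c, c ≤ G x → c ≤ G y → c ≤ u * G x + v * G y := fun c k1 k2 => by
        have := mul_le_mul_of_nonneg_left k1 hu
        have := mul_le_mul_of_nonneg_left k2 hv
        have : u * c + v * c = c := by rw [← add_mul, huv, one_mul]
        linarith
      rcases gx with gx | gx <;> rcases gy with gy | gy
      · have := c1 _ gx gy; linarith
      · right; linarith
      · left; linarith
      · have := c2 _ gx gy; linarith
    have sm : |G x - G y| * |a| ≤ 2 * ‖e‖ * ‖x - y‖ := by
      have : (G x - G y) * a = (e * cx (x - y)).im := by
        have : x - y = (x - Γ 0) - (y - Γ 0) := by abel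
        rw [this, cx_sub, mul_sub, Complex.sub_im]
        simp only [hG]; field_simp
      rw [← abs_mul, this]
      calc _ ≤ ‖e * cx (x - y)‖ := Complex.abs_im_le_norm _
        _ = ‖e‖ * ‖cx (x - y)‖ := norm_mul _ _
        _ ≤ ‖e‖ * (2 * ‖x - y‖) := by gcongr; exact norm_cx_le _
        _ = _ := by ring
    have hen : 0 < 2 * ‖e‖ := by have := norm_pos_iff.2 he; positivity
    rw [lt_div_iff₀ hen] at hxy
    have := mul_le_mul_of_nonneg_right big (abs_nonneg a)
    linarith

end Setup


namespace Setup
variable {Γ : ℝ → ℝ × ℝ} {α β : ℝ}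

theorem jh (h : Setup Γ α β) {ρ : ℝ → ℝ × ℝ} (hc : ContinuousOn ρ (Icc 0 1)) (hi : InjOn ρ (Ico 0 1))
    (hm : ∀ t ∈ Icc (0:ℝ) 1, ρ t ∈ Isq) (e0 : ∀ t ∈ Icc 0 α, ρ t = Γ t)
    (e1 : ∀ t ∈ Icc β 1, ρ t = Γ t) : JHyp ρ := by
  obtain ⟨e, d0, d1, he, hpos, -, hd0, hd1, l0, l1⟩ := h.lin
  have hα := h.hα
  have hαβ := h.hαβ
  have hβ := h.hβ
  have r0 : ρ 0 = Γ 0 := e0 0 ⟨le_rfl, hα.le⟩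
  have r1 : ρ 1 = Γ 1 := e1 1 ⟨hβ.le, le_rfl⟩
  refine ⟨hc, hi, by rw [r0, r1, h.closed], e, he, fun t ht => ?_, min (min α (1 - β)) (1/4), ?_, ?_, ?_, ?_⟩
  · rw [r0]; exact hpos _ (hm t ht)
  · exact lt_min (lt_min hα (by linarith)) (by norm_num)
  · exact lt_of_le_of_lt (min_le_right _ _) (by norm_num)
  · intro t ht
    have ht' : t ∈ Icc 0 α := ⟨ht.1, ht.2.trans ((min_le_left _ _).trans (min_le_left _ _))⟩
    rw [r0, e0 t ht', l0 t ht', add_sub_cancel_left, cx_smul, mul_left_comm, Complex.re_ofReal_mul, hd0, mul_zero]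
  · intro t ht
    have k : min (min α (1 - β)) (1/4) ≤ 1 - β := (min_le_left _ _).trans (min_le_right _ _)
    have ht' : t ∈ Icc β 1 := ⟨by linarith [ht.1], ht.2⟩
    rw [r0, e1 t ht', l1 t ht', add_sub_cancel_left, cx_smul, mul_left_comm, Complex.re_ofReal_mul, hd1, mul_zero]

theorem jhyp (h : Setup Γ α β) : JHyp Γ :=
  h.jh h.cont h.inj h.mem (fun _ _ => rfl) fun _ _ => rfl

theorem notOq (h : Setup Γ α β) {t : ℝ} (ht : t ∈ Icc 0 α ∪ Icc β 1) : Γ t ∉ Oq := by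
  obtain ⟨e, d0, d1, he, -, hpos, hd0, hd1, l0, l1⟩ := h.lin
  intro ho
  have := hpos _ ho
  rcases ht with ht | ht
  · rw [l0 t ht, add_sub_cancel_left, cx_smul, mul_left_comm, Complex.re_ofReal_mul, hd0, mul_zero] at this
    exact lt_irrefl _ this
  · rw [l1 t ht, add_sub_cancel_left, cx_smul, mul_left_comm, Complex.re_ofReal_mul, hd1, mul_zero] at this
    exact lt_irrefl _ this

theorem approx (h : Setup Γ α β) {τ : ℝ × ℝ → ℝ} (hτ : IsNorm2 τ) {δ : ℝ} (hδ : 0 < δ) :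
    ∃ (ρ : ℝ → ℝ × ℝ) (φ : ℝ → ℝ), PL ρ 0 1 ∧ JHyp ρ ∧ (∀ t ∈ Icc (0:ℝ) 1, ρ t ∈ Isq) ∧
      Continuous φ ∧ Monotone φ ∧ φ 0 = 0 ∧ φ 1 = 1 ∧ (∀ t ∈ Icc (0:ℝ) 1, ‖ρ (φ t) - Γ t‖ ≤ δ) ∧
      ∫ t in (0:ℝ)..1, iN τ (ρ t) (deriv ρ t) ≤ sSup {x | LenI τ Γ α β x} := by
  have hα := h.hα
  have hαβ := h.hαβ
  have hβ := h.hβ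
  obtain ⟨S, s1, s2, s3, s4, c0, hc0, s5⟩ := h.sep
  have sub : Icc α β ⊆ Ico 0 1 := fun t ht => ⟨by linarith [ht.1], by linarith [ht.2]⟩
  have sub' : Icc α β ⊆ Icc 0 1 := sub.trans Ico_subset_Icc_self
  obtain ⟨A, φ, a1, a2, a3, a4, a5, f1, f2, f3, f4, a6, a7⟩ :=
    arc_approx hτ hαβ (h.cont.mono sub') (h.inj.mono sub) h.bv
      (fun z hz => ⟨h.mem z (sub' hz), s1 z hz⟩) s4 hc0 s5 hδ
  have P0 : PL Γ 0 α := by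
    obtain ⟨e, d0, d1, -, -, -, -, -, l0, l1⟩ := h.lin
    exact PL.single hα.le (d := d0) fun t ht => by rw [l0 t ht, sub_zero]
  have P1 : PL Γ β 1 := by
    obtain ⟨e, d0, d1, -, -, -, -, -, l0, l1⟩ := h.lin
    refine PL.single hβ.le (d := d1) fun t ht => ?_
    rw [l1 t ht, l1 β ⟨le_rfl, hβ.le⟩, add_assoc, ← add_smul]; congr 2; ring
  obtain ⟨Q, q1, q2, q3⟩ := a1.glue P1 a4
  obtain ⟨ρ, p1, p2, p3⟩ := P0.glue q1 (by rw [q2 α hαβ.le, a3])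
  have r0 : ∀ t ∈ Icc 0 α, ρ t = Γ t := fun t ht => p2 t ht.2
  have rm : ∀ t ∈ Icc α β, ρ t = A t := fun t ht => by rw [p3 t ht.1, q2 t ht.2]
  have r1 : ∀ t ∈ Icc β 1, ρ t = Γ t := fun t ht => by rw [p3 t (by linarith [ht.1]), q3 t ht.1]
  have hm : ∀ t ∈ Icc (0:ℝ) 1, ρ t ∈ Isq := by
    intro t ht
    rcases le_total t α with k | k
    · rw [r0 t ⟨ht.1, k⟩]; exact h.mem t ht
    rcases le_total t β with k' | k'
    · rw [rm t ⟨k, k'⟩]; exact (a5 t ⟨k, k'⟩).1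
    · rw [r1 t ⟨k', ht.2⟩]; exact h.mem t ht
  have cls : ∀ t ∈ Ico (0:ℝ) 1, (t ∈ Icc α β ∧ ρ t = A t ∧ ρ t ∉ S) ∨ (ρ t = Γ t ∧ ρ t ∈ S) := by
    intro t ht
    rcases lt_or_ge t α with k | k
    · right; rw [r0 t ⟨ht.1, k.le⟩]; exact ⟨rfl, s2 t ⟨ht.1, k⟩⟩
    rcases le_or_gt t β with k' | k'
    · left; rw [rm t ⟨k, k'⟩]; exact ⟨⟨k, k'⟩, rfl, (a5 t ⟨k, k'⟩).2⟩
    · right; rw [r1 t ⟨k'.le, ht.2.le⟩]; exact ⟨rfl, s3 t ⟨k', ht.2.le⟩⟩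
  have hi : InjOn ρ (Ico 0 1) := by
    intro s hs t ht e
    rcases cls s hs with ⟨k1, k2, k3⟩ | ⟨k2, k3⟩ <;> rcases cls t ht with ⟨l1, l2, l3⟩ | ⟨l2, l3⟩
    · exact a2 k1 l1 (by rw [← k2, ← l2, e])
    · rw [e] at k3; exact absurd l3 k3
    · rw [e] at k3; exact absurd k3 l3
    · exact h.inj hs ht (by rw [← k2, ← l2, e])
  set ψ : ℝ → ℝ := fun t => φ (max α (min t β)) + min (t - α) 0 + max (t - β) 0 with hψ
  have ψ0 : ∀ t ≤ α, ψ t = t := by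
    intro t ht
    simp only [hψ]
    rw [min_eq_left (by linarith), max_eq_left ht, f3, min_eq_left (by linarith), max_eq_right (by linarith)]; ring
  have ψm : ∀ t ∈ Icc α β, ψ t = φ t := by
    intro t ht
    simp only [hψ]
    rw [min_eq_left ht.2, max_eq_right ht.1, min_eq_right (by linarith [ht.1]), max_eq_right (by linarith [ht.2])]; ring
  have ψ1 : ∀ t, β ≤ t → ψ t = t := by
    intro t ht
    simp only [hψ]
    rw [min_eq_right ht, max_eq_right hαβ.le, f4, min_eq_right (by linarith), max_eq_left (by linarith)]; ring
  refine ⟨ρ, ψ, p1, h.jh p1.cont hi hm r0 r1, hm, ?_, ?_, ψ0 0 hα.le, ψ1 1 hβ.le, ?_, ?_⟩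
  · simp only [hψ]; fun_prop
  · intro s t hst
    simp only [hψ]
    have := f1 (max_le_max le_rfl (min_le_min hst le_rfl) : max α (min s β) ≤ max α (min t β))
    have : min (s - α) 0 ≤ min (t - α) 0 := min_le_min (by linarith) le_rfl
    have : max (s - β) 0 ≤ max (t - β) 0 := max_le_max (by linarith) le_rfl
    linarith
  · intro t ht
    rcases le_total t α with k | k
    · rw [ψ0 t k, r0 t ⟨ht.1, k⟩, sub_self, norm_zero]; exact hδ.le
    rcases le_total t β with k' | k'
    · have : φ t ∈ Icc α β := ⟨f3 ▸ f1 k, f4 ▸ f1 k'⟩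
      rw [ψm t ⟨k, k'⟩, rm _ this]; exact a6 t ⟨k, k'⟩
    · rw [ψ1 t k', r1 t ⟨k', ht.2⟩, sub_self, norm_zero]; exact hδ.le
  · rw [glue_len hτ p1 ⟨hα.le, by linarith⟩ p2 p3, glue_len hτ q1 ⟨hαβ.le, hβ.le⟩ q2 q3]
    have z0 : ∫ z in (0:ℝ)..α, iN τ (Γ z) (deriv Γ z) = 0 := by
      refine intervalIntegral.integral_zero_ae (ae_of_all _ fun z hz => ?_)
      rw [uIoc_of_le hα.le] at hz
      exact iN_of_not_mem (h.notOq (Or.inl ⟨hz.1.le, hz.2⟩))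
    have z1 : ∫ z in β..(1:ℝ), iN τ (Γ z) (deriv Γ z) = 0 := by
      refine intervalIntegral.integral_zero_ae (ae_of_all _ fun z hz => ?_)
      rw [uIoc_of_le hβ.le] at hz
      exact iN_of_not_mem (h.notOq (Or.inr ⟨hz.1.le, hz.2⟩))
    rw [z0, z1]; linarith

end Setup


theorem HasW.comp {ρ : ℝ → ℝ × ℝ} {x : ℝ × ℝ} {w : ℤ} (h : HasW ρ x w) {φ : ℝ → ℝ} (hc : Continuous φ)
    (hm : Monotone φ) (h0 : φ 0 = 0) (h1 : φ 1 = 1) : HasW (ρ ∘ φ) x w := by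
  obtain ⟨L, l1, l2, l3⟩ := h
  have mt : MapsTo φ (Icc 0 1) (Icc 0 1) := fun t ht => ⟨h0 ▸ hm ht.1, h1 ▸ hm ht.2⟩
  refine ⟨L ∘ φ, l1.comp hc.continuousOn mt, fun t ht => l2 _ (mt ht), ?_⟩
  simp only [Function.comp, h0, h1, l3]

theorem mem_hull_iff {Γ : ℝ → ℝ × ℝ} (h : JHyp Γ) {x : ℝ × ℝ} (hx : x ∉ Γ '' Icc 0 1) {w : ℤ}
    (hw : HasW Γ x w) : x ∈ hullSet (Γ '' Icc 0 1) ↔ w ≠ 0 := by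
  obtain ⟨σ, hσ, U, -, -, e, u1, u2⟩ := jordan h
  have hσ0 : σ ≠ 0 := fun e => by rw [e] at hσ; simp at hσ
  rw [e]
  constructor
  · rintro (hc | hU)
    · exact absurd hc hx
    · rw [hw.unique (u1 x hU)]; exact hσ0
  · intro w0
    by_contra hU
    exact w0 (hw.unique (u2 x hx fun hu => hU (Or.inr hu)))

theorem onto01 {φ : ℝ → ℝ} (hc : Continuous φ) (h0 : φ 0 = 0) (h1 : φ 1 = 1) {t : ℝ} (ht : t ∈ Icc (0:ℝ) 1) :
    ∃ s ∈ Icc (0:ℝ) 1, φ s = t := by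
  have := intermediate_value_Icc zero_le_one hc.continuousOn
  rw [h0, h1] at this
  exact this ht

theorem hull_close {Γ ρ : ℝ → ℝ × ℝ} (h : JHyp Γ) (hρ : JHyp ρ) {φ : ℝ → ℝ} (hc : Continuous φ)
    (hm : Monotone φ) (h0 : φ 0 = 0) (h1 : φ 1 = 1) {δ : ℝ} (hδ : 0 < δ)
    (hd : ∀ t ∈ Icc (0:ℝ) 1, ‖ρ (φ t) - Γ t‖ ≤ δ) :
    symmDiff (hullSet (Γ '' Icc 0 1)) (hullSet (ρ '' Icc 0 1)) ⊆ Metric.cthickening (3 * δ) (Γ '' Icc 0 1) := by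
  intro x hx
  by_contra hn
  have far : ∀ t ∈ Icc (0:ℝ) 1, 3 * δ < ‖Γ t - x‖ := by
    intro t ht
    by_contra hcon
    refine hn (Metric.mem_cthickening_of_dist_le x (Γ t) _ _ ⟨t, ht, rfl⟩ ?_)
    rw [dist_comm, dist_eq_norm]; exact not_lt.1 hcon
  have x1 : x ∉ Γ '' Icc 0 1 := by
    rintro ⟨t, ht, e⟩
    have := far t ht
    rw [e, sub_self, norm_zero] at this; linarith
  have x2 : x ∉ ρ '' Icc 0 1 := by
    rintro ⟨t, ht, e⟩
    obtain ⟨s, hs, es⟩ := onto01 hc h0 h1 ht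
    have k1 := far s hs
    have k2 := hd s hs
    rw [es, e, norm_sub_rev] at k2; linarith
  obtain ⟨w, hw⟩ := exists_hasW hρ.cont hρ.closed x2
  have mt : MapsTo φ (Icc 0 1) (Icc 0 1) := fun t ht => ⟨h0 ▸ hm ht.1, h1 ▸ hm ht.2⟩
  have hw' : HasW Γ x w := by
    refine (hw.comp hc hm h0 h1).perturb h.cont (hρ.cont.comp hc.continuousOn mt) h.closed
      (by simp [h0, h1, hρ.closed]) fun t ht => ?_
    have e : (Γ t - x) - ((ρ ∘ φ) t - x) = -(ρ (φ t) - Γ t) := by simp only [Function.comp]; abel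
    rw [← cx_sub, e]
    have k1 := far t ht
    have k2 := hd t ht
    have k3 := norm_cx_le (-(ρ (φ t) - Γ t))
    have k4 := norm_cx_ge ((ρ ∘ φ) t - x)
    rw [norm_neg] at k3
    -- refined bound through the real distance
    have k5 : ‖Γ t - x‖ ≤ ‖(ρ ∘ φ) t - x‖ + ‖ρ (φ t) - Γ t‖ := by
      have : Γ t - x = ((ρ ∘ φ) t - x) - (ρ (φ t) - Γ t) := by simp only [Function.comp]; abel
      rw [this]; exact norm_sub_le _ _
    linarith
  rcases hx with ⟨p, q⟩ | ⟨p, q⟩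
  · exact q ((mem_hull_iff hρ x2 hw).2 ((mem_hull_iff h x1 hw').1 p))
  · exact q ((mem_hull_iff h x1 hw').2 ((mem_hull_iff hρ x2 hw).1 p))

theorem haus_close {Γ ρ : ℝ → ℝ × ℝ} {φ : ℝ → ℝ} (hc : Continuous φ)
    (hm : Monotone φ) (h0 : φ 0 = 0) (h1 : φ 1 = 1) {δ : ℝ} (hδ : 0 < δ)
    (hd : ∀ t ∈ Icc (0:ℝ) 1, ‖ρ (φ t) - Γ t‖ ≤ δ) :
    Metric.hausdorffDist (Γ '' Icc 0 1) (ρ '' Icc 0 1) ≤ δ := by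
  refine Metric.hausdorffDist_le_of_mem_dist hδ.le ?_ ?_
  · rintro _ ⟨t, ht, rfl⟩
    refine ⟨ρ (φ t), ⟨φ t, ⟨h0 ▸ hm ht.1, h1 ▸ hm ht.2⟩, rfl⟩, ?_⟩
    rw [dist_comm, dist_eq_norm]; exact hd t ht
  · rintro _ ⟨t, ht, rfl⟩
    obtain ⟨s, hs, es⟩ := onto01 hc h0 h1 ht
    refine ⟨Γ s, ⟨s, hs, rfl⟩, ?_⟩
    rw [← es, dist_eq_norm]; exact hd s hs

theorem hull_meas {Γ : ℝ → ℝ × ℝ} (h : JHyp Γ) : MeasurableSet (hullSet (Γ '' Icc 0 1)) := by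
  obtain ⟨σ, hσ, U, hU, -, e, u1, u2⟩ := jordan h
  rw [e]
  exact (isCompact_Icc.image_of_continuousOn h.cont).measurableSet.union hU.measurableSet

theorem energy_eq {ρ : ℝ → ℝ × ℝ} (h : PL ρ 0 1) (J : JHyp ρ) : ∃ σ : ℝ, (σ = 1 ∨ σ = -1) ∧
    ∀ f : ℝ × ℝ → ℝ × ℝ, ContDiff ℝ 1 f → HasCompactSupport f →
      ∫ t in (0:ℝ)..1, lineI f (ρ t) (deriv ρ t) = σ * ∫ x in hullSet (ρ '' Icc 0 1), div2 f x := by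
  classical
  obtain ⟨σ, hσ, U, hU, -, e, u1, u2⟩ := jordan J
  refine ⟨σ, ?_, fun f hf hfc => ?_⟩
  · rcases Int.isUnit_iff.1 (IsUnit.of_mul_eq_one _ hσ) with h | h <;> simp [h]
  have hn := h.null
  have hw : ∀ᵐ x, HasW ρ x (if x ∈ U then σ else 0) := by
    have : ∀ᵐ x, x ∉ ρ '' Icc 0 1 := measure_eq_zero_iff_ae_notMem.1 hn
    filter_upwards [this] with x hx
    split_ifs with hu
    · exact u1 x hu
    · exact u2 x hx hu
  rw [h.green J.closed hw hf hfc, e]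
  have : (ρ '' Icc 0 1 ∪ U : Set (ℝ × ℝ)) =ᵐ[volume] U := by
    rw [union_comm]
    exact union_ae_eq_left_of_ae_eq_empty (ae_eq_empty.2 hn)
  rw [setIntegral_congr_set this, ← integral_indicator hU.measurableSet, ← integral_const_mul]
  congr 1
  ext x
  by_cases hx : x ∈ U <;> simp [hx]


theorem bump1 {s t : Set (ℝ × ℝ)} (hs : IsClosed s) (ht : IsClosed t) (hd : Disjoint s t) :
    ∃ χ : ℝ × ℝ → ℝ, ContDiff ℝ (⊤ : ℕ∞) χ ∧ (∀ x ∈ s, χ x = 0) ∧ (∀ x ∈ t, χ x = 1) ∧ ∀ x, χ x ∈ Icc (0:ℝ) 1 := by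
  obtain ⟨f, h1, h2, h3⟩ := exists_contMDiffMap_zero_one_of_isClosed (n := (⊤ : ℕ∞)) (modelWithCornersSelf ℝ (ℝ × ℝ)) hs ht hd
  exact ⟨f, contMDiff_iff_contDiff.1 f.contMDiff, fun x hx => h1 hx, fun x hx => h2 hx, h3⟩

theorem bump {τ : ℝ × ℝ → ℝ} (hτ : IsNorm2 τ) {n : ℕ} {K : ℕ → Set (ℝ × ℝ)} {c : ℕ → ℝ × ℝ}
    (hK : ∀ i < n, IsCompact (K i)) (hO : ∀ i < n, K i ⊆ Oq)
    (hd : ∀ i j, i < j → j < n → Disjoint (K i) (K j)) (hc : ∀ i < n, dualNorm τ (c i) ≤ 1) :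
    ∃ f : ℝ × ℝ → ℝ × ℝ, ContDiff ℝ (⊤ : ℕ∞) f ∧ HasCompactSupport f ∧ tsupport f ⊆ Oq ∧
      (∀ x, dualNorm τ (f x) ≤ 1) ∧ ∃ r > 0, ∀ i < n, ∀ z ∈ K i, ∀ y, ‖y - z‖ ≤ r → f y = c i := by
  classical
  have E1 : ∀ i ∈ Finset.range n, ∀ᶠ r in nhdsWithin (0:ℝ) (Ioi 0), Metric.cthickening r (K i) ⊆ Oq := by
    intro i hi
    have hi := Finset.mem_range.1 hi
    obtain ⟨δ, hδ, h⟩ := (hK i hi).exists_cthickening_subset_open isOpen_Oq (hO i hi)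
    filter_upwards [Ioo_mem_nhdsGT hδ] with r hr
    exact (Metric.cthickening_mono hr.2.le _).trans h
  have E2 : ∀ j ∈ Finset.range n, ∀ i ∈ Finset.range j, ∀ᶠ r in nhdsWithin (0:ℝ) (Ioi 0),
      Disjoint (Metric.cthickening r (K i)) (Metric.cthickening r (K j)) := by
    intro j hj i hi
    have hj := Finset.mem_range.1 hj
    have hi := Finset.mem_range.1 hi
    obtain ⟨δ, hδ, h⟩ := (hd i j hi hj).exists_cthickenings (hK i (hi.trans hj)) (hK j hj).isClosed
    filter_upwards [Ioo_mem_nhdsGT hδ] with r hr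
    exact h.mono (Metric.cthickening_mono hr.2.le _) (Metric.cthickening_mono hr.2.le _)
  have E1' := (Filter.eventually_all_finset (Finset.range n)).2 E1
  have E2' := (Filter.eventually_all_finset (Finset.range n)).2
    fun j hj => (Filter.eventually_all_finset (Finset.range j)).2 (E2 j hj)
  obtain ⟨r, ⟨r1, r2⟩, r0⟩ := ((E1'.and E2').and (eventually_mem_nhdsWithin)).exists
  have r0 : 0 < r := r0
  have dis : ∀ i < n, ∀ j < n, i ≠ j → Disjoint (Metric.cthickening r (K i)) (Metric.cthickening r (K j)) := by
    intro i hi j hj hij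
    rcases lt_or_gt_of_ne hij with h | h
    · exact r2 j (Finset.mem_range.2 hj) i (Finset.mem_range.2 h)
    · exact (r2 i (Finset.mem_range.2 hi) j (Finset.mem_range.2 h)).symm
  have B : ∀ i, ∃ χ : ℝ × ℝ → ℝ, ContDiff ℝ (⊤ : ℕ∞) χ ∧ (∀ x ∉ Metric.thickening r (K i), χ x = 0) ∧
      (∀ x ∈ Metric.cthickening (r / 2) (K i), χ x = 1) ∧ ∀ x, χ x ∈ Icc (0:ℝ) 1 := fun i =>
    bump1 Metric.isOpen_thickening.isClosed_compl Metric.isClosed_cthickening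
      (disjoint_compl_left.mono_right (Metric.cthickening_subset_thickening' r0 (by linarith) _))
  choose χ χ1 χ2 χ3 χ4 using B
  set f : ℝ × ℝ → ℝ × ℝ := fun x => ∑ i ∈ Finset.range n, χ i x • c i with hf
  have fi : ∀ i < n, ∀ x ∈ Metric.thickening r (K i), f x = χ i x • c i := by
    intro i hi x hx
    refine Finset.sum_eq_single i (fun j hj hji => ?_) (fun h => absurd (Finset.mem_range.2 hi) h)
    rw [χ2 j x, zero_smul]
    intro hxj
    exact Set.disjoint_left.1 (dis j (Finset.mem_range.1 hj) i hi hji)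
      (Metric.thickening_subset_cthickening _ _ hxj) (Metric.thickening_subset_cthickening _ _ hx)
  have f0 : ∀ x, (∀ i < n, x ∉ Metric.thickening r (K i)) → f x = 0 := by
    intro x hx
    exact Finset.sum_eq_zero fun i hi => by rw [χ2 i x (hx i (Finset.mem_range.1 hi)), zero_smul]
  set Z : Set (ℝ × ℝ) := ⋃ i ∈ Finset.range n, Metric.cthickening r (K i) with hZ
  have Zc : IsCompact Z := (Finset.range n).isCompact_biUnion fun i hi => (hK i (Finset.mem_range.1 hi)).cthickening
  have fZ : ∀ x ∉ Z, f x = 0 := by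
    intro x hx
    refine f0 x fun i hi hxi => hx ?_
    exact mem_biUnion (Finset.mem_range.2 hi) (Metric.thickening_subset_cthickening _ _ hxi)
  have ts : tsupport f ⊆ Z := closure_minimal (fun x hx => by by_contra h; exact hx (fZ x h)) Zc.isClosed
  refine ⟨f, ?_, HasCompactSupport.intro Zc fZ, ?_, ?_, r / 2, half_pos r0, ?_⟩
  · exact ContDiff.sum fun i _ => (χ1 i).smul contDiff_const
  · refine ts.trans (iUnion₂_subset fun i hi => r1 i hi)
  · intro x
    rw [hτ.dual_iff]
    intro v
    by_cases hx : ∃ i < n, x ∈ Metric.thickening r (K i)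
    · obtain ⟨i, hi, hxi⟩ := hx
      rw [fi i hi x hxi]
      have k := (hτ.dual_iff _).1 (hc i hi) v
      have k' := χ4 i x
      have k'' := hτ.nonneg v
      simp only [Prod.smul_fst, Prod.smul_snd, smul_eq_mul]
      have := mul_le_mul_of_nonneg_left k k'.1
      have := mul_le_mul_of_nonneg_right k'.2 k''
      linarith
    · push Not at hx
      rw [f0 x hx]; simpa using hτ.nonneg v
  · intro i hi z hz y hy
    have : y ∈ Metric.cthickening (r / 2) (K i) :=
      Metric.mem_cthickening_of_dist_le y z _ _ hz (by rw [dist_eq_norm]; exact hy)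
    rw [fi i hi y (Metric.cthickening_subset_thickening' r0 (by linarith) _ this), χ3 i y this, one_smul]

theorem LenI.arcs {τ : ℝ × ℝ → ℝ} {Γ : ℝ → ℝ × ℝ} {s b x : ℝ} (h : LenI τ Γ s b x) :
    ∃ (n : ℕ) (p q : ℕ → ℝ), (∀ i < n, s ≤ p i ∧ p i < q i ∧ q i ≤ b ∧ ∀ z ∈ Ioo (p i) (q i), Γ z ∈ Oq) ∧
      (∀ i j, i < j → j < n → q i ≤ p j) ∧ x = ∑ i ∈ Finset.range n, rotN τ (Γ (q i) - Γ (p i)) := by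
  induction h with
  | nil => exact ⟨0, fun _ => 0, fun _ => 0, by simp, by simp, by simp⟩
  | skip b c x h1 h2 ih =>
    obtain ⟨n, p, q, k1, k2, k3⟩ := ih
    exact ⟨n, p, q, fun i hi => ⟨(k1 i hi).1, (k1 i hi).2.1, (k1 i hi).2.2.1.trans h2, (k1 i hi).2.2.2⟩, k2, k3⟩
  | add b c x h1 h2 h3 ih =>
    obtain ⟨n, p, q, k1, k2, k3⟩ := ih
    refine ⟨n + 1, fun i => if i < n then p i else b, fun i => if i < n then q i else c, ?_, ?_, ?_⟩
    · intro i hi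
      rcases Nat.lt_succ_iff_lt_or_eq.1 hi with h | rfl
      · simp only [h, if_true]
        exact ⟨(k1 i h).1, (k1 i h).2.1, (k1 i h).2.2.1.trans h2.le, (k1 i h).2.2.2⟩
      · simp only [lt_irrefl, if_false]
        exact ⟨h1.le, h2, le_rfl, h3⟩
    · intro i j hij hj
      rcases Nat.lt_succ_iff_lt_or_eq.1 hj with h | rfl
      · simp only [h, hij.trans h, if_true]; exact k2 i j hij h
      · simp only [hij, lt_irrefl, if_true, if_false]; exact (k1 i hij).2.2.1
    · rw [Finset.sum_range_succ, k3]
      congr 1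
      · refine Finset.sum_congr rfl fun i hi => ?_
        simp only [Finset.mem_range.1 hi, if_true]
      · simp

theorem field {τ : ℝ × ℝ → ℝ} (hτ : IsNorm2 τ) {Γ : ℝ → ℝ × ℝ} {α β : ℝ} (hab : α ≤ β)
    (hc : ContinuousOn Γ (Icc α β)) (hi : InjOn Γ (Icc α β)) {ε : ℝ} (hε : 0 < ε) :
    ∃ f : ℝ × ℝ → ℝ × ℝ, ContDiff ℝ (⊤ : ℕ∞) f ∧ HasCompactSupport f ∧ tsupport f ⊆ Oq ∧
      (∀ x, dualNorm τ (f x) ≤ 1) ∧ ∃ r > 0, ∃ (n : ℕ) (p q : ℕ → ℝ) (c : ℕ → ℝ × ℝ),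
        (∀ i < n, α ≤ p i ∧ p i ≤ q i ∧ q i ≤ β) ∧ (∀ i j, i < j → j < n → q i ≤ p j) ∧
        (∀ i < n, dualNorm τ (c i) ≤ 1) ∧
        (∀ i < n, ∀ t ∈ Icc (p i) (q i), ∀ y, ‖y - Γ t‖ ≤ r → f y = c i) ∧
        sSup {x | LenI τ Γ α β x} - ε ≤ ∑ i ∈ Finset.range n, lineI (fun _ => c i) 0 (Γ (q i) - Γ (p i)) := by
  obtain ⟨x, hx, hxL⟩ := exists_lt_of_lt_csSup (s := {x | LenI τ Γ α β x})
    ⟨0, LenI.skip _ _ _ LenI.nil hab⟩ (sub_lt_self _ hε)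
  obtain ⟨n, p, q, k1, k2, k3⟩ := LenI.arcs hx
  set P : ℕ → ℝ → ℝ := fun i κ => p i + κ * (q i - p i) with hP
  set Q : ℕ → ℝ → ℝ := fun i κ => q i - κ * (q i - p i) with hQ
  have PQ : ∀ i < n, ∀ κ ∈ Icc (0:ℝ) (1/4), p i ≤ P i κ ∧ P i κ ≤ Q i κ ∧ Q i κ ≤ q i := by
    intro i hi κ hκ
    have h0 : 0 < q i - p i := sub_pos.2 (k1 i hi).2.1
    have h1 := mul_nonneg hκ.1 h0.le
    have h2 := mul_le_mul_of_nonneg_right hκ.2 h0.le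
    simp only [hP, hQ]
    refine ⟨by linarith, by linarith, by linarith⟩
  have cont : ContinuousOn (fun κ => ∑ i ∈ Finset.range n, rotN τ (Γ (Q i κ) - Γ (P i κ))) (Icc (0:ℝ) (1/4)) := by
    refine continuousOn_finsetSum _ fun i hi => ?_
    have hi := Finset.mem_range.1 hi
    refine (rotN_norm hτ).continuous.comp_continuousOn ((hc.comp (by fun_prop) ?_).sub (hc.comp (by fun_prop) ?_))
    · intro κ hκ
      obtain ⟨a, b, c⟩ := PQ i hi κ hκ
      exact ⟨(k1 i hi).1.trans (a.trans b), c.trans (k1 i hi).2.2.1⟩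
    · intro κ hκ
      obtain ⟨a, b, c⟩ := PQ i hi κ hκ
      exact ⟨(k1 i hi).1.trans a, (b.trans c).trans (k1 i hi).2.2.1⟩
  have c0 := cont 0 ⟨le_rfl, by norm_num⟩
  have ev := c0.eventually (lt_mem_nhds (a := sSup {x | LenI τ Γ α β x} - ε) (by
    simpa [hP, hQ, ← k3] using hxL))
  have ev2 := ev.filter_mono (nhdsWithin_mono (0:ℝ) (Ioc_subset_Icc_self : Ioc (0:ℝ) (1/4) ⊆ _))
  have nb : (nhdsWithin (0:ℝ) (Ioc 0 (1/4))).NeBot := by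
    rw [nhdsWithin_Ioc_eq_nhdsGT (by norm_num)]; infer_instance
  obtain ⟨κ, κ1, κ2⟩ := (ev2.and eventually_mem_nhdsWithin).exists
  have PQ' : ∀ i < n, p i < P i κ ∧ P i κ ≤ Q i κ ∧ Q i κ < q i := by
    intro i hi
    have h0 : 0 < q i - p i := sub_pos.2 (k1 i hi).2.1
    have h1 := mul_pos κ2.1 h0
    refine ⟨?_, (PQ i hi κ ⟨κ2.1.le, κ2.2⟩).2.1, ?_⟩ <;> simp only [hP, hQ] <;> linarith
  have ex : ∀ i, ∃ w, dualNorm τ w ≤ 1 ∧ lineI (fun _ => w) 0 (Γ (Q i κ) - Γ (P i κ)) =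
      rotN τ (Γ (Q i κ) - Γ (P i κ)) := by
    intro i
    obtain ⟨w, w1, w2⟩ := hτ.dual_exists ((Γ (Q i κ) - Γ (P i κ)).2, -(Γ (Q i κ) - Γ (P i κ)).1)
    refine ⟨w, w1, ?_⟩
    rw [rotN, ← w2, lineI]; ring
  choose c c1 c2 using ex
  have sub : ∀ i < n, Icc (P i κ) (Q i κ) ⊆ Icc α β := fun i hi =>
    Icc_subset_Icc ((k1 i hi).1.trans (PQ' i hi).1.le) ((PQ' i hi).2.2.le.trans (k1 i hi).2.2.1)
  obtain ⟨f, f1, f2, f3, f4, r, r0, f5⟩ := bump hτ (n := n) (K := fun i => Γ '' Icc (P i κ) (Q i κ)) (c := c)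
    (fun i hi => isCompact_Icc.image_of_continuousOn (hc.mono (sub i hi)))
    (fun i hi => by
      rintro _ ⟨z, hz, rfl⟩
      exact (k1 i hi).2.2.2 z ⟨(PQ' i hi).1.trans_le hz.1, hz.2.trans_lt (PQ' i hi).2.2⟩)
    (fun i j hij hj => by
      rw [Set.disjoint_left]
      rintro _ ⟨z, hz, rfl⟩ ⟨z', hz', e⟩
      have := hi (sub j hj hz') (sub i (hij.trans hj) hz) e
      have := k2 i j hij hj
      have := (PQ' i (hij.trans hj)).2.2
      have := (PQ' j hj).1
      linarith [hz.2, hz'.1])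
    (fun i _ => c1 i)
  refine ⟨f, f1, f2, f3, f4, r, r0, n, fun i => P i κ, fun i => Q i κ, c, ?_, ?_, fun i _ => c1 i, ?_, ?_⟩
  · intro i hi
    exact ⟨(k1 i hi).1.trans (PQ' i hi).1.le, (PQ' i hi).2.1, (PQ' i hi).2.2.le.trans (k1 i hi).2.2.1⟩
  · intro i j hij hj
    have := k2 i j hij hj
    have := (PQ' i (hij.trans hj)).2.2
    have := (PQ' j hj).1
    simp only; linarith
  · intro i hi t ht y hy
    exact f5 i hi (Γ t) ⟨t, ht, rfl⟩ y hy
  · simp only [c2]; exact κ1.le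


theorem div2_cont {f : ℝ × ℝ → ℝ × ℝ} (hf : ContDiff ℝ 1 f) : Continuous (div2 f) := by
  have := hf.continuous_fderiv (by norm_num)
  unfold div2
  fun_prop

theorem div2_supp {f : ℝ × ℝ → ℝ × ℝ} (hf : HasCompactSupport f) : HasCompactSupport (div2 f) := by
  refine (hf.fderiv (𝕜 := ℝ)).mono fun x hx => ?_
  rw [Function.mem_support] at hx ⊢
  intro e; apply hx; simp [div2, e]

theorem div2_smul {f : ℝ × ℝ → ℝ × ℝ} (c : ℝ) (x : ℝ × ℝ) : div2 (c • f) x = c * div2 f x := by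
  unfold div2
  rw [fderiv_const_smul_field]
  simp; ring

theorem setInt_diff {A B : Set (ℝ × ℝ)} (hA : MeasurableSet A) (hB : MeasurableSet B) {g : ℝ × ℝ → ℝ}
    (hg : Integrable g) {M : ℝ} (hM : ∀ x, |g x| ≤ M) (hf : volume (symmDiff A B) ≠ ⊤) :
    |(∫ x in A, g x) - ∫ x in B, g x| ≤ M * (volume (symmDiff A B)).toReal := by
  rw [← integral_indicator hA, ← integral_indicator hB, ← integral_sub (hg.indicator hA) (hg.indicator hB)]
  have hm : MeasurableSet (symmDiff A B) := hA.symmDiff hB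
  have : M * (volume (symmDiff A B)).toReal = ∫ x, (symmDiff A B).indicator (fun _ => M) x := by
    rw [integral_indicator hm, setIntegral_const, Measure.real, smul_eq_mul, mul_comm]
  rw [this, ← Real.norm_eq_abs]
  refine norm_integral_le_of_norm_le ((integrable_indicator_iff hm).2 (integrableOn_const hf)) (ae_of_all _ fun x => ?_)
  have hM0 : 0 ≤ M := (abs_nonneg _).trans (hM x)
  by_cases a : x ∈ A <;> by_cases b : x ∈ B <;> simp [a, b, Set.mem_symmDiff, hM x]

theorem surfE_le {τ : ℝ × ℝ → ℝ} (hτ : IsNorm2 τ) {ρ : ℝ → ℝ × ℝ} (h : PL ρ 0 1) (J : JHyp ρ) :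
    surfE τ (hullSet (ρ '' Icc 0 1)) ≤ ENNReal.ofReal (∫ t in (0:ℝ)..1, iN τ (ρ t) (deriv ρ t)) := by
  obtain ⟨σ, hσ, he⟩ := energy_eq h J
  refine iSup₂_le fun f hf => ENNReal.ofReal_le_ofReal ?_
  obtain ⟨f1, f2, f3, f4⟩ := hf
  have f1' : ContDiff ℝ 1 f := f1.of_le (by exact_mod_cast le_top)
  have e := he f f1' f2
  have fz := field_zero f1'.continuous f3
  have up := lineInt_le hτ h f1'.continuous f4 fz
  have lo : -∫ t in (0:ℝ)..1, iN τ (ρ t) (deriv ρ t) ≤ ∫ t in (0:ℝ)..1, lineI f (ρ t) (deriv ρ t) := by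
    rw [← intervalIntegral.integral_neg]
    exact intervalIntegral.integral_mono_on h.le (lenInt hτ h).neg (h.intInt _ (lineI_cont f1'.continuous))
      fun t _ => neg_le_lineI' hτ (f4 _) (fz _) _
  rcases hσ with rfl | rfl <;> linarith

theorem Setup.main {Γ : ℝ → ℝ × ℝ} {α β : ℝ} (h : Setup Γ α β) {τ : ℝ × ℝ → ℝ} (hτ : IsNorm2 τ) {ε : ℝ} (hε : 0 < ε) :
    ∃ ρ : ℝ → ℝ × ℝ, PL ρ 0 1 ∧ JHyp ρ ∧ (∀ t ∈ Icc (0:ℝ) 1, ρ t ∈ Isq) ∧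
      Metric.hausdorffDist (Γ '' Icc 0 1) (ρ '' Icc 0 1) ≤ ε ∧
      surfE τ (hullSet (ρ '' Icc 0 1)) ≤ surfE τ (hullSet (Γ '' Icc 0 1)) + ENNReal.ofReal ε ∧
      volume (symmDiff (hullSet (Γ '' Icc 0 1)) (hullSet (ρ '' Icc 0 1))) ≤ ENNReal.ofReal ε := by
  have hα := h.hα
  have hαβ := h.hαβ
  have hβ := h.hβ
  have sub : Icc α β ⊆ Ico 0 1 := fun t ht => ⟨by linarith [ht.1], by linarith [ht.2]⟩
  have sub' : Icc α β ⊆ Icc 0 1 := sub.trans Ico_subset_Icc_self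
  set L := sSup {x | LenI τ Γ α β x} with hL
  set e' := ε / 8 with he'
  have he0 : 0 < e' := by positivity
  obtain ⟨f, f1, f2, f3, f4, r, r0, n, p, q, c, c1, c2, c3, c4, c5⟩ :=
    field hτ hαβ.le (h.cont.mono sub') (h.inj.mono sub) he0
  have f1' : ContDiff ℝ 1 f := f1.of_le (by exact_mod_cast le_top)
  have fz : ∀ p ∉ Oq, f p = 0 := fun p hp => image_eq_zero_of_notMem_tsupport fun hs => hp (f3 hs)
  obtain ⟨K, hK0, hK⟩ := (rotN_norm hτ).upper
  obtain ⟨M, hM⟩ := (div2_supp f2).exists_bound_of_continuous (div2_cont f1')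
  have hM0 : 0 ≤ M := (norm_nonneg _).trans (hM 0)
  have Cc : IsCompact (Γ '' Icc 0 1) := isCompact_Icc.image_of_continuousOn h.cont
  -- choice of the scale
  set v := min ε (e' / (M + 1)) with hv
  have hv0 : 0 < v := lt_min hε (by positivity)
  have tend := tendsto_measure_cthickening_of_isCompact (μ := volume) Cc
  rw [h.null] at tend
  have ev := tend.eventually (gt_mem_nhds (ENNReal.ofReal_pos.2 hv0))
  obtain ⟨d, hd0, hd⟩ := Metric.eventually_nhds_iff.1 ev
  set δ := min (min r ε) (min (d / 6) (e' / (n * (2 * K) + 1))) with hδ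
  have hδ0 : 0 < δ := lt_min (lt_min r0 hε) (lt_min (by positivity) (by positivity))
  have d1 : δ ≤ r := (min_le_left _ _).trans (min_le_left _ _)
  have d2 : δ ≤ ε := (min_le_left _ _).trans (min_le_right _ _)
  have d3 : δ ≤ d / 6 := (min_le_right _ _).trans (min_le_left _ _)
  have d4 : δ * (n * (2 * K) + 1) ≤ e' := by
    rw [← le_div_iff₀ (by positivity)]; exact (min_le_right _ _).trans (min_le_right _ _)
  obtain ⟨ρ, φ, P, J, rI, φc, φm, φ0, φ1, near, len⟩ := h.approx hτ hδ0
  have HC := hull_close h.jhyp J φc φm φ0 φ1 hδ0 near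
  have vol : volume (symmDiff (hullSet (Γ '' Icc 0 1)) (hullSet (ρ '' Icc 0 1))) ≤ ENNReal.ofReal v :=
    (measure_mono HC).trans (hd (y := 3 * δ) (by rw [Real.dist_eq, sub_zero, abs_of_pos (by positivity)]; linarith)).le
  refine ⟨ρ, P, J, rI, (haus_close φc φm φ0 φ1 hδ0 near).trans d2, ?_,
    vol.trans (ENNReal.ofReal_le_ofReal (min_le_left _ _))⟩
  -- energy
  have m01 : ∀ i < n, p i ∈ Icc (0:ℝ) 1 ∧ q i ∈ Icc (0:ℝ) 1 := fun i hi =>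
    ⟨sub' ⟨(c1 i hi).1, (c1 i hi).2.1.trans (c1 i hi).2.2⟩, sub' ⟨(c1 i hi).1.trans (c1 i hi).2.1, (c1 i hi).2.2⟩⟩
  have low := lower_sum hτ P f1'.continuous f4 fz (p := fun i => φ (p i)) (q := fun i => φ (q i)) (c := c) n
    (fun i hi => φ0 ▸ φm (m01 i hi).1.1) (fun i hi => φm (c1 i hi).2.1)
    (fun i j hij hj => φm (c2 i j hij hj))
    (fun i hi t ht => by
      obtain ⟨s, hs, rfl⟩ := intermediate_value_Icc (c1 i hi).2.1 φc.continuousOn ht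
      refine c4 i hi s hs _ ((near s ?_).trans d1)
      exact ⟨(m01 i hi).1.1.trans hs.1, hs.2.trans (m01 i hi).2.2⟩)
    1 mem01_1 (fun i hi => φ1 ▸ φm (m01 i hi).2.2)
  rw [intervalIntegral.integral_add (P.intInt _ (lineI_cont f1'.continuous)) (lenInt hτ P)] at low
  have cmp : ∑ i ∈ Finset.range n, (lineI (fun _ => c i) 0 (Γ (q i) - Γ (p i)) - 2 * K * δ) ≤
      ∑ i ∈ Finset.range n, lineI (fun _ => c i) 0 (ρ (φ (q i)) - ρ (φ (p i))) := by
    refine Finset.sum_le_sum fun i hi => ?_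
    have hi := Finset.mem_range.1 hi
    have n1 := near _ (m01 i hi).1
    have n2 := near _ (m01 i hi).2
    set u := (Γ (q i) - Γ (p i)) - (ρ (φ (q i)) - ρ (φ (p i))) with hu
    have e1 : lineI (fun _ => c i) 0 (Γ (q i) - Γ (p i)) =
        lineI (fun _ => c i) 0 (ρ (φ (q i)) - ρ (φ (p i))) + lineI (fun _ => c i) 0 u := by
      simp only [lineI, hu, Prod.fst_sub, Prod.snd_sub]; ring
    have e2 : lineI (fun _ => c i) 0 u ≤ rotN τ u := lineI_le hτ (c3 i hi) u
    have e3 : ‖u‖ ≤ 2 * δ := by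
      have : u = (ρ (φ (p i)) - Γ (p i)) - (ρ (φ (q i)) - Γ (q i)) := by rw [hu]; abel
      rw [this]
      have := norm_sub_le (ρ (φ (p i)) - Γ (p i)) (ρ (φ (q i)) - Γ (q i))
      linarith
    have e4 := hK u
    have e5 := mul_le_mul_of_nonneg_left e3 hK0.le
    linarith
  rw [Finset.sum_sub_distrib, Finset.sum_const, Finset.card_range, nsmul_eq_mul] at cmp
  have main : L - 4 * e' ≤ ∫ t in (0:ℝ)..1, lineI f (ρ t) (deriv ρ t) := by
    have : (n:ℝ) * (2 * K * δ) ≤ e' := by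
      have : (n:ℝ) * (2 * K * δ) = δ * (n * (2 * K) + 1) - δ := by ring
      linarith
    linarith
  obtain ⟨σ, hσ, he⟩ := energy_eq P J
  rw [he f f1' f2] at main
  have hσσ : |σ| = 1 := by rcases hσ with rfl | rfl <;> simp
  have vfin : volume (symmDiff (hullSet (Γ '' Icc 0 1)) (hullSet (ρ '' Icc 0 1))) ≠ ⊤ :=
    ne_top_of_le_ne_top ENNReal.ofReal_ne_top vol
  have df := setInt_diff (hull_meas h.jhyp) (hull_meas J)
    ((div2_cont f1').integrable_of_hasCompactSupport (div2_supp f2)) hM vfin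
  have vr : M * (volume (symmDiff (hullSet (Γ '' Icc 0 1)) (hullSet (ρ '' Icc 0 1)))).toReal ≤ e' := by
    have h1 := ENNReal.toReal_le_of_le_ofReal hv0.le vol
    have h2 : v ≤ e' / (M + 1) := min_le_right _ _
    have h3 : v * (M + 1) ≤ e' := by rwa [← le_div_iff₀ (by positivity)]
    have := mul_le_mul_of_nonneg_left h1 hM0
    linarith
  have low2 : L - 5 * e' ≤ σ * ∫ x in hullSet (Γ '' Icc 0 1), div2 f x := by
    have := abs_le.1 (df.trans vr)
    rcases hσ with rfl | rfl <;> linarith [this.1, this.2]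
  have mem : σ • f ∈ {f : ℝ × ℝ → ℝ × ℝ | ContDiff ℝ (⊤ : ℕ∞) f ∧ HasCompactSupport f ∧ tsupport f ⊆ Osq ∧
        ∀ x, dualNorm τ (f x) ≤ 1} := by
    have ss : Function.support (σ • f) ⊆ Function.support f := fun x hx => by
      rw [Function.mem_support] at hx ⊢
      intro e; apply hx; simp [e]
    refine ⟨contDiff_const.smul f1, f2.mono ss, (closure_mono ss).trans (f3.trans Oq_sub), fun x => ?_⟩
    rw [hτ.dual_iff]
    intro w
    have k1 := (hτ.dual_iff _).1 (f4 x) w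
    have k2 := (hτ.dual_iff _).1 (f4 x) (-w)
    rw [hτ.neg] at k2
    simp only [Prod.fst_neg, Prod.snd_neg] at k2
    rcases hσ with rfl | rfl <;> simp <;> linarith
  have fin : ENNReal.ofReal (L - 5 * e') ≤ surfE τ (hullSet (Γ '' Icc 0 1)) := by
    refine le_trans (ENNReal.ofReal_le_ofReal ?_) (le_iSup₂ (f := fun (f : ℝ × ℝ → ℝ × ℝ) _ =>
      ENNReal.ofReal (∫ x in hullSet (Γ '' Icc 0 1), div2 f x)) (σ • f) mem)
    simp only [div2_smul]
    rw [integral_const_mul]; exact low2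
  calc _ ≤ ENNReal.ofReal (∫ t in (0:ℝ)..1, iN τ (ρ t) (deriv ρ t)) := surfE_le hτ P J
    _ ≤ ENNReal.ofReal ((L - 5 * e') + ε) := ENNReal.ofReal_le_ofReal (by rw [he'] at *; linarith)
    _ ≤ ENNReal.ofReal (L - 5 * e') + ENNReal.ofReal ε := ENNReal.ofReal_add_le
    _ ≤ _ := by gcongr


theorem bv_null {γ : ℝ → ℝ × ℝ} {s : Set ℝ} (h : BoundedVariationOn γ s) :
    volume (γ '' s) = 0 := by
  rcases s.eq_empty_or_nonempty with rfl | ⟨a, ha⟩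
  · simp
  have hl := h.locallyBoundedVariationOn
  have hu := has_unit_speed_naturalParameterization γ hl ha
  set N := naturalParameterization γ s a
  set V := variationOnFromTo γ s a '' s
  have lip : LipschitzOnWith 1 N V := by
    have key : ∀ x ∈ V, ∀ y ∈ V, x ≤ y → edist (N x) (N y) ≤ edist x y := by
      intro x hx y hy hxy
      have h1 := eVariationOn.edist_le N (s := V ∩ Icc x y) ⟨hx, le_rfl, hxy⟩ ⟨hy, hxy, le_rfl⟩
      have h2 := hu hx hy
      rw [h2] at h1
      refine h1.trans ?_
      rw [edist_comm, edist_dist, Real.dist_eq, abs_of_nonneg (by linarith)]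
      simp
    intro x hx y hy
    rw [ENNReal.coe_one, one_mul]
    rcases le_total x y with hxy | hxy
    · exact key x hx y hy hxy
    · rw [edist_comm, edist_comm x]; exact key y hy x hx hxy
  have sub : γ '' s ⊆ N '' V := by
    rintro _ ⟨t, ht, rfl⟩
    exact ⟨_, ⟨t, ht, rfl⟩, edist_eq_zero.1 (edist_naturalParameterization_eq_zero hl ha ht)⟩
  have d1 : dimH (γ '' s) ≤ 1 := by
    refine (dimH_mono sub).trans (lip.dimH_image_le.trans ?_)
    rw [← Real.dimH_univ]; exact dimH_mono (subset_univ _)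
  rw [← hausdorffMeasure_prod_real]
  have := hausdorffMeasure_of_dimH_lt (X := ℝ × ℝ) (s := γ '' s) (d := 2) (lt_of_le_of_lt d1 (by norm_num))
  simpa using this

theorem norm_le_eNorm2 (v : ℝ × ℝ) : ‖v‖ ≤ eNorm2 v := by
  rw [Prod.norm_def]
  exact max_le (Real.abs_le_sqrt (by nlinarith [sq_nonneg v.2])) (Real.abs_le_sqrt (by nlinarith [sq_nonneg v.1]))

theorem bv_of_varLength {γ : ℝ → ℝ × ℝ} (h : varLength eNorm2 γ ≠ ⊤) : BoundedVariationOn γ (Icc 0 1) := by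
  refine ne_top_of_le_ne_top h (iSup_le ?_)
  rintro ⟨n, u, hu, hs⟩
  simp only
  set t' : ℕ → ℝ := fun i => if i = 0 then 0 else if n + 2 ≤ i then 1 else u (i - 1) with ht'
  have tm : Monotone t' := by
    refine monotone_nat_of_le_succ fun i => ?_
    simp only [ht']
    have hne : ¬ (i + 1 = 0) := Nat.succ_ne_zero i
    rw [if_neg hne]
    by_cases h0 : i = 0
    · rw [if_pos h0]
      by_cases h3 : n + 2 ≤ i + 1
      · rw [if_pos h3]; norm_num
      · rw [if_neg h3]; exact (hs _).1
    · rw [if_neg h0]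
      by_cases h2 : n + 2 ≤ i
      · rw [if_pos h2, if_pos (h2.trans (Nat.le_succ i))]
      · rw [if_neg h2]
        by_cases h3 : n + 2 ≤ i + 1
        · rw [if_pos h3]; exact (hs _).2
        · rw [if_neg h3]; exact hu (by omega)
  have key : ENNReal.ofReal (∑ i : Fin (n + 2), eNorm2 (γ (t' ((i : ℕ) + 1)) - γ (t' i))) ≤ varLength eNorm2 γ := by
    refine le_iSup_of_le (n + 2) (le_iSup_of_le (fun i : Fin (n + 2 + 1) => t' i) (le_iSup_of_le ⟨?_, ?_, ?_⟩ ?_))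
    · exact fun i j hij => tm hij
    · simp [ht']
    · simp [ht']
    · simp
  refine le_trans ?_ key
  rw [Fin.sum_univ_eq_sum_range (fun i => eNorm2 (γ (t' (i + 1)) - γ (t' i))), Finset.sum_range_succ',
    Finset.sum_range_succ]
  have pos : ∀ v, 0 ≤ eNorm2 v := fun v => Real.sqrt_nonneg _
  have e1 : ∑ i ∈ Finset.range n, edist (γ (u (i + 1))) (γ (u i)) ≤
      ENNReal.ofReal (∑ i ∈ Finset.range n, eNorm2 (γ (t' (i + 1 + 1)) - γ (t' (i + 1)))) := by
    rw [ENNReal.ofReal_sum_of_nonneg fun _ _ => pos _]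
    refine Finset.sum_le_sum fun i hi => ?_
    have hi := Finset.mem_range.1 hi
    have a1 : t' (i + 1) = u i := by
      have : ¬ (n + 2 ≤ i + 1) := by omega
      simp [ht', this]
    have a2 : t' (i + 1 + 1) = u (i + 1) := by
      have : ¬ (n + 2 ≤ i + 1 + 1) := by omega
      simp [ht', this]
    rw [a1, a2, edist_dist, dist_eq_norm]
    exact ENNReal.ofReal_le_ofReal (norm_le_eNorm2 _)
  refine e1.trans (ENNReal.ofReal_le_ofReal ?_)
  have := pos (γ (t' (n + 1 + 1)) - γ (t' (n + 1)))
  have := pos (γ (t' (0 + 1)) - γ (t' 0))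
  linarith

theorem bv_shift {γ : ℝ → ℝ × ℝ} (hp : ∀ t, γ (t + 1) = γ t) (h : BoundedVariationOn γ (Icc 0 1))
    {t0 : ℝ} (h0 : 0 ≤ t0) (h1 : t0 ≤ 1) : BoundedVariationOn (fun t => γ (t + t0)) (Icc 0 1) := by
  have k : BoundedVariationOn γ (Icc 1 2) := by
    refine ne_top_of_le_ne_top h (le_trans (le_of_eq ?_) (eVariationOn.comp_le_of_monotoneOn γ (s := Icc 0 1) (t := Icc 1 2)
      (fun t => t - 1) (fun x _ y _ hxy => by simp only; linarith) fun t ht => ⟨by linarith [ht.1], by linarith [ht.2]⟩))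
    congr 1
    ext t : 1
    have := hp (t - 1)
    rw [sub_add_cancel] at this
    exact this
  have k2 : BoundedVariationOn γ (Icc 0 2) := by
    have := eVariationOn.Icc_add_Icc γ (s := univ) (a := 0) (b := 1) (c := 2) zero_le_one one_le_two (mem_univ _)
    simp only [univ_inter] at this
    unfold BoundedVariationOn at *
    rw [← this]; exact ENNReal.add_ne_top.2 ⟨h, k⟩
  exact ne_top_of_le_ne_top k2 (eVariationOn.comp_le_of_monotoneOn γ (s := Icc 0 2) (t := Icc 0 1)
      (fun t => t + t0) (fun x _ y _ hxy => by simp only; linarith) fun t ht => ⟨by linarith [ht.1], by linarith [ht.2]⟩)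

theorem exists_arc {γ : ℝ → ℝ × ℝ} (hc : Continuous γ) (h1 : γ 1 = γ 0) (hi : InjOn γ (Ico 0 1))
    {K : Set (ℝ × ℝ)} (hK : IsPreconnected K) (hsub : K ⊆ γ '' Icc 0 1)
    {a b : ℝ} (ha : 0 < a) (hab : a < b) (hb : b < 1) (haK : γ a ∈ K) (hbK : γ b ∈ K) :
    ∃ c d, 0 < c ∧ c < d ∧ d < 1 ∧ ∀ t ∈ Ioo c d, γ t ∈ K := by
  by_contra hcon
  push Not at hcon
  obtain ⟨t1, m1, n1⟩ := hcon a b ha hab hb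
  obtain ⟨t2, m2, n2⟩ := hcon b ((b + 1) / 2) (ha.trans hab) (by linarith) (by linarith)
  have c1 : IsClosed (γ '' Icc t1 t2) := (isCompact_Icc.image hc).isClosed
  have c2 : IsClosed (γ '' (Icc 0 t1 ∪ Icc t2 1)) := ((isCompact_Icc.union isCompact_Icc).image hc).isClosed
  have := isPreconnected_closed_iff.1 hK _ _ c1 c2 (by
    rintro _ hx
    obtain ⟨t, ht, rfl⟩ := hsub hx
    rcases le_total t t1 with k | k
    · exact Or.inr ⟨t, Or.inl ⟨ht.1, k⟩, rfl⟩
    rcases le_total t t2 with k' | k'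
    · exact Or.inl ⟨t, ⟨k, k'⟩, rfl⟩
    · exact Or.inr ⟨t, Or.inr ⟨k', ht.2⟩, rfl⟩)
    ⟨γ b, hbK, b, ⟨m1.2.le, m2.1.le⟩, rfl⟩ ⟨γ a, haK, a, Or.inl ⟨ha.le, m1.1.le⟩, rfl⟩
  obtain ⟨y, hy, ⟨s, hs, rfl⟩, ⟨s', hs', e⟩⟩ := this
  have x1 : s ≠ t1 := fun e => n1 (e ▸ hy)
  have x2 : s ≠ t2 := fun e => n2 (e ▸ hy)
  have l1 : t1 < s := lt_of_le_of_ne hs.1 x1.symm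
  have l2 : s < t2 := lt_of_le_of_ne hs.2 x2
  have sI : s ∈ Ico (0:ℝ) 1 := ⟨by linarith [m1.1], by linarith [m2.2]⟩
  rcases hs' with hs' | hs'
  · have := hi ⟨hs'.1, by linarith [hs'.2, m1.2]⟩ sI e
    linarith [hs'.2]
  · rcases hs'.2.eq_or_lt with k | k
    · rw [k, h1] at e
      have := hi ⟨le_rfl, one_pos⟩ sI e
      linarith [m1.1]
    · have := hi ⟨by linarith [hs'.1, m2.1], k⟩ sI e
      linarith [hs'.1]


theorem side {m : ℝ × ℝ} (hm : m ∈ Isq) (ho : m ∉ Oq) (hc : ¬ (|m.1| = 1 ∧ |m.2| = 1)) :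
    ∃ e : ℂ, e ≠ 0 ∧ (∀ p ∈ Isq, 0 ≤ (e * cx (p - m)).re) ∧ (∀ p ∈ Oq, 0 < (e * cx (p - m)).re) ∧
      ∃ r > 0, ∀ p ∈ Isq \ Oq, ‖p - m‖ < r → (e * cx (p - m)).re = 0 := by
  obtain ⟨x, y⟩ := m
  simp only [mem_Isq, mem_Oq, Set.mem_sdiff] at *
  obtain ⟨⟨h1, h2⟩, h3, h4⟩ := hm
  have nrm : ∀ p : ℝ × ℝ, ∀ r, ‖p - (x, y)‖ < r → |p.1 - x| < r ∧ |p.2 - y| < r := by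
    intro p r h
    rw [Prod.norm_def] at h
    exact max_lt_iff.1 h
  have ax : |x| ≤ 1 := abs_le.2 ⟨h1, h2⟩
  have ay : |y| ≤ 1 := abs_le.2 ⟨h3, h4⟩
  by_cases hx : |x| = 1
  · have hy : |y| < 1 := lt_of_le_of_ne ay fun h => hc ⟨hx, h⟩
    have hy' := abs_lt.1 hy
    rcases (abs_eq zero_le_one).1 hx with rfl | rfl
    · refine ⟨-1, by simp, ?_, ?_, min 1 (1 - |y|), lt_min one_pos (by linarith), ?_⟩
      · rintro p ⟨⟨a, b⟩, c, d⟩; simp [cx_re, cx_im]; linarith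
      · rintro p ⟨⟨a, b⟩, c, d⟩; simp [cx_re, cx_im]; linarith
      · rintro p ⟨⟨⟨a, b⟩, c, d⟩, n⟩ hr
        obtain ⟨k1, k2⟩ := nrm p _ hr
        have k1 := abs_lt.1 (k1.trans_le (min_le_left _ _))
        have k2 := abs_lt.1 (k2.trans_le (min_le_right _ _))
        have := neg_abs_le y; have := le_abs_self y
        have : p.1 = 1 := by
          by_contra hne
          exact n ⟨⟨by linarith, lt_of_le_of_ne b hne⟩, by linarith, by linarith⟩
        simp [cx_re, cx_im, this]
    · refine ⟨1, by simp, ?_, ?_, min 1 (1 - |y|), lt_min one_pos (by linarith), ?_⟩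
      · rintro p ⟨⟨a, b⟩, c, d⟩; simp [cx_re, cx_im]; linarith
      · rintro p ⟨⟨a, b⟩, c, d⟩; simp [cx_re, cx_im]; linarith
      · rintro p ⟨⟨⟨a, b⟩, c, d⟩, n⟩ hr
        obtain ⟨k1, k2⟩ := nrm p _ hr
        have k1 := abs_lt.1 (k1.trans_le (min_le_left _ _))
        have k2 := abs_lt.1 (k2.trans_le (min_le_right _ _))
        have := neg_abs_le y; have := le_abs_self y
        have : p.1 = -1 := by
          by_contra hne
          exact n ⟨⟨lt_of_le_of_ne a (Ne.symm hne), by linarith⟩, by linarith, by linarith⟩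
        simp [cx_re, cx_im, this]
  · have hx : |x| < 1 := lt_of_le_of_ne ax hx
    have hx' := abs_lt.1 hx
    have hy : |y| = 1 := by
      by_contra hne
      have := abs_lt.1 (lt_of_le_of_ne ay hne)
      exact ho ⟨hx', this⟩
    rcases (abs_eq zero_le_one).1 hy with rfl | rfl
    · refine ⟨Complex.I, by simp, ?_, ?_, min 1 (1 - |x|), lt_min one_pos (by linarith), ?_⟩
      · rintro p ⟨⟨a, b⟩, c, d⟩; simp [cx_re, cx_im]; linarith
      · rintro p ⟨⟨a, b⟩, c, d⟩; simp [cx_re, cx_im]; linarith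
      · rintro p ⟨⟨⟨a, b⟩, c, d⟩, n⟩ hr
        obtain ⟨k1, k2⟩ := nrm p _ hr
        have k2 := abs_lt.1 (k2.trans_le (min_le_left _ _))
        have k1 := abs_lt.1 (k1.trans_le (min_le_right _ _))
        have := neg_abs_le x; have := le_abs_self x
        have : p.2 = 1 := by
          by_contra hne
          exact n ⟨⟨by linarith, by linarith⟩, by linarith, lt_of_le_of_ne d hne⟩
        simp [cx_re, cx_im, this]
    · refine ⟨-Complex.I, by simp, ?_, ?_, min 1 (1 - |x|), lt_min one_pos (by linarith), ?_⟩
      · rintro p ⟨⟨a, b⟩, c, d⟩; simp [cx_re, cx_im]; linarith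
      · rintro p ⟨⟨a, b⟩, c, d⟩; simp [cx_re, cx_im]; linarith
      · rintro p ⟨⟨⟨a, b⟩, c, d⟩, n⟩ hr
        obtain ⟨k1, k2⟩ := nrm p _ hr
        have k2 := abs_lt.1 (k2.trans_le (min_le_left _ _))
        have k1 := abs_lt.1 (k1.trans_le (min_le_right _ _))
        have := neg_abs_le x; have := le_abs_self x
        have : p.2 = -1 := by
          by_contra hne
          exact n ⟨⟨by linarith, by linarith⟩, lt_of_le_of_ne c (Ne.symm hne), by linarith⟩
        simp [cx_re, cx_im, this]

theorem reparam {g : ℝ → ℝ} {η : ℝ} (hη : 0 < η) (hc : ContinuousOn g (Icc 0 η)) (hi : InjOn g (Icc 0 η))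
    (h0 : g 0 = 0) : ∃ θ : ℝ → ℝ, (∀ t ∈ Icc 0 η, θ t ∈ Icc 0 η ∧ g (θ t) = t * (g η / η)) ∧
      InjOn θ (Icc 0 η) ∧ SurjOn θ (Icc 0 η) (Icc 0 η) ∧ θ 0 = 0 ∧ θ η = η := by
  have m0 : (0:ℝ) ∈ Icc 0 η := ⟨le_rfl, hη.le⟩
  have m1 : η ∈ Icc 0 η := ⟨hη.le, le_rfl⟩
  have gη : g η ≠ 0 := fun e => hη.ne' (hi m1 m0 (e.trans h0.symm))
  have key : ∀ s ∈ Icc 0 η, ∃ t ∈ Icc 0 η, g s = t * (g η / η) := by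
    intro s hs
    have : g s / g η ∈ Icc (0:ℝ) 1 := by
      rcases hc.strictMonoOn_of_injOn_Icc' hη.le hi with hm | hm
      · have a := hm.monotoneOn m0 hs hs.1
        have b := hm.monotoneOn hs m1 hs.2
        have c := hm m0 m1 hη
        rw [h0] at a c
        exact ⟨div_nonneg a c.le, (div_le_one c).2 b⟩
      · have a := hm.antitoneOn m0 hs hs.1
        have b := hm.antitoneOn hs m1 hs.2
        have c := hm m0 m1 hη
        rw [h0] at a c
        exact ⟨div_nonneg_of_nonpos a c.le, (div_le_one_of_neg c).2 b⟩
    refine ⟨g s / g η * η, ⟨mul_nonneg this.1 hη.le, by nlinarith [this.2]⟩, ?_⟩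
    field_simp
  have ex : ∀ t ∈ Icc 0 η, ∃ s ∈ Icc 0 η, g s = t * (g η / η) := by
    intro t ht
    have hc' : ContinuousOn g (uIcc 0 η) := by rwa [uIcc_of_le hη.le]
    have : t * (g η / η) ∈ uIcc (g 0) (g η) := by
      rw [h0]
      have e : t * (g η / η) = (t / η) * g η := by ring
      have a1 : 0 ≤ t / η := div_nonneg ht.1 hη.le
      have a2 : t / η ≤ 1 := (div_le_one hη).2 ht.2
      rw [e, mem_uIcc]
      rcases le_total 0 (g η) with k | k
      · left; exact ⟨mul_nonneg a1 k, by nlinarith⟩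
      · right; exact ⟨by nlinarith, mul_nonpos_of_nonneg_of_nonpos a1 k⟩
    obtain ⟨s, hs, e⟩ := intermediate_value_uIcc hc' this
    rw [uIcc_of_le hη.le] at hs
    exact ⟨s, hs, e⟩
  choose! θ hθ hθ' using ex
  have inj : ∀ t ∈ Icc 0 η, ∀ s ∈ Icc 0 η, g s = t * (g η / η) → θ t = s := by
    intro t ht s hs e
    exact hi (hθ t ht) hs ((hθ' t ht).trans e.symm)
  refine ⟨θ, fun t ht => ⟨hθ t ht, hθ' t ht⟩, ?_, ?_, ?_, ?_⟩
  · intro t ht s hs e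
    have a := hθ' t ht
    have b := hθ' s hs
    rw [e, b] at a
    exact (mul_right_cancel₀ (div_ne_zero gη hη.ne') a).symm
  · intro s hs
    obtain ⟨t, ht, e⟩ := key s hs
    exact ⟨t, ht, inj t ht s hs e⟩
  · exact inj 0 m0 0 m0 (by rw [h0, zero_mul])
  · exact inj η m1 η m1 (by field_simp)

theorem PL.seq {ρ : ℝ → ℝ × ℝ} {a b : ℝ} (h : PL ρ a b) :
    ∃ (n : ℕ) (s : Fin (n + 1) → ℝ), Monotone s ∧ s 0 = a ∧ s (Fin.last n) = b ∧
    ∀ i : Fin n, ∀ t ∈ Set.Icc (s i.castSucc) (s i.succ),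
      ρ t = ρ (s i.castSucc) +
        ((t - s i.castSucc) / (s i.succ - s i.castSucc)) • (ρ (s i.succ) - ρ (s i.castSucc)) := by
  induction h with
  | nil => exact ⟨0, fun _ => a, monotone_const, rfl, rfl, fun i => i.elim0⟩
  | snoc b c d h1 h2 h3 ih =>
    obtain ⟨n, s, hm, s0, s1, hl⟩ := ih
    refine ⟨n + 1, Fin.snoc s c, ?_, ?_, ?_, ?_⟩
    · refine Fin.monotone_iff_le_succ.2 fun i => ?_
      refine Fin.lastCases ?_ (fun j => ?_) i
      · rw [Fin.succ_last, Fin.snoc_last, Fin.snoc_castSucc, s1]; exact h2.le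
      · rw [Fin.succ_castSucc, Fin.snoc_castSucc, Fin.snoc_castSucc]
        exact hm (Fin.castSucc_le_succ j)
    · rw [← Fin.castSucc_zero, Fin.snoc_castSucc]; exact s0
    · rw [Fin.snoc_last]
    · intro i
      refine Fin.lastCases ?_ (fun j => ?_) i
      · rw [Fin.succ_last, Fin.snoc_last, Fin.snoc_castSucc, s1]
        intro t ht
        rw [h3 t ht, h3 c ⟨h2.le, le_rfl⟩, add_sub_cancel_left, smul_smul, div_mul_cancel₀]
        linarith
      · rw [Fin.succ_castSucc, Fin.snoc_castSucc, Fin.snoc_castSucc]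
        exact hl j


theorem setup_local {γ : ℝ → ℝ × ℝ} (hc : Continuous γ) (hp : ∀ t, γ (t + 1) = γ t)
    (hi : ∀ x y, γ x = γ y → |x - y| < 1 → x = y) (hm : ∀ t, γ t ∈ Isq)
    (hbv : BoundedVariationOn γ (Icc 0 1)) {e : ℂ} (he : e ≠ 0)
    (p1 : ∀ p ∈ Isq, 0 ≤ (e * cx (p - γ 0)).re) (p2 : ∀ p ∈ Oq, 0 < (e * cx (p - γ 0)).re)
    {η : ℝ} (h0 : 0 < η) (h4 : η < 1 / 4) (hz : ∀ s, |s| ≤ η → (e * cx (γ s - γ 0)).re = 0) :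
    ∃ Γ : ℝ → ℝ × ℝ, Setup Γ η (1 - η) ∧ Γ '' Icc 0 1 = γ '' Icc 0 1 := by
  obtain ⟨u, hu⟩ : ∃ u, e * cx u = Complex.I := by
    refine ⟨((e⁻¹ * Complex.I).re, (e⁻¹ * Complex.I).im), ?_⟩
    have : cx ((e⁻¹ * Complex.I).re, (e⁻¹ * Complex.I).im) = e⁻¹ * Complex.I := by
      apply Complex.ext
      · rw [cx_re]
      · rw [cx_im]
    rw [this, mul_inv_cancel_left₀ he]
  obtain ⟨g, hg⟩ : ∃ g : ℝ → ℝ, g = fun s => (e * cx (γ s - γ 0)).im := ⟨_, rfl⟩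
  have gc : Continuous g := by
    rw [hg]
    exact Complex.continuous_im.comp (continuous_const.mul (cx_continuous.comp (hc.sub continuous_const)))
  have g0 : g 0 = 0 := by
    rw [hg]; simp only [sub_self]
    rw [show cx 0 = 0 from map_zero Complex.equivRealProdCLM.symm]; simp
  have rep : ∀ s, |s| ≤ η → γ s = γ 0 + g s • u := by
    intro s hs
    have h1 := hz s hs
    have : e * cx (γ s - γ 0) = e * cx (g s • u) := by
      rw [cx_smul, mul_left_comm, hu]
      apply Complex.ext
      · simp [h1]
      · simp [hg]
    have := cx_inj (mul_left_cancel₀ he this)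
    rw [← this]; abel
  have gi : ∀ x y, |x| ≤ η → |y| ≤ η → g x = g y → x = y := by
    intro x y hx hy h
    refine hi x y (by rw [rep x hx, rep y hy, h]) ?_
    rw [abs_le] at hx hy
    rw [abs_lt]; constructor <;> linarith
  have abI : ∀ x ∈ Icc 0 η, |x| ≤ η := fun x hx => abs_le.2 ⟨by linarith [hx.1], hx.2⟩
  obtain ⟨θ1, a1, b1, c1, d1, e1⟩ := reparam h0 gc.continuousOn
    (fun x hx y hy h => gi x y (abI x hx) (abI y hy) h) g0
  obtain ⟨θ2, a2, b2, c2, d2, e2⟩ := reparam (g := fun s => g (-s)) h0 (gc.comp continuous_neg).continuousOn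
    (fun x hx y hy h => neg_injective (gi (-x) (-y) (by rw [abs_neg]; exact abI x hx)
      (by rw [abs_neg]; exact abI y hy) h)) (by simp [g0])
  obtain ⟨θ, hθ⟩ : ∃ θ : ℝ → ℝ, θ = fun t => if t ≤ η then θ1 t else if t ≤ 1 - η then t else 1 - θ2 (1 - t) :=
    ⟨_, rfl⟩
  have T1 : ∀ t ∈ Icc 0 η, θ t = θ1 t := by
    intro t ht; rw [hθ]; simp only; rw [if_pos ht.2]
  have T2 : ∀ t ∈ Icc η (1 - η), θ t = t := by
    intro t ht
    rcases ht.1.eq_or_lt with k | k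
    · rw [← k, T1 η ⟨h0.le, le_rfl⟩, e1]
    · rw [hθ]; simp only; rw [if_neg (not_le.2 k), if_pos ht.2]
  have T3 : ∀ t ∈ Icc (1 - η) 1, θ t = 1 - θ2 (1 - t) := by
    intro t ht
    rcases ht.1.eq_or_lt with k | k
    · rw [← k, T2 _ ⟨by linarith, le_rfl⟩, _root_.sub_sub_cancel, e2]
    · rw [hθ]; simp only; rw [if_neg (by linarith), if_neg (not_le.2 k)]
  have L1 : ∀ t ∈ Icc 0 η, γ (θ t) = γ 0 + t • ((g η / η) • u) := by
    intro t ht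
    rw [T1 t ht, rep _ (abI _ (a1 t ht).1), (a1 t ht).2, smul_smul]
  have L3 : ∀ t ∈ Icc (1 - η) 1, γ (θ t) = γ 0 + (t - 1) • (-(g (-η) / η) • u) := by
    intro t ht
    have m : 1 - t ∈ Icc 0 η := ⟨by linarith [ht.2], by linarith [ht.1]⟩
    have k := a2 _ m
    have q : γ (1 - θ2 (1 - t)) = γ (-θ2 (1 - t)) := by rw [← hp (-θ2 (1 - t))]; congr 1; ring
    rw [T3 t ht, q, rep _ (by rw [abs_neg]; exact abI _ k.1), k.2, smul_smul]
    congr 2; ring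
  have θ0 : θ 0 = 0 := by rw [T1 0 ⟨le_rfl, h0.le⟩, d1]
  have θ_1 : θ 1 = 1 := by rw [T3 1 ⟨by linarith, le_rfl⟩, sub_self, d2, sub_zero]
  have R1 : ∀ t, 0 ≤ t → t ≤ η → 0 ≤ θ t ∧ θ t ≤ η := by
    intro t ht ht'; rw [T1 t ⟨ht, ht'⟩]; exact (a1 t ⟨ht, ht'⟩).1
  have R3 : ∀ t, 1 - η < t → t ≤ 1 → 1 - η < θ t ∧ θ t ≤ 1 := by
    intro t ht ht'
    have m : 1 - t ∈ Icc 0 η := ⟨by linarith, by linarith⟩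
    have k := (a2 _ m).1
    rw [T3 t ⟨ht.le, ht'⟩]
    refine ⟨?_, by linarith [k.1]⟩
    have : θ2 (1 - t) ≠ η := by
      intro h
      have := b2 m ⟨h0.le, le_rfl⟩ (h.trans e2.symm)
      linarith
    have := lt_of_le_of_ne k.2 this
    linarith
  have Rm : ∀ t ∈ Icc (0:ℝ) 1, θ t ∈ Icc (0:ℝ) 1 := by
    intro t ht
    rcases le_or_gt t η with k | k
    · have := R1 t ht.1 k; exact ⟨this.1, by linarith⟩
    rcases le_or_gt t (1 - η) with k' | k'
    · rw [T2 t ⟨k.le, k'⟩]; exact ht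
    · have := R3 t k' ht.2; exact ⟨by linarith, this.2⟩
  have Tinj : InjOn θ (Icc 0 1) := by
    have ca : ∀ t, 0 ≤ t → t ≤ 1 → (t ≤ η ∧ 0 ≤ θ t ∧ θ t ≤ η) ∨ (η < t ∧ t ≤ 1 - η ∧ θ t = t) ∨
        (1 - η < t ∧ 1 - η < θ t ∧ θ t ≤ 1) := by
      intro t ht ht'
      rcases le_or_gt t η with k | k
      · exact Or.inl ⟨k, R1 t ht k⟩
      rcases le_or_gt t (1 - η) with k' | k'
      · exact Or.inr (Or.inl ⟨k, k', T2 t ⟨k.le, k'⟩⟩)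
      · exact Or.inr (Or.inr ⟨k', R3 t k' ht'⟩)
    intro t ht s hs h
    rcases ca t ht.1 ht.2 with x | x | x <;> rcases ca s hs.1 hs.2 with y | y | y
    · rw [T1 t ⟨ht.1, x.1⟩, T1 s ⟨hs.1, y.1⟩] at h
      exact b1 ⟨ht.1, x.1⟩ ⟨hs.1, y.1⟩ h
    · linarith [x.2.2, y.2.2, y.1]
    · linarith [x.2.2, y.2.1]
    · linarith [y.2.2, x.2.2, x.1]
    · linarith [y.2.2, x.2.2]
    · linarith [y.2.1, x.2.2, x.2.1]
    · linarith [y.2.2, x.2.1]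
    · linarith [x.2.1, y.2.2, y.2.1]
    · rw [T3 t ⟨x.1.le, ht.2⟩, T3 s ⟨y.1.le, hs.2⟩] at h
      have := b2 ⟨by linarith [ht.2], by linarith [x.1]⟩ ⟨by linarith [hs.2], by linarith [y.1]⟩ (sub_right_injective h)
      linarith
  have Tsurj : SurjOn θ (Icc 0 1) (Icc 0 1) := by
    intro s hs
    rcases le_or_gt s η with k | k
    · obtain ⟨t, ht, rfl⟩ := c1 ⟨hs.1, k⟩
      exact ⟨t, ⟨ht.1, by linarith [ht.2]⟩, T1 t ht⟩
    rcases le_or_gt s (1 - η) with k' | k'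
    · exact ⟨s, hs, T2 s ⟨k.le, k'⟩⟩
    · obtain ⟨t, ht, h⟩ := c2 (show 1 - s ∈ Icc 0 η from ⟨by linarith [hs.2], by linarith⟩)
      refine ⟨1 - t, ⟨by linarith [ht.2], by linarith [ht.1]⟩, ?_⟩
      rw [T3 _ ⟨by linarith [ht.2], by linarith [ht.1]⟩, _root_.sub_sub_cancel, h, _root_.sub_sub_cancel]
  have γ1 : γ 1 = γ 0 := by have := hp 0; rwa [zero_add] at this
  have im : (fun t => γ (θ t)) '' Icc 0 1 = γ '' Icc 0 1 := by
    apply Subset.antisymm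
    · rintro _ ⟨t, ht, rfl⟩; exact ⟨θ t, Rm t ht, rfl⟩
    · rintro _ ⟨s, hs, rfl⟩
      obtain ⟨t, ht, rfl⟩ := Tsurj hs
      exact ⟨t, ht, rfl⟩
  have E2 : EqOn (fun t => γ (θ t)) γ (Icc η (1 - η)) := fun t ht => by simp only; rw [T2 t ht]
  refine ⟨fun t => γ (θ t), ⟨?_, ?_, ?_, h0, by linarith, by linarith, fun t _ => hm _, ?_, ?_, ?_⟩, im⟩
  · have k1 : ContinuousOn (fun t => γ (θ t)) (Icc 0 η) :=
      ContinuousOn.congr (f := fun t : ℝ => γ 0 + t • ((g η / η) • u)) (by fun_prop) L1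
    have k2 : ContinuousOn (fun t => γ (θ t)) (Icc η (1 - η)) := hc.continuousOn.congr E2
    have k3 : ContinuousOn (fun t => γ (θ t)) (Icc (1 - η) 1) :=
      ContinuousOn.congr (f := fun t : ℝ => γ 0 + (t - 1) • (-(g (-η) / η) • u)) (by fun_prop) L3
    have := (k1.union_of_isClosed k2 isClosed_Icc isClosed_Icc).union_of_isClosed k3
      (isClosed_Icc.union isClosed_Icc) isClosed_Icc
    rwa [Icc_union_Icc_eq_Icc h0.le (by linarith), Icc_union_Icc_eq_Icc (by linarith) (by linarith)] at this
  · intro t ht s hs h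
    have t1 : ∀ t ∈ Ico (0:ℝ) 1, 0 ≤ θ t ∧ θ t < 1 := by
      intro t ht
      have := Rm t ⟨ht.1, ht.2.le⟩
      refine ⟨this.1, lt_of_le_of_ne this.2 fun h => ?_⟩
      exact ht.2.ne (Tinj ⟨ht.1, ht.2.le⟩ ⟨zero_le_one, le_rfl⟩ (h.trans θ_1.symm))
    have x := t1 t ht
    have y := t1 s hs
    have := hi _ _ h (by rw [abs_lt]; constructor <;> linarith)
    exact Tinj ⟨ht.1, ht.2.le⟩ ⟨hs.1, hs.2.le⟩ this
  · rw [θ0, θ_1, γ1]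
  · unfold BoundedVariationOn
    rw [eVariationOn.congr E2]
    exact hbv.mono (Icc_subset_Icc h0.le (by linarith))
  · rw [im]; exact bv_null hbv
  · simp only [θ0]
    have r0 : ∀ c : ℝ, (e * cx (c • u)).re = 0 := by
      intro c; rw [cx_smul, mul_left_comm, hu]; simp
    exact ⟨e, _, _, he, p1, p2, r0 _, r0 _, L1, L3⟩

theorem setup_exists {C : Set (ℝ × ℝ)} (hC : IsRectJordanCurve C) (hCsub : C ⊆ Isq)
    {γ₁ : ℝ → ℝ × ℝ} (h₁c : ContinuousOn γ₁ (Set.Icc 0 1)) (h₁inj : Set.InjOn γ₁ (Set.Icc 0 1))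
    (hsub : γ₁ '' Set.Icc 0 1 ⊆ C) (h₁bd : γ₁ '' Set.Icc 0 1 ⊆ frontier Isq) :
    ∃ Γ α β, Setup Γ α β ∧ Γ '' Icc 0 1 = C := by
  obtain ⟨γ, hc, hp, hi, rfl, hv⟩ := hC
  have hP : Function.Periodic γ 1 := hp
  have hbv := bv_of_varLength hv
  have rng : γ '' Icc 0 1 = range γ := by
    have := hP.image_Icc one_pos 0
    rwa [zero_add] at this
  have γ1 : γ 1 = γ 0 := by have := hp 0; rwa [zero_add] at this
  have hfr : ∀ x, γ (Int.fract x) = γ x := by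
    intro x
    have := hP.sub_int_mul_eq (x := x) ⌊x⌋
    rw [mul_one] at this
    exact this
  have inj : ∀ x y, γ x = γ y → |x - y| < 1 → x = y := by
    intro x y h hxy
    have : Int.fract x = Int.fract y :=
      hi ⟨Int.fract_nonneg _, Int.fract_lt_one _⟩ ⟨Int.fract_nonneg _, Int.fract_lt_one _⟩ (by rw [hfr, hfr, h])
    obtain ⟨z, hz⟩ := Int.fract_eq_fract.1 this
    rw [hz] at hxy
    have : |z| < 1 := by exact_mod_cast hxy
    have := Int.abs_lt_one_iff.1 this
    rw [this] at hz
    push_cast at hz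
    linarith
  have hK : IsPreconnected (γ₁ '' Icc 0 1) := isPreconnected_Icc.image _ h₁c
  have m0 : (0:ℝ) ∈ Icc (0:ℝ) 1 := ⟨le_rfl, zero_le_one⟩
  have m1 : (1:ℝ) ∈ Icc (0:ℝ) 1 := ⟨zero_le_one, le_rfl⟩
  have mh : (1/2:ℝ) ∈ Icc (0:ℝ) 1 := ⟨by norm_num, by norm_num⟩
  have two : ∃ q ∈ γ₁ '' Icc 0 1, ∃ q' ∈ γ₁ '' Icc 0 1, q ≠ q' ∧ q ≠ γ 0 ∧ q' ≠ γ 0 := by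
    have d1 : γ₁ 0 ≠ γ₁ (1/2) := fun h => by have := h₁inj m0 mh h; norm_num at this
    have d2 : γ₁ 0 ≠ γ₁ 1 := fun h => by have := h₁inj m0 m1 h; norm_num at this
    have d3 : γ₁ (1/2) ≠ γ₁ 1 := fun h => by have := h₁inj mh m1 h; norm_num at this
    by_cases e0 : γ₁ 0 = γ 0
    · exact ⟨_, ⟨_, mh, rfl⟩, _, ⟨_, m1, rfl⟩, d3, e0 ▸ d1.symm, e0 ▸ d2.symm⟩
    · by_cases e1 : γ₁ 1 = γ 0
      · exact ⟨_, ⟨_, m0, rfl⟩, _, ⟨_, mh, rfl⟩, d1, e0, e1 ▸ d3⟩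
      · exact ⟨_, ⟨_, m0, rfl⟩, _, ⟨_, m1, rfl⟩, d2, e0, e1⟩
  obtain ⟨q, hq, q', hq', hne, hn, hn'⟩ := two
  have pre : ∀ q ∈ γ₁ '' Icc 0 1, q ≠ γ 0 → ∃ a, 0 < a ∧ a < 1 ∧ γ a = q := by
    intro q hq hn
    obtain ⟨a, ha, rfl⟩ := hsub hq
    refine ⟨a, lt_of_le_of_ne ha.1 ?_, lt_of_le_of_ne ha.2 ?_, rfl⟩
    · rintro rfl; exact hn rfl
    · rintro rfl; exact hn γ1
  obtain ⟨a, a0, a1, rfl⟩ := pre q hq hn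
  obtain ⟨b, b0, b1, rfl⟩ := pre q' hq' hn'
  have arc : ∃ c d, 0 < c ∧ c < d ∧ d < 1 ∧ ∀ t ∈ Ioo c d, γ t ∈ γ₁ '' Icc 0 1 := by
    rcases lt_trichotomy a b with h | h | h
    · exact exists_arc hc γ1 hi hK hsub a0 h b1 hq hq'
    · exact absurd (by rw [h]) hne
    · exact exists_arc hc γ1 hi hK hsub b0 h a1 hq' hq
  obtain ⟨c, d, c0, cd, d1, hcd⟩ := arc
  have injI : InjOn γ (Ioo c d) := hi.mono fun t (ht : t ∈ Ioo c d) =>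
    show t ∈ Ico (0:ℝ) 1 from ⟨by linarith [ht.1], by linarith [ht.2]⟩
  obtain ⟨_, ⟨t0, ht0, rfl⟩, hcorner⟩ := ((Ioo_infinite cd).image injI).exists_notMem_finite
    (t := {p : ℝ × ℝ | |p.1| = 1 ∧ |p.2| = 1}) (by
      refine Set.Finite.subset (((Set.toFinite {(1:ℝ), -1}).prod (Set.toFinite {(1:ℝ), -1}))) ?_
      rintro ⟨x, y⟩ ⟨h1, h2⟩
      exact ⟨(abs_eq zero_le_one).1 h1, (abs_eq zero_le_one).1 h2⟩)
  have hfro : ∀ t ∈ Ioo c d, γ t ∈ Isq \ Oq := fun t ht => frontier_Isq ▸ h₁bd (hcd t ht)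
  obtain ⟨e, he, p1, p2, r, hr, p3⟩ := side (hfro t0 ht0).1 (hfro t0 ht0).2 hcorner
  have ev : ∀ᶠ t in nhds t0, ‖γ t - γ t0‖ < r := by
    have := Metric.tendsto_nhds.1 (hc.continuousAt (x := t0)).tendsto r hr
    simpa [dist_eq_norm] using this
  have ev2 : ∀ᶠ t in nhds t0, t ∈ Ioo c d := Ioo_mem_nhds ht0.1 ht0.2
  obtain ⟨δ, δ0, hδ⟩ := Metric.eventually_nhds_iff.1 (ev.and ev2)
  obtain ⟨η, η0, η1⟩ : ∃ η, 0 < η ∧ η < min δ (1/4) := exists_between (lt_min δ0 (by norm_num))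
  have mem : ∀ t, γ t ∈ Isq := fun t => hCsub (rng ▸ mem_range_self t)
  obtain ⟨Γ, hΓ, hΓ'⟩ := setup_local (γ := fun t => γ (t + t0)) (hc.comp (continuous_id.add continuous_const))
    (fun t => by rw [← hp (t + t0)]; congr 1; ring)
    (fun x y h hxy => by
      have := inj _ _ h (by rwa [add_sub_add_right_eq_sub])
      linarith)
    (fun t => mem _) (bv_shift hp hbv (by linarith [ht0.1]) (by linarith [ht0.2])) he
    (by simpa using p1) (by simpa using p2) η0 (η1.trans_le (min_le_right _ _)) (by
      intro s hs
      have hd : dist (s + t0) t0 < δ := by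
        rw [Real.dist_eq, add_sub_cancel_right]; exact hs.trans_lt (η1.trans_le (min_le_left _ _))
      have := hδ hd
      have := p3 _ (hfro _ this.2) this.1
      simpa using this)
  refine ⟨Γ, _, _, hΓ, hΓ'.trans ?_⟩
  have hP' : Function.Periodic (fun t => γ (t + t0)) 1 := fun t => by
    simp only; rw [← hp (t + t0)]; congr 1; ring
  have := hP'.image_Icc one_pos 0
  rw [zero_add] at this
  rw [this, rng]
  ext x; constructor
  · rintro ⟨t, rfl⟩; exact ⟨_, rfl⟩
  · rintro ⟨t, rfl⟩; exact ⟨t - t0, by simp⟩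

theorem polygonal_approximation_jordan (τ : ℝ × ℝ → ℝ) (hτ : IsNorm2 τ)
    (C : Set (ℝ × ℝ)) (hC : IsRectJordanCurve C) (hCsub : C ⊆ Isq)
    (γ₁ γ₂ : ℝ → ℝ × ℝ)
    (h₁c : ContinuousOn γ₁ (Set.Icc 0 1)) (h₁inj : Set.InjOn γ₁ (Set.Icc 0 1))
    (h₂c : ContinuousOn γ₂ (Set.Icc 0 1)) (h₂inj : Set.InjOn γ₂ (Set.Icc 0 1))
    (hunion : C = γ₁ '' Set.Icc 0 1 ∪ γ₂ '' Set.Icc 0 1)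
    (h₁bd : γ₁ '' Set.Icc 0 1 ⊆ frontier Isq)
    (h₂int : γ₂ '' Set.Ioo 0 1 ⊆ Osq)
    (hcat₁ : γ₁ 1 = γ₂ 0) (hcat₂ : γ₂ 1 = γ₁ 0)
    (ε : ℝ) (hε : 0 < ε) :
    ∃ ρ : ℝ → ℝ × ℝ, IsPolygonal ρ ∧ Set.InjOn ρ (Set.Ico 0 1) ∧ ρ 1 = ρ 0 ∧
      ρ '' Set.Icc 0 1 ⊆ Isq ∧
      Metric.hausdorffDist C (ρ '' Set.Icc 0 1) ≤ ε ∧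
      surfE τ (hullSet (ρ '' Set.Icc 0 1)) ≤ surfE τ (hullSet C) + ENNReal.ofReal ε ∧
      volume (symmDiff (hullSet C) (hullSet (ρ '' Set.Icc 0 1))) ≤ ENNReal.ofReal ε := by
  obtain ⟨Γ, α, β, hS, rfl⟩ := setup_exists hC hCsub h₁c h₁inj (hunion ▸ subset_union_left) h₁bd
  obtain ⟨ρ, hpl, hJ, hm, h1, h2, h3⟩ := hS.main hτ hε
  refine ⟨ρ, hpl.seq, hJ.inj, hJ.closed, ?_, h1, h2, h3⟩
  rintro _ ⟨t, ht, rfl⟩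
  exact hm t ht
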